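/- Let N ≥ 2 and 0 < c₁⁰ < c₂⁰ < … < c_N⁰. There exist constants α₀, A₀, L₀, γ₀ > 0 such that the following holds. Let L > L₀, α ∈ (0, α₀), and x₁⁰ < x₂⁰ < … < x_N⁰ with x_j⁰ > x_{j-1}⁰ + L for j = 2, …, N. Let u be a classical solution of the KdV equation such that ‖u(0,·) − Σ_{j=1}^N Q_{c_j⁰}(· − x_j⁰)‖_{L²(ℝ)} ≤ α. Then there exist functions x₁, …, x_N : [0,∞) → ℝ such that sup_{t ≥ 0} ‖u(t,·) − Σ_{j=1}^N Q_{c_j⁰}(· − x_j(t))‖_{L²(ℝ)} ≤ A₀ (α + e^{−γ₀ L}). -/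

import Mathlib

open MeasureTheory Filter Real

/-- The KdV soliton profile `Q_c(s) = 3c / (1 + cosh(√c s))`. -/
noncomputable def Q (c s : ℝ) : ℝ := 3 * c / (1 + Real.cosh (Real.sqrt c * s))

/-- Squared `L²(ℝ)` norm. -/
noncomputable def L2sq (f : ℝ → ℝ) : ℝ := ∫ x : ℝ, (f x) ^ 2

/-- `f` satisfies the Schwartz class decay estimates. -/
def IsSchwartzFn (f : ℝ → ℝ) : Prop :=
  ∀ k n : ℕ, ∃ C : ℝ, ∀ x : ℝ, |x| ^ k * |iteratedDeriv n f x| ≤ C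

/-- `u` is a classical solution of the KdV equation `u_t + (u_xx + u²)_x = 0`,
smooth and Schwartz in space for each time. -/
def IsKdVSolution (u : ℝ → ℝ → ℝ) : Prop :=
  ContDiff ℝ (⊤ : ℕ∞) (Function.uncurry u) ∧ (∀ t : ℝ, IsSchwartzFn (u t)) ∧
  ∀ t x : ℝ,
    deriv (fun τ => u τ x) t +
      deriv (fun y => deriv (deriv (u t)) y + (u t y) ^ 2) x = 0

section SolitonTrains

open Set Topology Function

/-- Pointwise regularity of a solution of `q_t + q_xxx + 6 q q_x = 0`. -/
structure KdVReg (q q1 q2 q3 : ℝ → ℝ → ℝ) : Prop where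
  d0 : ∀ t x, HasDerivAt (q t) (q1 t x) x
  d1 : ∀ t x, HasDerivAt (q1 t) (q2 t x) x
  d2 : ∀ t x, HasDerivAt (q2 t) (q3 t x) x
  dt : ∀ t x, HasDerivAt (fun τ => q τ x) (-(q3 t x + 6 * q t x * q1 t x)) t
  c0 : Continuous (uncurry q)
  c1 : Continuous (uncurry q1)
  c2 : Continuous (uncurry q2)
  c3 : Continuous (uncurry q3)

/-- A solution of `q_t + q_xxx + 6 q q_x = 0` which is locally bounded in time with values
in `H¹`. -/
structure KdVClass (q q1 q2 q3 : ℝ → ℝ → ℝ) : Prop extends KdVReg q q1 q2 q3 where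
  bdd : ∀ T : ℝ, ∃ M : ℝ, ∀ t, |t| ≤ T → (∀ x, |q t x| ≤ M) ∧
    Integrable (fun x => q t x ^ 2) ∧ Integrable (fun x => q1 t x ^ 2) ∧
    ∫ x, q t x ^ 2 ≤ M ∧ ∫ x, q1 t x ^ 2 ≤ M

theorem exists_bump : ∃ ζ ζ1 ζ2 ζ3 : ℝ → ℝ, (∀ x, HasDerivAt ζ (ζ1 x) x) ∧
    (∀ x, HasDerivAt ζ1 (ζ2 x) x) ∧ (∀ x, HasDerivAt ζ2 (ζ3 x) x) ∧
    Continuous ζ ∧ Continuous ζ1 ∧ Continuous ζ2 ∧ Continuous ζ3 ∧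
    (∀ x, 0 ≤ ζ x) ∧ (∀ x, ζ x ≤ 1) ∧ (∀ x, |x| ≤ 1 / 4 → ζ x = 1) ∧
    ∀ x, 1 ≤ |x| → ζ x = 0 ∧ ζ1 x = 0 ∧ ζ2 x = 0 ∧ ζ3 x = 0 := by
  let b : ContDiffBump (0 : ℝ) := ⟨1 / 4, 1 / 2, by norm_num, by norm_num⟩
  have hb : ContDiff ℝ 4 b := b.contDiff
  have hb1 : ContDiff ℝ 3 (deriv b) := by
    have h : ContDiff ℝ (3 + 1) b := hb
    exact (contDiff_succ_iff_deriv.1 h).2.2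
  have hb2 : ContDiff ℝ 2 (deriv (deriv b)) := by
    have h : ContDiff ℝ (2 + 1) (deriv b) := hb1
    exact (contDiff_succ_iff_deriv.1 h).2.2
  have hb3 : ContDiff ℝ 1 (deriv (deriv (deriv b))) := by
    have h : ContDiff ℝ (1 + 1) (deriv (deriv b)) := hb2
    exact (contDiff_succ_iff_deriv.1 h).2.2
  refine ⟨b, deriv b, deriv (deriv b), deriv (deriv (deriv b)),
    fun x => (hb.differentiable (by norm_num) x).hasDerivAt,
    fun x => (hb1.differentiable (by norm_num) x).hasDerivAt,
    fun x => (hb2.differentiable (by norm_num) x).hasDerivAt,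
    hb.continuous, hb1.continuous, hb2.continuous, hb3.continuous,
    fun x => b.nonneg, fun x => b.le_one, fun x hx => b.one_of_mem_closedBall ?_, ?_⟩
  · simpa [b] using hx
  · intro x hx
    have h0 : (b : ℝ → ℝ) =ᶠ[𝓝 x] fun _ => 0 := by
      have : {y : ℝ | 1 / 2 < |y|} ∈ 𝓝 x :=
        (isOpen_lt continuous_const continuous_abs).mem_nhds (by change 1 / 2 < |x|; linarith)
      filter_upwards [this] with y hy
      exact b.zero_of_le_dist (by simp [b]; simpa using hy.le)
    have h1 : deriv b =ᶠ[𝓝 x] fun _ => 0 := by simpa using h0.deriv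
    have h2 : deriv (deriv b) =ᶠ[𝓝 x] fun _ => 0 := by simpa using h1.deriv
    have h3 : deriv (deriv (deriv b)) =ᶠ[𝓝 x] fun _ => 0 := by simpa using h2.deriv
    exact ⟨h0.eq_of_nhds, h1.eq_of_nhds, h2.eq_of_nhds, h3.eq_of_nhds⟩

theorem hasDerivAt_intervalIntegral_param {f f' : ℝ → ℝ → ℝ} (a b t : ℝ)
    (hf : Continuous (uncurry f)) (hf' : Continuous (uncurry f'))
    (h : ∀ t x, HasDerivAt (fun τ => f τ x) (f' t x) t) :
    HasDerivAt (fun τ => ∫ x in a..b, f τ x) (∫ x in a..b, f' t x) t := by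
  obtain ⟨C, hC⟩ := ((isCompact_Icc (a := t - 1) (b := t + 1)).prod
    (isCompact_uIcc (a := a) (b := b))).exists_bound_of_continuousOn hf'.continuousOn
  have hs : Icc (t - 1) (t + 1) ∈ 𝓝 t := Icc_mem_nhds (by linarith) (by linarith)
  refine (intervalIntegral.hasDerivAt_integral_of_dominated_loc_of_deriv_le
    (bound := fun _ => C) hs ?_ ?_ ?_ ?_ ?_ ?_).2
  · exact Eventually.of_forall fun τ => (hf.uncurry_left τ).aestronglyMeasurable
  · exact (hf.uncurry_left t).intervalIntegrable _ _
  · exact (hf'.uncurry_left t).aestronglyMeasurable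
  · refine Eventually.of_forall fun x hx τ hτ => ?_
    exact hC (τ, x) ⟨hτ, uIoc_subset_uIcc hx⟩
  · exact intervalIntegrable_const
  · exact Eventually.of_forall fun x _ τ _ => h τ x

/-- Integration by parts with vanishing boundary values of the second factor. -/
theorem integral_deriv_mul_eq_neg {F F' φ φ' : ℝ → ℝ} {a b : ℝ}
    (hF : ∀ x, HasDerivAt F (F' x) x) (hφ : ∀ x, HasDerivAt φ (φ' x) x)
    (cF : Continuous F') (cφ : Continuous φ') (ha : φ a = 0) (hb : φ b = 0) :
    ∫ x in a..b, F' x * φ x = -∫ x in a..b, F x * φ' x := by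
  have := intervalIntegral.integral_mul_deriv_eq_deriv_mul (a := a) (b := b)
    (fun x _ => hF x) (fun x _ => hφ x) (cF.intervalIntegrable _ _) (cφ.intervalIntegrable _ _)
  rw [ha, hb] at this
  linarith

theorem abs_intervalIntegral_mul_le {F φ : ℝ → ℝ} {a b D C : ℝ} (hab : a ≤ b)
    (hF : Integrable F) (hC : ∫ x, |F x| ≤ C) (hD : 0 ≤ D) (hφ : ∀ x, |φ x| ≤ D) :
    |∫ x in a..b, F x * φ x| ≤ C * D := by
  have h1 : |∫ x in a..b, F x * φ x| ≤ ∫ x in a..b, |F x| * D := by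
    refine intervalIntegral.norm_integral_le_of_norm_le (f := fun x => F x * φ x) hab
      (Eventually.of_forall fun x _ => ?_) (hF.abs.mul_const D).intervalIntegrable
    rw [Real.norm_eq_abs, abs_mul]
    exact mul_le_mul_of_nonneg_left (hφ x) (abs_nonneg _)
  refine h1.trans ?_
  rw [intervalIntegral.integral_of_le hab]
  calc ∫ x in Ioc a b, |F x| * D ≤ ∫ x, |F x| * D :=
        setIntegral_le_integral (hF.abs.mul_const D)
          (Eventually.of_forall fun x => mul_nonneg (abs_nonneg _) hD)
    _ = (∫ x, |F x|) * D := integral_mul_const D _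
    _ ≤ C * D := mul_le_mul_of_nonneg_right hC hD

/-- A local conservation law with a source term, integrated over the line. -/
theorem conservation_law {ρ σ F F' G G' G'' : ℝ → ℝ → ℝ} {s t C a : ℝ} (hst : s ≤ t)
    (hρ : ∀ τ x, HasDerivAt (fun τ => ρ τ x) (σ τ x + F' τ x + G'' τ x) τ)
    (hF : ∀ τ x, HasDerivAt (F τ) (F' τ x) x)
    (hG : ∀ τ x, HasDerivAt (G τ) (G' τ x) x)
    (hG' : ∀ τ x, HasDerivAt (G' τ) (G'' τ x) x)
    (cρ : Continuous (uncurry ρ)) (cσ : Continuous (uncurry σ))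
    (cF : Continuous (uncurry F')) (cG : Continuous (uncurry G''))
    (iσ : ∀ τ ∈ Icc s t, Integrable (σ τ) ∧ ∫ x, |σ τ x| ≤ a)
    (iF : ∀ τ ∈ Icc s t, Integrable (F τ) ∧ ∫ x, |F τ x| ≤ C)
    (iG : ∀ τ ∈ Icc s t, Integrable (G τ) ∧ ∫ x, |G τ x| ≤ C)
    (is : Integrable (ρ s)) (it : Integrable (ρ t)) :
    |(∫ x, ρ t x) - ∫ x, ρ s x| ≤ a * (t - s) := by
  obtain ⟨φ, φ1, φ2, φ3, h0, h1, h2, c0, c1, c2, c3, hpos, hle, hone, hzero⟩ := exists_bump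
  obtain ⟨D, hD⟩ : ∃ D, ∀ x, |φ1 x| ≤ D ∧ |φ2 x| ≤ D := by
    obtain ⟨D1, hD1⟩ := (isCompact_Icc (a := (-1 : ℝ)) (b := 1)).exists_bound_of_continuousOn
      c1.continuousOn
    obtain ⟨D2, hD2⟩ := (isCompact_Icc (a := (-1 : ℝ)) (b := 1)).exists_bound_of_continuousOn
      c2.continuousOn
    have hD0 : 0 ≤ D1 := (norm_nonneg _).trans (hD1 0 (by simp))
    refine ⟨max D1 D2, fun x => ?_⟩
    rcases le_total 1 |x| with hx | hx
    · obtain ⟨-, e1, e2, -⟩ := hzero x hx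
      rw [e1, e2]; simp [hD0]
    · have hx' : x ∈ Icc (-1 : ℝ) 1 := abs_le.1 hx
      exact ⟨(hD1 x hx').trans (le_max_left _ _), (hD2 x hx').trans (le_max_right _ _)⟩
  have hD0 : 0 ≤ D := (abs_nonneg _).trans (hD 0).1
  have hC0 : 0 ≤ C := (integral_nonneg fun x => abs_nonneg _).trans (iF s ⟨le_rfl, hst⟩).2
  have key : ∀ R : ℝ, 1 ≤ R → |(∫ x, ρ t x * φ (x / R)) - ∫ x, ρ s x * φ (x / R)| ≤
      (a + C * (D / R) + C * (D / R)) * (t - s) := by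
    intro R hR
    have hR0 : 0 < R := by linarith
    have e0 : ∀ x, HasDerivAt (fun x => φ (x / R)) (φ1 (x / R) / R) x := fun x => by
      simpa [Function.comp_def, div_eq_mul_inv] using (h0 (x / R)).comp x ((hasDerivAt_id x).div_const R)
    have e1 : ∀ x, HasDerivAt (fun x => φ1 (x / R) / R) (φ2 (x / R) / R / R) x := fun x => by
      simpa [Function.comp_def, div_eq_mul_inv] using
        ((h1 (x / R)).comp x ((hasDerivAt_id x).div_const R)).div_const R
    have cdiv : Continuous fun x : ℝ => x / R := continuous_id.div_const R
    have hb1 : 1 ≤ |R / R| := by rw [div_self hR0.ne']; simp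
    have hb2 : 1 ≤ |-R / R| := by rw [neg_div, div_self hR0.ne']; simp
    have hsupp : ∀ f : ℝ → ℝ, ∫ x, f x * φ (x / R) = ∫ x in (-R)..R, f x * φ (x / R) := by
      intro f
      rw [intervalIntegral.integral_of_le (by linarith), setIntegral_eq_integral_of_forall_compl_eq_zero]
      intro x hx
      have : 1 ≤ |x / R| := by
        rw [abs_div, abs_of_pos hR0, le_div_iff₀ hR0, one_mul]
        by_contra hlt
        push Not at hlt
        exact hx ⟨(abs_lt.1 hlt).1, (abs_lt.1 hlt).2.le⟩
      rw [(hzero _ this).1, mul_zero]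
    rw [hsupp, hsupp]
    have hder : ∀ τ, HasDerivAt (fun τ => ∫ x in (-R)..R, ρ τ x * φ (x / R))
        (∫ x in (-R)..R, (σ τ x + F' τ x + G'' τ x) * φ (x / R)) τ := by
      intro τ
      refine hasDerivAt_intervalIntegral_param (f := fun τ x => ρ τ x * φ (x / R))
        (f' := fun τ x => (σ τ x + F' τ x + G'' τ x) * φ (x / R)) _ _ _ ?_ ?_ ?_
      · exact cρ.mul (c0.comp (cdiv.comp continuous_snd))
      · exact ((cσ.add cF).add cG).mul (c0.comp (cdiv.comp continuous_snd))
      · exact fun t x => (hρ t x).mul_const _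
    have hbd : ∀ τ ∈ Icc s t, ‖∫ x in (-R)..R, (σ τ x + F' τ x + G'' τ x) * φ (x / R)‖ ≤
        a + C * (D / R) + C * (D / R) := by
      intro τ hτ
      have cφ : Continuous fun x => φ (x / R) := c0.comp cdiv
      have i1 : IntervalIntegrable (fun x => σ τ x * φ (x / R)) volume (-R) R :=
        ((cσ.uncurry_left τ).mul cφ).intervalIntegrable _ _
      have i2 : IntervalIntegrable (fun x => F' τ x * φ (x / R)) volume (-R) R :=
        ((cF.uncurry_left τ).mul cφ).intervalIntegrable _ _
      have i3 : IntervalIntegrable (fun x => G'' τ x * φ (x / R)) volume (-R) R :=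
        ((cG.uncurry_left τ).mul cφ).intervalIntegrable _ _
      have esum : ∫ x in (-R)..R, (σ τ x + F' τ x + G'' τ x) * φ (x / R) =
          (∫ x in (-R)..R, σ τ x * φ (x / R)) + (∫ x in (-R)..R, F' τ x * φ (x / R)) +
          ∫ x in (-R)..R, G'' τ x * φ (x / R) := by
        rw [← intervalIntegral.integral_add i1 i2, ← intervalIntegral.integral_add (i1.add i2) i3]
        exact intervalIntegral.integral_congr fun x _ => by ring
      have eF := integral_deriv_mul_eq_neg (a := -R) (b := R) (hF τ) e0 (cF.uncurry_left τ)
        ((c1.comp cdiv).div_const R) (hzero _ hb2).1 (hzero _ hb1).1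
      have cG' : Continuous (G' τ) :=
        continuous_iff_continuousAt.2 fun x => (hG' τ x).continuousAt
      have eG := integral_deriv_mul_eq_neg (a := -R) (b := R) (hG' τ) e0 (cG.uncurry_left τ)
        ((c1.comp cdiv).div_const R) (hzero _ hb2).1 (hzero _ hb1).1
      have eG' := integral_deriv_mul_eq_neg (a := -R) (b := R) (hG τ) e1 cG'
        (((c2.comp cdiv).div_const R).div_const R) (by rw [(hzero _ hb2).2.1, zero_div])
        (by rw [(hzero _ hb1).2.1, zero_div])
      have b1 : |∫ x in (-R)..R, σ τ x * φ (x / R)| ≤ a * 1 :=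
        abs_intervalIntegral_mul_le (by linarith) (iσ τ hτ).1 (iσ τ hτ).2 zero_le_one
          fun x => by rw [abs_of_nonneg (hpos _)]; exact hle _
      have b2 : |∫ x in (-R)..R, F τ x * (φ1 (x / R) / R)| ≤ C * (D / R) :=
        abs_intervalIntegral_mul_le (by linarith) (iF τ hτ).1 (iF τ hτ).2 (by positivity)
          fun x => by
            rw [abs_div, abs_of_pos hR0]
            exact div_le_div_of_nonneg_right (hD _).1 hR0.le
      have b3 : |∫ x in (-R)..R, G τ x * (φ2 (x / R) / R / R)| ≤ C * (D / R) :=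
        abs_intervalIntegral_mul_le (by linarith) (iG τ hτ).1 (iG τ hτ).2 (by positivity)
          fun x => by
            rw [abs_div, abs_div, abs_of_pos hR0]
            calc |φ2 (x / R)| / R / R ≤ D / R / R :=
                  div_le_div_of_nonneg_right (div_le_div_of_nonneg_right (hD _).2 hR0.le) hR0.le
              _ ≤ D / R := div_le_self (by positivity) hR
      rw [esum, eF, eG, eG', neg_neg, Real.norm_eq_abs]
      rw [abs_le] at b1 b2 b3 ⊢
      constructor <;> linarith [b1.1, b1.2, b2.1, b2.2, b3.1, b3.2]
    have := Convex.norm_image_sub_le_of_norm_hasDerivWithin_le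
      (fun τ hτ => (hder τ).hasDerivWithinAt) hbd (convex_Icc s t) (left_mem_Icc.2 hst)
      (right_mem_Icc.2 hst)
    rwa [Real.norm_eq_abs, Real.norm_eq_abs, abs_of_nonneg (sub_nonneg.2 hst)] at this
  have lim : ∀ f : ℝ → ℝ, Integrable f →
      Tendsto (fun R : ℝ => ∫ x, f x * φ (x / R)) atTop (𝓝 (∫ x, f x)) := by
    intro f hf
    refine tendsto_integral_filter_of_dominated_convergence (fun x => |f x|) ?_ ?_ hf.abs ?_
    · exact Eventually.of_forall fun R =>
        hf.aestronglyMeasurable.mul (c0.comp (continuous_id.div_const R)).aestronglyMeasurable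
    · refine Eventually.of_forall fun R => Eventually.of_forall fun x => ?_
      rw [Real.norm_eq_abs, abs_mul, abs_of_nonneg (hpos _)]
      exact mul_le_of_le_one_right (abs_nonneg _) (hle _)
    · refine Eventually.of_forall fun x => ?_
      have : Tendsto (fun R : ℝ => φ (x / R)) atTop (𝓝 (φ 0)) :=
        (c0.tendsto 0).comp (tendsto_const_nhds.div_atTop tendsto_id)
      rw [hone 0 (by norm_num)] at this
      simpa using this.const_mul (f x)
  have l1 := ((lim _ it).sub (lim _ is)).abs
  have l2 : Tendsto (fun R : ℝ => (a + C * (D / R) + C * (D / R)) * (t - s)) atTop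
      (𝓝 ((a + C * 0 + C * 0) * (t - s))) := by
    have : Tendsto (fun R : ℝ => D / R) atTop (𝓝 0) := tendsto_const_nhds.div_atTop tendsto_id
    exact (((tendsto_const_nhds.add (this.const_mul C)).add (this.const_mul C))).mul_const _
  have := le_of_tendsto_of_tendsto l1 l2 ((eventually_ge_atTop 1).mono key)
  simpa using this

/-- Two-sided Grönwall estimate around time zero. -/
theorem norm_le_of_norm_deriv_le {E : Type*} [NormedAddCommGroup E] [NormedSpace ℝ E]
    {f f' : ℝ → E} {T K ε δ : ℝ} (hK : 0 < K) (hε : 0 ≤ ε)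
    (hf : ∀ t, |t| ≤ T → HasDerivAt f (f' t) t)
    (hb : ∀ t, |t| ≤ T → ‖f' t‖ ≤ K * ‖f t‖ + ε) (h0 : ‖f 0‖ ≤ δ) {t : ℝ} (ht : |t| ≤ T) :
    ‖f t‖ ≤ (δ + ε / K) * exp (K * T) := by
  have hδ : 0 ≤ δ := (norm_nonneg _).trans h0
  have main : ∀ g g' : ℝ → E, (∀ t, |t| ≤ T → HasDerivAt g (g' t) t) →
      (∀ t, |t| ≤ T → ‖g' t‖ ≤ K * ‖g t‖ + ε) → ‖g 0‖ ≤ δ → ∀ t, 0 ≤ t → t ≤ T →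
      ‖g t‖ ≤ (δ + ε / K) * exp (K * T) := by
    intro g g' hg hb h0 t ht0 htT
    have ha : ∀ τ ∈ Icc 0 t, |τ| ≤ T := fun τ hτ => by
      rw [abs_of_nonneg hτ.1]; exact hτ.2.trans htT
    have := norm_le_gronwallBound_of_norm_deriv_right_le (a := 0) (b := t)
      (fun τ hτ => (hg τ (ha τ hτ)).continuousAt.continuousWithinAt)
      (fun τ hτ => (hg τ (ha τ (Ico_subset_Icc_self hτ))).hasDerivWithinAt) h0
      (fun τ hτ => hb τ (ha τ (Ico_subset_Icc_self hτ))) t ⟨ht0, le_rfl⟩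
    refine this.trans ?_
    rw [gronwallBound_of_K_ne_0 hK.ne', sub_zero]
    have h1 : exp (K * t) ≤ exp (K * T) := exp_le_exp.2 (mul_le_mul_of_nonneg_left htT hK.le)
    have h2 : 0 ≤ ε / K := div_nonneg hε hK.le
    change δ * exp (K * t) + ε / K * (exp (K * t) - 1) ≤ _
    nlinarith
  rcases le_total 0 t with h | h
  · exact main f f' hf hb h0 t h ((le_abs_self t).trans ht)
  · have := main (fun s => f (-s)) (fun s => -f' (-s)) (fun s hs => ?_) (fun s hs => ?_)
      (by simpa using h0) (-t) (by linarith) ((neg_le_abs t).trans ht)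
    · simpa using this
    · have := (hf (-s) (by simpa using hs)).scomp s (hasDerivAt_neg s)
      simpa [Function.comp_def] using this
    · rw [norm_neg]; exact hb (-s) (by simpa using hs)

theorem eq_zero_of_linear_ode {E : Type*} [NormedAddCommGroup E] [NormedSpace ℝ E]
    {A : ℝ → E →L[ℝ] E} (hA : Continuous A) {f : ℝ → E} {T : ℝ}
    (hf : ∀ t, |t| ≤ T → HasDerivAt f (A t (f t)) t) (h0 : f 0 = 0) {t : ℝ} (ht : |t| ≤ T) :
    f t = 0 := by
  obtain ⟨B, hB⟩ := (isCompact_Icc (a := -T) (b := T)).exists_bound_of_continuousOn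
    hA.continuousOn
  have := norm_le_of_norm_deriv_le (K := |B| + 1) (ε := 0) (δ := 0) (by positivity) le_rfl hf
    (fun s hs => ?_) (by rw [h0, norm_zero]) ht
  · simpa using this
  · refine ((A s).le_opNorm _).trans ?_
    rw [add_zero]
    refine mul_le_mul_of_nonneg_right ?_ (norm_nonneg _)
    linarith [hB s (abs_le.1 hs), le_abs_self B]

/-- Componentwise truncation of the plane. -/
noncomputable def clampProd (R : ℝ) (p : ℝ × ℝ) : ℝ × ℝ :=
  (max (-R) (min R p.1), max (-R) (min R p.2))

theorem clampProd_eq {R : ℝ} {p : ℝ × ℝ} (h : ‖p‖ ≤ R) : clampProd R p = p := by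
  have h1 : |p.1| ≤ R := (norm_fst_le p).trans h
  have h2 : |p.2| ≤ R := (norm_snd_le p).trans h
  rw [abs_le] at h1 h2
  simp [clampProd, h1.1, h1.2, h2.1, h2.2]

theorem norm_clampProd_le {R : ℝ} (hR : 0 ≤ R) (p : ℝ × ℝ) :
    ‖clampProd R p‖ ≤ R ∧ ‖clampProd R p‖ ≤ ‖p‖ := by
  have key : ∀ a : ℝ, |max (-R) (min R a)| ≤ R ∧ |max (-R) (min R a)| ≤ |a| := by
    intro a
    constructor <;> grind
  constructor
  · rw [Prod.norm_def]
    exact max_le (key p.1).1 (key p.2).1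
  · rw [Prod.norm_def, Prod.norm_def]
    exact max_le_max (key p.1).2 (key p.2).2

theorem lipschitzWith_clampProd (R : ℝ) : LipschitzWith 1 (clampProd R) := by
  have key : LipschitzWith 1 fun a : ℝ => max (-R) (min R a) :=
    (LipschitzWith.id.const_min R).const_max (-R)
  have := (key.comp (LipschitzWith.prod_fst (α := ℝ) (β := ℝ))).prodMk
    (key.comp (LipschitzWith.prod_snd (α := ℝ) (β := ℝ)))
  simp only [mul_one, max_self] at this
  exact this

theorem linear_ode_exists_bounded {A : ℝ → (ℝ × ℝ) →L[ℝ] (ℝ × ℝ)} (hA : Continuous A)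
    (y0 : ℝ × ℝ) {T : ℝ} (hT : 0 ≤ T) :
    ∃ y : ℝ → ℝ × ℝ, y 0 = y0 ∧ ∀ t, |t| ≤ T → HasDerivAt y (A t (y t)) t := by
  obtain ⟨B, hB⟩ := (isCompact_Icc (a := -(T + 1)) (b := T + 1)).exists_bound_of_continuousOn
    hA.continuousOn
  have hB0 : 0 ≤ B := (norm_nonneg _).trans (hB 0 ⟨by linarith, by linarith⟩)
  set K := B + 1 with hK
  have hK0 : 0 < K := by positivity
  set R := ‖y0‖ * exp (K * T) with hR
  have hR0 : 0 ≤ R := by positivity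
  have h0mem : (0 : ℝ) ∈ Icc (-(T + 1)) (T + 1) := ⟨by linarith, by linarith⟩
  have pl : IsPicardLindelof (fun t p => A t (clampProd R p)) (tmin := -(T + 1)) (tmax := T + 1)
      ⟨0, h0mem⟩ y0 (Real.toNNReal (K * R * (T + 1))) 0 (Real.toNNReal (K * R))
      (Real.toNNReal K) := by
    refine ⟨fun t ht => ?_, fun x _ => ?_, fun t ht x _ => ?_, ?_⟩
    · refine LipschitzWith.lipschitzOnWith ?_
      refine LipschitzWith.of_dist_le_mul fun p q => ?_
      rw [dist_eq_norm, ← map_sub, Real.coe_toNNReal _ hK0.le]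
      refine ((A t).le_opNorm _).trans ?_
      have h1 := (lipschitzWith_clampProd R).dist_le_mul p q
      rw [NNReal.coe_one, one_mul, dist_eq_norm] at h1
      exact mul_le_mul (by linarith [hB t ht]) h1 (norm_nonneg _) hK0.le
    · exact (hA.clm_apply continuous_const).continuousOn
    · rw [Real.coe_toNNReal _ (by positivity)]
      refine ((A t).le_opNorm _).trans ?_
      exact mul_le_mul (by linarith [hB t ht]) (norm_clampProd_le hR0 x).1 (norm_nonneg _) hK0.le
    · rw [Real.coe_toNNReal _ (by positivity), Real.coe_toNNReal _ (by positivity)]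
      simp
  obtain ⟨y, hy0, hy⟩ := pl.exists_eq_forall_mem_Icc_hasDerivWithinAt₀
  have hy' : ∀ t, |t| ≤ T → HasDerivAt y (A t (clampProd R (y t))) t := by
    intro t ht
    have := abs_le.1 ht
    exact (hy t ⟨by linarith, by linarith⟩).hasDerivAt
      (Icc_mem_nhds (by linarith) (by linarith))
  refine ⟨y, hy0, fun t ht => ?_⟩
  have hbd := norm_le_of_norm_deriv_le (ε := 0) (δ := ‖y0‖) hK0 le_rfl hy' (fun s hs => ?_)
    (by rw [← hy0]) ht
  · have := hy' t ht
    rwa [clampProd_eq (by simpa using hbd)] at this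
  · refine ((A s).le_opNorm _).trans ?_
    have := abs_le.1 hs
    rw [add_zero]
    exact mul_le_mul (by linarith [hB s ⟨by linarith, by linarith⟩]) (norm_clampProd_le hR0 _).2
      (norm_nonneg _) hK0.le

/-- Global solvability of linear differential systems in the plane. -/
theorem linear_ode_exists {A : ℝ → (ℝ × ℝ) →L[ℝ] (ℝ × ℝ)} (hA : Continuous A) (y0 : ℝ × ℝ) :
    ∃ y : ℝ → ℝ × ℝ, y 0 = y0 ∧ ∀ t, HasDerivAt y (A t (y t)) t := by
  choose y hy0 hy using fun n : ℕ => linear_ode_exists_bounded hA y0 (Nat.cast_nonneg n)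
  have uniq : ∀ (n m : ℕ) (t : ℝ), |t| ≤ n → |t| ≤ m → y n t = y m t := by
    intro n m t hn hm
    have := eq_zero_of_linear_ode hA (f := fun s => y n s - y m s) (T := |t|) (fun s hs => ?_)
      (by simp [hy0]) le_rfl
    · exact sub_eq_zero.1 this
    · simpa using (hy n s (hs.trans hn)).fun_sub (hy m s (hs.trans hm))
  refine ⟨fun t => y ⌈|t|⌉₊ t, by simp [hy0], fun t => ?_⟩
  have hev : (fun t => y ⌈|t|⌉₊ t) =ᶠ[𝓝 t] y (⌈|t|⌉₊ + 1) := by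
    have : {s : ℝ | |s| < ((⌈|t|⌉₊ + 1 : ℕ) : ℝ)} ∈ 𝓝 t :=
      (isOpen_lt continuous_abs continuous_const).mem_nhds (by
        change |t| < _
        push_cast
        linarith [Nat.le_ceil |t|])
    filter_upwards [this] with s hs
    exact uniq _ _ s (Nat.le_ceil _) (le_of_lt hs)
  have h1 := hy (⌈|t|⌉₊ + 1) t (by push_cast; linarith [Nat.le_ceil |t|])
  rw [← hev.eq_of_nhds] at h1
  exact h1.congr_of_eventuallyEq hev

/-- Zero-curvature compatibility: a spatial linear relation valid at time zero is propagated. -/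
theorem zero_curvature {E : Type*} [NormedAddCommGroup E] [NormedSpace ℝ E]
    {U U' V V' : ℝ → ℝ → E →L[ℝ] E} {Ψ : ℝ → ℝ → E}
    (hV : ∀ t x, HasDerivAt (V t) (V' t x) x) (cV : Continuous (uncurry V))
    (cV' : Continuous (uncurry V'))
    (hU : ∀ t x, HasDerivAt (fun τ => U τ x) (U' t x) t)
    (cU : Continuous (uncurry U))
    (hz : ∀ t x, U' t x = V' t x + (V t x).comp (U t x) - (U t x).comp (V t x))
    (hΨ : ∀ t x, HasDerivAt (fun τ => Ψ τ x) (V t x (Ψ t x)) t)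
    (h0 : ∀ x, HasDerivAt (Ψ 0) (U 0 x (Ψ 0 x)) x) (t x : ℝ) :
    HasDerivAt (Ψ t) (U t x (Ψ t x)) x := by
  set T := |t|
  have hcompact : IsCompact (Icc (-T) T ×ˢ Icc (x - 1) (x + 1)) := isCompact_Icc.prod isCompact_Icc
  obtain ⟨B, hB⟩ := hcompact.exists_bound_of_continuousOn cV.continuousOn
  have cΨ : Continuous fun τ => Ψ τ x :=
    continuous_iff_continuousAt.2 fun τ => (hΨ τ x).continuousAt
  have cΦ : Continuous fun τ => U τ x (Ψ τ x) := (cU.uncurry_right x).clm_apply cΨ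
  obtain ⟨C1, hC1⟩ := (isCompact_Icc (a := -T) (b := T)).exists_bound_of_continuousOn
    cΨ.continuousOn
  obtain ⟨C2, hC2⟩ := (isCompact_Icc (a := -T) (b := T)).exists_bound_of_continuousOn
    cΦ.continuousOn
  have hT : 0 ≤ T := abs_nonneg t
  have hB0 : 0 ≤ B := (norm_nonneg _).trans (hB (0, x) ⟨⟨by simpa, hT⟩, by simp, by simp⟩)
  have hC10 : 0 ≤ C1 := (norm_nonneg _).trans (hC1 0 ⟨by simpa, hT⟩)
  have hC20 : 0 ≤ C2 := (norm_nonneg _).trans (hC2 0 ⟨by simpa, hT⟩)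
  set K := B + 1
  have hK : 0 < K := by positivity
  set D := (1 + (C1 + C2) / K) * exp (K * T)
  have hD : 0 < D := by positivity
  rw [hasDerivAt_iff_isLittleO, Asymptotics.isLittleO_iff]
  intro c hc
  set ε := c / D
  have hε : 0 < ε := div_pos hc hD
  have uc : ∀ {W : ℝ → ℝ → E →L[ℝ] E}, Continuous (uncurry W) →
      ∃ δ > 0, ∀ τ ∈ Icc (-T) T, ∀ y, |y - x| < δ → ‖W τ y - W τ x‖ ≤ ε := by
    intro W cW
    have hu := hcompact.uniformContinuousOn_of_continuous cW.continuousOn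
    obtain ⟨δ, hδ, h⟩ := Metric.uniformContinuousOn_iff.1 hu ε hε
    refine ⟨min δ 1, by positivity, fun τ hτ y hy => ?_⟩
    have hy1 := abs_le.1 (hy.le.trans (min_le_right _ _))
    have := h (τ, y) ⟨hτ, by constructor <;> simp only <;> linarith [hy1.1, hy1.2]⟩ (τ, x)
      ⟨hτ, by simp, by simp⟩
      (by simp [Prod.dist_eq, Real.dist_eq]; exact hy.trans_le (min_le_left _ _))
    rw [dist_eq_norm] at this
    exact this.le
  obtain ⟨δ1, hδ1, hV1⟩ := uc cV
  obtain ⟨δ2, hδ2, hV2⟩ := uc cV'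
  have hinit := (hasDerivAt_iff_isLittleO.1 (h0 x))
  rw [Asymptotics.isLittleO_iff] at hinit
  have hnear : ∀ δ > 0, ∀ᶠ y in 𝓝 x, |y - x| < δ := fun δ hδ => by
    have := Metric.ball_mem_nhds x hδ
    filter_upwards [this] with y hy
    simpa [Real.dist_eq] using hy
  filter_upwards [hinit hε, hnear δ1 hδ1, hnear δ2 hδ2, hnear 1 one_pos] with y hy0 hy1 hy2 hy3
  have hyI : y ∈ Icc (x - 1) (x + 1) := by
    have := abs_lt.1 hy3
    constructor <;> linarith
  have hder : ∀ τ, HasDerivAt (fun τ => Ψ τ y - Ψ τ x - (y - x) • U τ x (Ψ τ x))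
      (V τ y (Ψ τ y) - V τ x (Ψ τ x) -
        (y - x) • (U' τ x (Ψ τ x) + U τ x (V τ x (Ψ τ x)))) τ := fun τ =>
    ((hΨ τ y).sub (hΨ τ x)).sub (((hU τ x).clm_apply (hΨ τ x)).const_smul (y - x))
  have hcomb : ∀ τ, V τ y (Ψ τ y) - V τ x (Ψ τ x) -
        (y - x) • (U' τ x (Ψ τ x) + U τ x (V τ x (Ψ τ x))) =
      V τ y (Ψ τ y - Ψ τ x - (y - x) • U τ x (Ψ τ x)) +
      (V τ y - V τ x - (y - x) • V' τ x) (Ψ τ x) +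
      (y - x) • (V τ y - V τ x) (U τ x (Ψ τ x)) := by
    intro τ
    rw [hz]
    simp only [map_sub, map_smul, sub_apply, add_apply,
      smul_apply, ContinuousLinearMap.comp_apply, smul_add, smul_sub]
    abel
  have hrem : ∀ τ ∈ Icc (-T) T, ‖V τ y - V τ x - (y - x) • V' τ x‖ ≤ ε * |y - x| := by
    intro τ hτ
    have := (convex_uIcc x y).norm_image_sub_le_of_norm_hasDerivWithin_le (𝕜 := ℝ)
      (f := fun z => V τ z - (z - x) • V' τ x) (f' := fun z => V' τ z - V' τ x) (C := ε)
      (fun z _ => by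
        have h1 := ((hasDerivAt_id z).sub_const x).smul_const (V' τ x)
        rw [one_smul] at h1
        exact ((hV τ z).sub h1).hasDerivWithinAt)
      (fun z hz => hV2 τ hτ z
        (lt_of_le_of_lt (abs_sub_left_of_mem_uIcc hz) hy2)) left_mem_uIcc right_mem_uIcc
    simpa [sub_right_comm] using this
  have hfin := norm_le_of_norm_deriv_le (ε := (C1 + C2) * (ε * |y - x|)) (δ := ε * |y - x|) hK
    (by positivity) (fun τ (_ : |τ| ≤ T) => hder τ) (fun τ hτ => ?_) ?_ (le_refl T)
  · refine hfin.trans (le_of_eq ?_)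
    have : c = ε * D := by simp only [ε]; field_simp
    rw [Real.norm_eq_abs, this]
    simp only [D]
    ring
  · have hτ' : τ ∈ Icc (-T) T := abs_le.1 hτ
    rw [hcomb]
    refine (norm_add₃_le).trans ?_
    have e1 := ((V τ y).le_opNorm (Ψ τ y - Ψ τ x - (y - x) • U τ x (Ψ τ x)))
    have e2 := (V τ y - V τ x - (y - x) • V' τ x).le_opNorm (Ψ τ x)
    have e3 := (V τ y - V τ x).le_opNorm (U τ x (Ψ τ x))
    have b1 : ‖V τ y‖ ≤ K := by
      have := hB (τ, y) ⟨hτ', hyI⟩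
      simp only [uncurry] at this
      linarith
    have e1' := e1.trans (mul_le_mul_of_nonneg_right b1 (norm_nonneg _))
    have e2' := e2.trans (mul_le_mul (hrem τ hτ') (hC1 τ hτ') (norm_nonneg _) (by positivity))
    have e3' := e3.trans (mul_le_mul (hV1 τ hτ' y hy1) (hC2 τ hτ') (norm_nonneg _) hε.le)
    rw [norm_smul, Real.norm_eq_abs]
    have e3'' := mul_le_mul_of_nonneg_left e3' (abs_nonneg (y - x))
    linarith
  · simpa using hy0

theorem hasDerivAt_along_curve {f f1 f2 : ℝ → ℝ → ℝ} {X : ℝ → ℝ} {X' t : ℝ}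
    (h1 : ∀ t x, HasDerivAt (fun τ => f τ x) (f1 t x) t)
    (h2 : ∀ t x, HasDerivAt (f t) (f2 t x) x)
    (c1 : Continuous (uncurry f1)) (c2 : Continuous (uncurry f2)) (hX : HasDerivAt X X' t) :
    HasDerivAt (fun τ => f τ (X τ)) (f1 t (X t) + f2 t (X t) * X') t := by
  have key := (hasStrictFDerivAt_uncurry_coprod (𝕜 := ℝ) (u := (t, X t)) (f := f)
    (f₁ := fun s x => ContinuousLinearMap.toSpanSingleton ℝ (f1 s x))
    (f₂ := fun s x => ContinuousLinearMap.toSpanSingleton ℝ (f2 s x))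
    (Eventually.of_forall fun v => (h1 v.1 v.2).hasFDerivAt)
    (Eventually.of_forall fun v => (h2 v.1 v.2).hasFDerivAt)
    ((ContinuousLinearMap.toSpanSingletonCLE (𝕜 := ℝ) (E := ℝ)).continuous.comp c1).continuousAt
    ((ContinuousLinearMap.toSpanSingletonCLE (𝕜 := ℝ) (E := ℝ)).continuous.comp c2).continuousAt)
  have := key.hasFDerivAt.comp_hasDerivAt t ((hasDerivAt_id t).prodMk hX)
  refine HasDerivAt.congr_deriv (f := fun τ => f τ (X τ)) this ?_
  simp [HasUncurry.uncurry, mul_comm]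

/-- The operator of a two by two matrix. -/
noncomputable def matOp (a b c d : ℝ) : (ℝ × ℝ) →L[ℝ] (ℝ × ℝ) :=
  a • (ContinuousLinearMap.inl ℝ ℝ ℝ).comp (ContinuousLinearMap.fst ℝ ℝ ℝ) +
  b • (ContinuousLinearMap.inl ℝ ℝ ℝ).comp (ContinuousLinearMap.snd ℝ ℝ ℝ) +
  c • (ContinuousLinearMap.inr ℝ ℝ ℝ).comp (ContinuousLinearMap.fst ℝ ℝ ℝ) +
  d • (ContinuousLinearMap.inr ℝ ℝ ℝ).comp (ContinuousLinearMap.snd ℝ ℝ ℝ)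

@[simp] theorem matOp_apply (a b c d : ℝ) (p : ℝ × ℝ) :
    matOp a b c d p = (a * p.1 + b * p.2, c * p.1 + d * p.2) := by
  simp [matOp]

theorem continuous_matOp {X : Type*} [TopologicalSpace X] {a b c d : X → ℝ} (ha : Continuous a)
    (hb : Continuous b) (hc : Continuous c) (hd : Continuous d) :
    Continuous fun x => matOp (a x) (b x) (c x) (d x) :=
  (((ha.smul continuous_const).add (hb.smul continuous_const)).add
    (hc.smul continuous_const)).add (hd.smul continuous_const)

theorem hasDerivAt_matOp {a b c d : ℝ → ℝ} {a' b' c' d' x : ℝ} (ha : HasDerivAt a a' x)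
    (hb : HasDerivAt b b' x) (hc : HasDerivAt c c' x) (hd : HasDerivAt d d' x) :
    HasDerivAt (fun x => matOp (a x) (b x) (c x) (d x)) (matOp a' b' c' d') x :=
  (((ha.smul_const _).add (hb.smul_const _)).add (hc.smul_const _)).add
    (hd.smul_const ((ContinuousLinearMap.inr ℝ ℝ ℝ).comp (ContinuousLinearMap.snd ℝ ℝ ℝ)))

/-- A family of solutions of linear systems, continuous at time zero in the parameter and at
every time, is jointly continuous. -/
theorem continuous_uncurry_of_linear_ode {E : Type*} [NormedAddCommGroup E] [NormedSpace ℝ E]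
    {V : ℝ → ℝ → E →L[ℝ] E} {Ψ : ℝ → ℝ → E} (cV : Continuous (uncurry V))
    (hΨ : ∀ t x, HasDerivAt (fun τ => Ψ τ x) (V t x (Ψ t x)) t)
    (hc : ∀ t, Continuous (Ψ t)) : Continuous (uncurry Ψ) := by
  rw [continuous_iff_continuousAt]
  rintro ⟨t, x⟩
  set T := |t| + 1
  obtain ⟨B, hB⟩ := ((isCompact_Icc (a := -T) (b := T)).prod
    (isCompact_Icc (a := x - 1) (b := x + 1))).exists_bound_of_continuousOn cV.continuousOn
  obtain ⟨C, hC⟩ := (isCompact_Icc (a := x - 1) (b := x + 1)).exists_bound_of_continuousOn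
    (hc 0).continuousOn
  have hT : 0 < T := by positivity
  have hB0 : 0 ≤ B := (norm_nonneg _).trans (hB (0, x) ⟨⟨by simpa using hT.le, hT.le⟩, by simp, by simp⟩)
  have hC0 : 0 ≤ C := (norm_nonneg _).trans (hC x ⟨by simp, by simp⟩)
  have hbd : ∀ y ∈ Icc (x - 1) (x + 1), ∀ s ∈ Icc (-T) T,
      ‖V s y (Ψ s y)‖ ≤ (B + 1) * ((C + 0 / (B + 1)) * exp ((B + 1) * T)) := by
    have hV : ∀ y ∈ Icc (x - 1) (x + 1), ∀ s ∈ Icc (-T) T,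
        ‖V s y (Ψ s y)‖ ≤ (B + 1) * ‖Ψ s y‖ := by
      intro y hy s hs
      refine ((V s y).le_opNorm _).trans (mul_le_mul_of_nonneg_right ?_ (norm_nonneg _))
      have := hB (s, y) ⟨hs, hy⟩
      simp only [uncurry] at this
      linarith
    intro y hy s hs
    refine (hV y hy s hs).trans (mul_le_mul_of_nonneg_left ?_ (by positivity))
    exact norm_le_of_norm_deriv_le (by positivity) le_rfl (fun τ _ => hΨ τ y)
      (fun τ hτ => by rw [add_zero]; exact hV y hy τ (abs_le.1 hτ)) (hC y hy) (abs_le.2 hs)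
  have hL := continuousOn_prod_of_continuousOn_lipschitzOnWith (uncurry Ψ)
    (s := Icc (-T) T) (t := Icc (x - 1) (x + 1))
    (Real.toNNReal ((B + 1) * ((C + 0 / (B + 1)) * exp ((B + 1) * T))))
    (fun s _ => (hc s).continuousOn)
    (fun y hy => (convex_Icc _ _).lipschitzOnWith_of_nnnorm_hasDerivWithin_le
      (fun s hs => (hΨ s y).hasDerivWithinAt) (fun s hs => by
        rw [← NNReal.coe_le_coe, coe_nnnorm, Real.coe_toNNReal _ (by positivity)]
        exact hbd y hy s hs))
  refine hL.continuousAt (prod_mem_nhds (Icc_mem_nhds ?_ ?_) (Icc_mem_nhds ?_ ?_))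
  · have := neg_abs_le t
    linarith
  · have := le_abs_self t
    linarith
  · linarith
  · linarith

/-- Backward solvability of the characteristic equation `X' = a + 2 q(t, X)`. -/
theorem exists_characteristic {q q1 q2 q3 : ℝ → ℝ → ℝ} (hq : KdVClass q q1 q2 q3) (a t1 x1 : ℝ) :
    ∃ X : ℝ → ℝ, X t1 = x1 ∧ ∀ t, |t| ≤ |t1| → HasDerivAt X (a + 2 * q t (X t)) t := by
  set T := |t1| + 1
  have hT : 1 ≤ T := by simp [T]
  obtain ⟨M, hM⟩ := hq.bdd T
  have hM0 : 0 ≤ M := (abs_nonneg _).trans ((hM 0 (by simp; linarith)).1 0)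
  set L := |a| + 2 * M
  have hL : 0 ≤ L := by positivity
  obtain ⟨B, hB⟩ := ((isCompact_Icc (a := -T) (b := T)).prod
    (isCompact_closedBall x1 (L * (2 * T)))).exists_bound_of_continuousOn hq.c1.continuousOn
  have ht1 : t1 ∈ Icc (-T) T := by
    have := abs_le.1 (le_refl |t1|)
    constructor <;> linarith [this.1, this.2, show T = |t1| + 1 from rfl]
  have pl : IsPicardLindelof (fun t x => a + 2 * q t x) (tmin := -T) (tmax := T)
      ⟨t1, ht1⟩ x1 (Real.toNNReal (L * (2 * T))) 0 (Real.toNNReal L)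
      (Real.toNNReal (2 * B)) := by
    refine ⟨fun t ht => ?_, fun x _ => ?_, fun t ht x _ => ?_, ?_⟩
    · refine (convex_closedBall _ _).lipschitzOnWith_of_nnnorm_hasDerivWithin_le
        (fun x _ => ((hq.d0 t x).const_mul 2 |>.const_add a).hasDerivWithinAt) (fun x hx => ?_)
      rw [Real.coe_toNNReal _ (by positivity)] at hx
      have h1 := hB (t, x) ⟨ht, hx⟩
      simp only [uncurry] at h1
      rw [← NNReal.coe_le_coe, coe_nnnorm,
        Real.coe_toNNReal _ (mul_nonneg zero_le_two ((norm_nonneg _).trans h1)), norm_mul]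
      simpa using h1
    · exact (continuous_const.add (continuous_const.mul (hq.c0.uncurry_right x))).continuousOn
    · rw [Real.coe_toNNReal _ hL, Real.norm_eq_abs]
      have := (hM t (abs_le.2 ht)).1 x
      calc |a + 2 * q t x| ≤ |a| + |2 * q t x| := abs_add_le _ _
        _ ≤ L := by rw [abs_mul, abs_two]; simp only [L]; linarith
    · rw [Real.coe_toNNReal _ (by positivity), Real.coe_toNNReal _ (by positivity)]
      simp only [NNReal.coe_zero, sub_zero]
      exact mul_le_mul_of_nonneg_left (max_le (by linarith [ht1.1]) (by linarith [ht1.2])) hL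
  obtain ⟨X, hX0, hX⟩ := pl.exists_eq_forall_mem_Icc_hasDerivWithinAt₀
  refine ⟨X, hX0, fun t ht => ?_⟩
  have := abs_le.1 ht
  exact (hX t ⟨by linarith, by linarith⟩).hasDerivAt
    (Icc_mem_nhds (by linarith) (by linarith))

/-- Evolution of the logarithmic derivative of a positive eigenfunction along KdV. -/
theorem exists_riccati_evolution {q q1 q2 q3 : ℝ → ℝ → ℝ} (hq : KdVClass q q1 q2 q3) (κ : ℝ)
    {h0 : ℝ → ℝ} (hh0 : ∀ x, HasDerivAt h0 (h0 x ^ 2 - κ ^ 2 + q 0 x) x) :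
    ∃ h : ℝ → ℝ → ℝ, h 0 = h0 ∧ Continuous (uncurry h) ∧
      (∀ t x, HasDerivAt (h t) (h t x ^ 2 - κ ^ 2 + q t x) x) ∧
      ∀ t x, HasDerivAt (fun τ => h τ x) (-(q2 t x + 2 * q1 t x * h t x +
        (4 * κ ^ 2 + 2 * q t x) * (h t x ^ 2 - κ ^ 2 + q t x))) t := by
  let V : ℝ → ℝ → (ℝ × ℝ) →L[ℝ] (ℝ × ℝ) := fun t x =>
    matOp (q1 t x) (-(4 * κ ^ 2 + 2 * q t x))
      (q2 t x - (4 * κ ^ 2 + 2 * q t x) * (κ ^ 2 - q t x)) (-q1 t x)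
  let V' : ℝ → ℝ → (ℝ × ℝ) →L[ℝ] (ℝ × ℝ) := fun t x =>
    matOp (q2 t x) (-(2 * q1 t x))
      (q3 t x - ((2 * q1 t x) * (κ ^ 2 - q t x) + (4 * κ ^ 2 + 2 * q t x) * (-q1 t x)))
      (-q2 t x)
  let U : ℝ → ℝ → (ℝ × ℝ) →L[ℝ] (ℝ × ℝ) := fun t x => matOp 0 1 (κ ^ 2 - q t x) 0
  let U' : ℝ → ℝ → (ℝ × ℝ) →L[ℝ] (ℝ × ℝ) := fun t x =>
    matOp 0 0 (-(-(q3 t x + 6 * q t x * q1 t x))) 0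
  have c0 := hq.c0
  have c1 := hq.c1
  have c2 := hq.c2
  have c3 := hq.c3
  have cV : Continuous (uncurry V) :=
    continuous_matOp c1 (continuous_const.add (continuous_const.mul c0)).neg
      (c2.sub ((continuous_const.add (continuous_const.mul c0)).mul (continuous_const.sub c0)))
      c1.neg
  have cV' : Continuous (uncurry V') :=
    continuous_matOp c2 (continuous_const.mul c1).neg
      (c3.sub (((continuous_const.mul c1).mul (continuous_const.sub c0)).add
        ((continuous_const.add (continuous_const.mul c0)).mul c1.neg))) c2.neg
  have cU : Continuous (uncurry U) :=
    continuous_matOp continuous_const continuous_const (continuous_const.sub c0) continuous_const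
  have hV : ∀ t x, HasDerivAt (V t) (V' t x) x := by
    intro t x
    have e := ((hq.d0 t x).const_mul 2).const_add (4 * κ ^ 2)
    exact hasDerivAt_matOp (hq.d1 t x) e.neg
      ((hq.d2 t x).sub (e.mul ((hq.d0 t x).const_sub (κ ^ 2)))) (hq.d1 t x).neg
  have hU : ∀ t x, HasDerivAt (fun τ => U τ x) (U' t x) t := by
    intro t x
    exact hasDerivAt_matOp (hasDerivAt_const _ _) (hasDerivAt_const _ _)
      ((hq.dt t x).const_sub (κ ^ 2)) (hasDerivAt_const _ _)
  have hz : ∀ t x, U' t x = V' t x + (V t x).comp (U t x) - (U t x).comp (V t x) := by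
    intro t x
    refine ContinuousLinearMap.ext fun p => ?_
    simp only [U', V', V, U, sub_apply, add_apply, ContinuousLinearMap.comp_apply, matOp_apply,
      Prod.mk_add_mk, Prod.mk_sub_mk, Prod.mk.injEq]
    constructor <;> ring
  have ch0 : Continuous h0 := continuous_iff_continuousAt.2 fun x => (hh0 x).continuousAt
  let E : ℝ → ℝ := fun x => exp (-∫ y in (0:ℝ)..x, h0 y)
  have hE : ∀ x, HasDerivAt E (-(h0 x * E x)) x := by
    intro x
    have := (intervalIntegral.integral_hasDerivAt_right (ch0.intervalIntegrable 0 x)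
      (ch0.stronglyMeasurableAtFilter _ _) ch0.continuousAt).neg.exp
    refine HasDerivAt.congr_deriv (f := E) this ?_
    simp only [E, Pi.neg_apply]; ring
  choose Ψ hΨ0 hΨ using fun x => linear_ode_exists (cV.uncurry_right x) (E x, -(h0 x * E x))
  have hx := zero_curvature (Ψ := fun t x => Ψ x t) hV cV cV' hU cU hz (fun t x => hΨ x t) (by
    intro x
    have e1 := (hE x).prodMk ((hh0 x).mul (hE x)).neg
    have : (fun x => Ψ x 0) = fun x => (E x, -(h0 x * E x)) := funext hΨ0
    rw [this]
    refine e1.congr_deriv ?_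
    simp only [U, hΨ0, matOp_apply, Prod.mk.injEq]
    constructor <;> ring)
  have cΨ : Continuous (uncurry fun t x => Ψ x t) :=
    continuous_uncurry_of_linear_ode cV (fun t x => hΨ x t) fun t =>
      continuous_iff_continuousAt.2 fun x => (hx t x).continuousAt
  have px : ∀ t x, HasDerivAt (fun y => (Ψ y t).1) (Ψ x t).2 x ∧
      HasDerivAt (fun y => (Ψ y t).2) ((κ ^ 2 - q t x) * (Ψ x t).1) x := by
    intro t x
    have e1 := (ContinuousLinearMap.fst ℝ ℝ ℝ).hasFDerivAt.comp_hasDerivAt x (hx t x)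
    have e2 := (ContinuousLinearMap.snd ℝ ℝ ℝ).hasFDerivAt.comp_hasDerivAt x (hx t x)
    simp only [U, matOp_apply, ContinuousLinearMap.coe_fst', ContinuousLinearMap.coe_snd',
      zero_mul, zero_add, one_mul, add_zero] at e1 e2
    exact ⟨e1, e2⟩
  have pt : ∀ t x, HasDerivAt (fun τ => (Ψ x τ).1)
        (q1 t x * (Ψ x t).1 + -(4 * κ ^ 2 + 2 * q t x) * (Ψ x t).2) t ∧
      HasDerivAt (fun τ => (Ψ x τ).2) ((q2 t x - (4 * κ ^ 2 + 2 * q t x) * (κ ^ 2 - q t x)) *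
        (Ψ x t).1 + -q1 t x * (Ψ x t).2) t := by
    intro t x
    have e1 := (ContinuousLinearMap.fst ℝ ℝ ℝ).hasFDerivAt.comp_hasDerivAt t (hΨ x t)
    have e2 := (ContinuousLinearMap.snd ℝ ℝ ℝ).hasFDerivAt.comp_hasDerivAt t (hΨ x t)
    simp only [V, matOp_apply, ContinuousLinearMap.coe_fst', ContinuousLinearMap.coe_snd'] at e1 e2
    exact ⟨e1, e2⟩
  have cΨ1 : Continuous (uncurry fun t x => (Ψ x t).1) := continuous_fst.comp cΨ
  have cΨ2 : Continuous (uncurry fun t x => (Ψ x t).2) := continuous_snd.comp cΨ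
  have pos : ∀ t x, 0 < (Ψ x t).1 := by
    intro t x
    obtain ⟨X, hXt, hX⟩ := exists_characteristic hq (4 * κ ^ 2) t x
    have hg : ∀ s, |s| ≤ |t| → HasDerivAt (fun s => (Ψ (X s) s).1)
        (q1 s (X s) * (Ψ (X s) s).1) s := by
      intro s hs
      have := hasDerivAt_along_curve (f := fun s y => (Ψ y s).1) (fun t x => (pt t x).1)
        (fun t x => (px t x).1)
        ((c1.mul cΨ1).add ((continuous_const.add (continuous_const.mul c0)).neg.mul cΨ2)) cΨ2
        (hX s hs)
      exact this.congr_deriv (by ring)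
    have hXc : ContinuousOn X (Icc (-|t|) |t|) := fun s hs =>
      (hX s (abs_le.2 hs)).continuousAt.continuousWithinAt
    obtain ⟨B, hB⟩ := isCompact_Icc.exists_bound_of_continuousOn
      (c1.comp_continuousOn (continuousOn_id.prodMk hXc))
    by_contra hneg
    push Not at hneg
    have hcont : ContinuousOn (fun s => (Ψ (X s) s).1) (uIcc 0 t) := fun s hs => by
      refine (hg s ?_).continuousAt.continuousWithinAt
      simpa using abs_sub_left_of_mem_uIcc hs
    have h00 : 0 < (Ψ (X 0) 0).1 := by rw [hΨ0]; exact exp_pos _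
    obtain ⟨s, hs, hs0⟩ := intermediate_value_uIcc hcont
      (show (0 : ℝ) ∈ uIcc ((Ψ (X 0) 0).1) ((Ψ (X t) t).1) from
        mem_uIcc.2 (Or.inr ⟨by rw [hXt]; exact hneg, h00.le⟩))
    have hst : |s| ≤ |t| := by simpa using abs_sub_left_of_mem_uIcc hs
    have hz0 : (Ψ (X 0) 0).1 = 0 := by
      have main : ∀ (f : ℝ → ℝ) (b : ℝ → ℝ), (∀ r ∈ Icc 0 |s|, HasDerivAt f (b r * f r) r) →
          (∀ r ∈ Icc 0 |s|, |b r| ≤ B) → f 0 = 0 → f |s| = 0 := by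
        intro f b hf hb h0
        refine eq_zero_of_abs_deriv_le_mul_abs_self_of_eq_zero_right (K := B) (a := 0) (b := |s|)
          (f' := fun r => b r * f r)
          (fun r hr => (hf r hr).continuousAt.continuousWithinAt)
          (fun r hr => (hf r (Ico_subset_Icc_self hr)).hasDerivWithinAt) h0 (fun r hr => ?_) _
          ⟨abs_nonneg s, le_rfl⟩
        rw [norm_mul]
        exact mul_le_mul_of_nonneg_right (hb r (Ico_subset_Icc_self hr)) (norm_nonneg _)
      rcases le_total 0 s with h | h
      · have hr : ∀ r ∈ Icc 0 |s|, |s - r| ≤ |t| := fun r hr => by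
          rw [abs_of_nonneg h] at hr hst
          rw [abs_le]; constructor <;> linarith [hr.1, hr.2]
        have := main (fun r => (Ψ (X (s - r)) (s - r)).1) (fun r => -q1 (s - r) (X (s - r)))
          (fun r hr' => by
            have := (hg (s - r) (hr r hr')).scomp r ((hasDerivAt_id r).const_sub s)
            exact this.congr_deriv (by simp))
          (fun r hr' => by
            rw [abs_neg]; exact hB (s - r) (abs_le.1 (hr r hr'))) (by simpa using hs0)
        simpa [abs_of_nonneg h] using this
      · have hr : ∀ r ∈ Icc 0 |s|, |s + r| ≤ |t| := fun r hr => by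
          rw [abs_of_nonpos h] at hr hst
          rw [abs_le]; constructor <;> linarith [hr.1, hr.2]
        have := main (fun r => (Ψ (X (s + r)) (s + r)).1) (fun r => q1 (s + r) (X (s + r)))
          (fun r hr' => by
            have := (hg (s + r) (hr r hr')).scomp r ((hasDerivAt_id r).const_add s)
            exact this.congr_deriv (by simp))
          (fun r hr' => hB (s + r) (abs_le.1 (hr r hr'))) (by simpa using hs0)
        simpa [abs_of_nonpos h] using this
    exact h00.ne' hz0
  refine ⟨fun t x => -(Ψ x t).2 / (Ψ x t).1, ?_, ?_, fun t x => ?_, fun t x => ?_⟩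
  · funext x
    have : E x ≠ 0 := (exp_pos _).ne'
    simp only [hΨ0]
    field_simp
  · exact cΨ2.neg.div cΨ1 fun p => (pos p.1 p.2).ne'
  · have hne := (pos t x).ne'
    refine (((px t x).2.fun_neg).fun_div (px t x).1 hne).congr_deriv ?_
    field_simp
    ring
  · have hne := (pos t x).ne'
    refine (((pt t x).2.fun_neg).fun_div (pt t x).1 hne).congr_deriv ?_
    field_simp
    ring

theorem integrable_of_symm_intervalIntegral_le {f : ℝ → ℝ} {C : ℝ} (hf : Continuous f)
    (h0 : ∀ x, 0 ≤ f x) (h : ∀ R : ℝ, 0 ≤ R → ∫ x in (-R)..R, f x ≤ C) :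
    Integrable f ∧ ∫ x, f x ≤ C := by
  have hi : Integrable f := by
    refine integrable_of_intervalIntegral_norm_bounded (μ := volume) (f := f) C
      (a := fun R : ℝ => -R) (b := fun R => R) (l := atTop)
      (fun R => (hf.integrableOn_Icc).mono_set Ioc_subset_Icc_self)
      tendsto_neg_atTop_atBot tendsto_id ?_
    filter_upwards [eventually_ge_atTop 0] with R hR
    simpa [Real.norm_eq_abs, abs_of_nonneg (h0 _)] using h R hR
  refine ⟨hi, ?_⟩
  have := intervalIntegral_tendsto_integral hi tendsto_neg_atTop_atBot
    (tendsto_id (α := ℝ) (x := atTop))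
  exact le_of_tendsto this ((eventually_ge_atTop 0).mono fun R hR => h R hR)

theorem intervalIntegral_le_integral_of_nonneg {f : ℝ → ℝ} (hf : Integrable f)
    (h0 : ∀ x, 0 ≤ f x) {a b : ℝ} (hab : a ≤ b) : ∫ x in a..b, f x ≤ ∫ x, f x := by
  rw [intervalIntegral.integral_of_le hab]
  exact setIntegral_le_integral hf (Eventually.of_forall h0)

/-- A global solution of a Riccati equation is bounded. -/
theorem riccati_sq_le {h q : ℝ → ℝ} {κ M : ℝ}
    (hh : ∀ x, HasDerivAt h (h x ^ 2 - κ ^ 2 + q x) x) (hq : ∀ x, |q x| ≤ M) (x : ℝ) :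
    |h x| ≤ √(κ ^ 2 + M) := by
  have hM : 0 ≤ M := (abs_nonneg _).trans (hq 0)
  set K := √(κ ^ 2 + M) with hK
  have hK2 : K ^ 2 = κ ^ 2 + M := Real.sq_sqrt (by positivity)
  have hK0 : 0 ≤ K := Real.sqrt_nonneg _
  have main : ∀ (h q : ℝ → ℝ), (∀ x, HasDerivAt h (h x ^ 2 - κ ^ 2 + q x) x) →
      (∀ x, |q x| ≤ M) → ∀ x, h x ≤ K := by
    intro h q hh hq x0
    by_contra hlt
    push Not at hlt
    have ch : Continuous h := continuous_iff_continuousAt.2 fun x => (hh x).continuousAt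
    let E : ℝ → ℝ := fun x => exp (-∫ y in x0..x, h y)
    have hE : ∀ x, HasDerivAt E (-(h x * E x)) x := by
      intro x
      have := (intervalIntegral.integral_hasDerivAt_right (ch.intervalIntegrable x0 x)
        (ch.stronglyMeasurableAtFilter _ _) ch.continuousAt).neg.exp
      refine HasDerivAt.congr_deriv (f := E) this ?_
      simp only [E, Pi.neg_apply]; ring
    have hE0 : ∀ x, 0 < E x := fun x => exp_pos _
    have hEx0 : E x0 = 1 := by simp [E]
    let p : ℝ → ℝ := fun x => (K - h x) * E x * exp (-K * x)
    have hp : ∀ x, HasDerivAt p (-((κ ^ 2 + M - κ ^ 2 + q x) * E x * exp (-K * x))) x := by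
      intro x
      have e1 := (((hh x).const_sub K).mul (hE x)).mul
        (((hasDerivAt_id x).const_mul (-K)).exp)
      refine HasDerivAt.congr_deriv (f := p) e1 ?_
      simp only [id, Pi.mul_apply]
      linear_combination (- E x * exp (-K * x)) * hK2
    have hpa : Antitone p := antitone_of_hasDerivAt_nonpos hp fun x => by
      have : 0 ≤ κ ^ 2 + M - κ ^ 2 + q x := by linarith [(abs_le.1 (hq x)).1]
      have := hE0 x
      exact neg_nonpos.2 (by positivity)
    set g := (K - h x0) with hg
    have hg0 : g < 0 := by linarith
    have hlow : ∀ x, x0 ≤ x → (K - h x) * E x ≤ g := by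
      intro x hx
      have h1 : (K - h x) * E x * exp (-K * x) ≤ (K - h x0) * E x0 * exp (-K * x0) := hpa hx
      rw [hEx0, mul_one] at h1
      have h2 : exp (-K * x) ≤ exp (-K * x0) := exp_le_exp.2 (by nlinarith)
      have h3 : 0 < exp (-K * x) := exp_pos _
      by_contra hcon
      push Not at hcon
      nlinarith [mul_lt_mul_of_pos_right hcon h3]
    have hfin : ∀ x, x0 ≤ x → E x ≤ 1 + g * (x - x0) := by
      intro x hx
      have := (convex_Icc x0 x).image_sub_le_mul_sub_of_deriv_le (f := E) (C := g)
        (fun y _ => (hE y).continuousAt.continuousWithinAt)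
        (fun y _ => (hE y).differentiableAt.differentiableWithinAt) (fun y hy => by
          rw [(hE y).deriv]
          rw [interior_Icc] at hy
          have := hlow y hy.1.le
          nlinarith [mul_nonneg hK0 (hE0 y).le]) x0 (left_mem_Icc.2 hx) x (right_mem_Icc.2 hx) hx
      rw [hEx0] at this
      linarith
    have hx : x0 ≤ x0 + 1 / (-g) := by
      have : 0 < 1 / (-g) := by apply div_pos one_pos; linarith
      linarith
    have h1 := hfin _ hx
    have h2 : g * (x0 + 1 / (-g) - x0) = -1 := by
      have : g ≠ 0 := hg0.ne
      rw [add_sub_cancel_left, mul_one_div, div_neg, div_self this]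
    rw [h2] at h1
    linarith [hE0 (x0 + 1 / (-g))]
  rw [abs_le]
  refine ⟨?_, main h q hh hq x⟩
  have := main (fun y => -h (-y)) (fun y => q (-y)) (fun y => ?_) (fun y => hq _) (-x)
  · simp only [neg_neg] at this; linarith
  · have := ((hh (-y)).scomp y (hasDerivAt_neg y)).neg
    refine HasDerivAt.congr_deriv this ?_
    simp

/-- The data of an evolving Riccati function. -/
structure RiccatiFlow (q q1 q2 : ℝ → ℝ → ℝ) (κ : ℝ) (h : ℝ → ℝ → ℝ) : Prop where
  c : Continuous (uncurry h)
  dx : ∀ t x, HasDerivAt (h t) (h t x ^ 2 - κ ^ 2 + q t x) x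
  dt : ∀ t x, HasDerivAt (fun τ => h τ x) (-(q2 t x + 2 * q1 t x * h t x +
        (4 * κ ^ 2 + 2 * q t x) * (h t x ^ 2 - κ ^ 2 + q t x))) t

/-- The Darboux transform of a solution is again a solution of the same class. -/
theorem RiccatiFlow.darboux {q q1 q2 q3 h : ℝ → ℝ → ℝ} {κ : ℝ} (hq : KdVClass q q1 q2 q3)
    (H : RiccatiFlow q q1 q2 κ h) :
    ∃ w1 w2 w3, KdVClass (fun t x => -q t x - 2 * h t x ^ 2 + 2 * κ ^ 2) w1 w2 w3 := by
  let h1 : ℝ → ℝ → ℝ := fun t x => h t x ^ 2 - κ ^ 2 + q t x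
  let h2 : ℝ → ℝ → ℝ := fun t x => 2 * h t x * h1 t x + q1 t x
  let h3 : ℝ → ℝ → ℝ := fun t x => 2 * (h1 t x * h1 t x + h t x * h2 t x) + q2 t x
  have c := H.c
  have c0 := hq.c0
  have c1 := hq.c1
  have c2 := hq.c2
  have c3 := hq.c3
  have ch1 : Continuous (uncurry h1) := ((c.pow 2).sub continuous_const).add c0
  have ch2 : Continuous (uncurry h2) := ((continuous_const.mul c).mul ch1).add c1
  have ch3 : Continuous (uncurry h3) :=
    (continuous_const.mul ((ch1.mul ch1).add (c.mul ch2))).add c2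
  have d1 : ∀ t x, HasDerivAt (h1 t) (h2 t x) x := fun t x =>
    ((((H.dx t x).pow 2).sub_const (κ ^ 2)).add (hq.d0 t x)).congr_deriv
      (by simp only [h2, h1]; ring)
  have d2 : ∀ t x, HasDerivAt (h2 t) (h3 t x) x := fun t x =>
    ((((H.dx t x).const_mul 2).mul (d1 t x)).add (hq.d1 t x)).congr_deriv
      (by simp only [h3, h2, h1]; ring)
  let w : ℝ → ℝ → ℝ := fun t x => -q t x - 2 * h t x ^ 2 + 2 * κ ^ 2
  let w1 : ℝ → ℝ → ℝ := fun t x => -q1 t x - 4 * (h t x * h1 t x)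
  let w2 : ℝ → ℝ → ℝ := fun t x => -q2 t x - 4 * (h1 t x * h1 t x + h t x * h2 t x)
  let w3 : ℝ → ℝ → ℝ := fun t x =>
    -q3 t x - 4 * (2 * (h1 t x * h2 t x) + h1 t x * h2 t x + h t x * h3 t x)
  have cw : Continuous (uncurry w) :=
    (c0.neg.sub (continuous_const.mul (c.pow 2))).add continuous_const
  have cw1 : Continuous (uncurry w1) := c1.neg.sub (continuous_const.mul (c.mul ch1))
  refine ⟨w1, w2, w3, ⟨fun t x => ?_, fun t x => ?_, fun t x => ?_, fun t x => ?_,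
    cw, cw1, ?_, ?_⟩, fun T => ?_⟩
  · refine (((hq.d0 t x).fun_neg.fun_sub (((H.dx t x).fun_pow 2).const_mul 2)).add_const
      (2 * κ ^ 2)).congr_deriv ?_
    simp only [w1, h1]; ring
  · refine ((hq.d1 t x).fun_neg.fun_sub (((H.dx t x).fun_mul (d1 t x)).const_mul 4)).congr_deriv ?_
    simp only [w2, h2, h1]
  · refine ((hq.d2 t x).fun_neg.fun_sub ((((d1 t x).fun_mul (d1 t x)).fun_add
      ((H.dx t x).fun_mul (d2 t x))).const_mul 4)).congr_deriv ?_
    simp only [w3, h3, h2, h1]; ring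
  · refine (((hq.dt t x).fun_neg.fun_sub (((H.dt t x).fun_pow 2).const_mul 2)).add_const
      (2 * κ ^ 2)).congr_deriv ?_
    simp only [w3, w1, h3, h2, h1]; ring
  · exact c2.neg.sub (continuous_const.mul ((ch1.mul ch1).add (c.mul ch2)))
  · exact c3.neg.sub (continuous_const.mul
      (((continuous_const.mul (ch1.mul ch2)).add (ch1.mul ch2)).add (c.mul ch3)))
  · obtain ⟨M, hM⟩ := hq.bdd T
    set K := √(κ ^ 2 + M) with hK
    have hK0 : 0 ≤ K := Real.sqrt_nonneg _
    set W := M + 2 * (4 * K ^ 3 / 3 + 4 * κ ^ 2 * K) with hW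
    refine ⟨max (M + 2 * K ^ 2 + 2 * κ ^ 2) (max W (2 * M + 16 * K ^ 2 * (M + W))),
      fun t ht => ?_⟩
    obtain ⟨b0, i0, i1, e0, e1⟩ := hM t ht
    have hb : ∀ x, |h t x| ≤ K := fun x => riccati_sq_le (H.dx t) b0 x
    have hsq : ∀ x, h t x ^ 2 ≤ K ^ 2 := fun x => sq_le_sq' (abs_le.1 (hb x)).1 (abs_le.1 (hb x)).2
    have cub : ∀ x, |4 * h t x ^ 3 / 3 - 4 * κ ^ 2 * h t x| ≤ 4 * K ^ 3 / 3 + 4 * κ ^ 2 * K := by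
      intro x
      have h3 : |h t x| ^ 3 ≤ K ^ 3 := pow_le_pow_left₀ (abs_nonneg _) (hb x) 3
      calc |4 * h t x ^ 3 / 3 - 4 * κ ^ 2 * h t x|
          ≤ |4 * h t x ^ 3 / 3| + |4 * κ ^ 2 * h t x| := abs_sub _ _
        _ = 4 * |h t x| ^ 3 / 3 + 4 * κ ^ 2 * |h t x| := by
            rw [abs_div, abs_mul, abs_mul, abs_mul, abs_pow, abs_pow, sq_abs]; norm_num
        _ ≤ _ := by nlinarith [mul_le_mul_of_nonneg_left (hb x) (sq_nonneg κ)]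
    have cont : ∀ {f : ℝ → ℝ → ℝ}, Continuous (uncurry f) → Continuous (f t) := fun hf =>
      hf.uncurry_left t
    have hw := integrable_of_symm_intervalIntegral_le (f := fun x => w t x ^ 2) (C := W)
      ((cont cw).pow 2) (fun x => sq_nonneg _) (fun R hR => by
        have hd : ∀ x, HasDerivAt (fun y => 4 * h t y ^ 3 / 3 - 4 * κ ^ 2 * h t y)
            (w t x ^ 2 - q t x ^ 2) x := fun x => by
          refine (((((H.dx t x).fun_pow 3).const_mul 4).div_const 3).fun_sub
            ((H.dx t x).const_mul (4 * κ ^ 2))).congr_deriv ?_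
          simp only [w]; push_cast; ring
        have ii : IntervalIntegrable (fun x => w t x ^ 2) volume (-R) R :=
          ((cont cw).pow 2).intervalIntegrable _ _
        have iq : IntervalIntegrable (fun x => q t x ^ 2) volume (-R) R :=
          ((cont c0).pow 2).intervalIntegrable _ _
        have := intervalIntegral.integral_eq_sub_of_hasDerivAt (a := -R) (b := R)
          (fun x _ => hd x) (ii.sub iq)
        rw [intervalIntegral.integral_sub ii iq] at this
        have hle := intervalIntegral_le_integral_of_nonneg i0 (fun x => sq_nonneg _)
          (show -R ≤ R by linarith)
        have := abs_le.1 (cub R)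
        have := abs_le.1 (cub (-R))
        simp only [hW]
        linarith [this.1, this.2])
    have hdom : ∀ x, w1 t x ^ 2 ≤ 2 * q1 t x ^ 2 + 16 * K ^ 2 * (q t x ^ 2 + w t x ^ 2) := by
      intro x
      have e : h1 t x = (q t x - w t x) / 2 := by simp only [w, h1]; ring
      have e2 : w1 t x ^ 2 ≤ 2 * q1 t x ^ 2 + 32 * (h t x ^ 2 * h1 t x ^ 2) := by
        simp only [w1]
        nlinarith [sq_nonneg (q1 t x - 4 * (h t x * h1 t x))]
      have e3 : h t x ^ 2 * h1 t x ^ 2 ≤ K ^ 2 * h1 t x ^ 2 :=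
        mul_le_mul_of_nonneg_right (hsq x) (sq_nonneg _)
      have e4 : h1 t x ^ 2 ≤ (q t x ^ 2 + w t x ^ 2) / 2 := by
        rw [e]; nlinarith [sq_nonneg (q t x + w t x)]
      nlinarith [mul_le_mul_of_nonneg_left e4 (sq_nonneg K)]
    have idom : Integrable fun x => 2 * q1 t x ^ 2 + 16 * K ^ 2 * (q t x ^ 2 + w t x ^ 2) :=
      (i1.const_mul 2).add ((i0.add hw.1).const_mul _)
    have iw1 : Integrable fun x => w1 t x ^ 2 := by
      refine idom.mono' ((cont cw1).pow 2).aestronglyMeasurable (Eventually.of_forall fun x => ?_)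
      rw [Real.norm_eq_abs, abs_of_nonneg (sq_nonneg _)]
      exact hdom x
    refine ⟨fun x => ?_, hw.1, iw1, ?_, ?_⟩
    · refine le_trans ?_ (le_max_left _ _)
      rw [abs_le]
      have := abs_le.1 (b0 x)
      have := hsq x
      constructor <;> nlinarith [sq_nonneg (h t x), sq_nonneg κ, sq_nonneg K]
    · exact hw.2.trans ((le_max_left _ _).trans (le_max_right _ _))
    · refine le_trans ?_ ((le_max_right _ _).trans (le_max_right _ _))
      refine (integral_mono iw1 idom hdom).trans ?_
      have i2 : Integrable fun x => q t x ^ 2 + w t x ^ 2 := i0.add hw.1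
      rw [integral_add (i1.const_mul 2) (i2.const_mul _), integral_const_mul, integral_const_mul,
        integral_add i0 hw.1]
      have := hw.2
      gcongr

theorem integrable_mul_of_sq {f g : ℝ → ℝ} (cf : Continuous f) (cg : Continuous g)
    (hf : Integrable fun x => f x ^ 2) (hg : Integrable fun x => g x ^ 2) :
    Integrable fun x => f x * g x := by
  refine (hf.add hg).mono' (cf.mul cg).aestronglyMeasurable (Eventually.of_forall fun x => ?_)
  simp only [Pi.add_apply, Real.norm_eq_abs]
  rw [abs_le]
  constructor <;> nlinarith [sq_nonneg (f x + g x), sq_nonneg (f x - g x)]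

theorem sq_le_integral_sq_add {f f' : ℝ → ℝ} (hf : ∀ x, HasDerivAt f (f' x) x)
    (cf' : Continuous f') (i0 : Integrable fun x => f x ^ 2) (i1 : Integrable fun x => f' x ^ 2)
    (x : ℝ) : f x ^ 2 ≤ (∫ x, f x ^ 2) + ∫ x, f' x ^ 2 := by
  have cf : Continuous f := continuous_iff_continuousAt.2 fun x => (hf x).continuousAt
  have hd : ∀ x, HasDerivAt (fun y => f y ^ 2) (2 * (f x * f' x)) x := fun x =>
    ((hf x).fun_pow 2).congr_deriv (by ring)
  have im : Integrable fun x => 2 * (f x * f' x) := (integrable_mul_of_sq cf cf' i0 i1).const_mul 2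
  have h := integral_Iic_of_hasDerivAt_of_tendsto' (a := x) (fun y _ => hd y) im.integrableOn
    (tendsto_zero_of_hasDerivAt_of_integrableOn_Iic (a := x) (fun y _ => hd y) im.integrableOn
      i0.integrableOn)
  rw [sub_zero] at h
  rw [← h, ← integral_add i0 i1]
  refine (setIntegral_mono im.integrableOn (i0.add i1).integrableOn fun y => ?_).trans
    (setIntegral_le_integral (i0.add i1) (Eventually.of_forall fun y => ?_))
  · simp only [Pi.add_apply]; nlinarith [sq_nonneg (f y - f' y)]
  · simp only [Pi.add_apply, Pi.zero_apply]; positivity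

/-- The spatial average `∫₀¹ g (x + h r) dr`. -/
noncomputable def shiftAvg (g : ℝ → ℝ) (h x : ℝ) : ℝ := ∫ r in (0:ℝ)..1, g (x + h * r)

theorem continuous_shiftAvg {g : ℝ → ℝ → ℝ} (hg : Continuous (uncurry g)) :
    Continuous fun p : ℝ × ℝ × ℝ => shiftAvg (g p.1) p.2.1 p.2.2 := by
  unfold shiftAvg
  refine intervalIntegral.continuous_parametric_intervalIntegral_of_continuous'
    (f := fun (p : ℝ × ℝ × ℝ) r => g p.1 (p.2.2 + p.2.1 * r)) ?_ _ _
  exact hg.comp (f := fun (p : (ℝ × ℝ × ℝ) × ℝ) => (p.1.1, p.1.2.2 + p.1.2.1 * p.2)) (by fun_prop)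

theorem sq_shiftAvg_le {g : ℝ → ℝ} (cg : Continuous g) (h x : ℝ) :
    shiftAvg g h x ^ 2 ≤ shiftAvg (fun y => g y ^ 2) h x := by
  set m := shiftAvg g h x with hm
  have c1 : Continuous fun r : ℝ => g (x + h * r) := by fun_prop
  have h0 : 0 ≤ ∫ r in (0:ℝ)..1, (g (x + h * r) - m) ^ 2 :=
    intervalIntegral.integral_nonneg zero_le_one fun r _ => sq_nonneg _
  have e : ∫ r in (0:ℝ)..1, (g (x + h * r) - m) ^ 2 =
      (∫ r in (0:ℝ)..1, g (x + h * r) ^ 2) - 2 * m * (∫ r in (0:ℝ)..1, g (x + h * r)) + m ^ 2 := by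
    have c2 : Continuous fun r : ℝ => g (x + h * r) ^ 2 := c1.pow 2
    have c3 : Continuous fun r : ℝ => 2 * m * g (x + h * r) := continuous_const.mul c1
    rw [← intervalIntegral.integral_const_mul, ← intervalIntegral.integral_sub
      (c2.intervalIntegrable _ _) (c3.intervalIntegrable _ _)]
    have : m ^ 2 = ∫ r in (0:ℝ)..1, m ^ 2 := by simp
    have c4 : Continuous fun r : ℝ => g (x + h * r) ^ 2 - 2 * m * g (x + h * r) := c2.sub c3
    rw [this, ← intervalIntegral.integral_add (c4.intervalIntegrable _ _)
      (continuous_const.intervalIntegrable _ _)]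
    exact intervalIntegral.integral_congr fun r _ => by ring
  rw [e] at h0
  have : ∫ r in (0:ℝ)..1, g (x + h * r) = m := rfl
  rw [this] at h0
  change m ^ 2 ≤ ∫ r in (0:ℝ)..1, g (x + h * r) ^ 2
  nlinarith

theorem integrable_shiftAvg_sq {g : ℝ → ℝ} (cg : Continuous g) (ig : Integrable fun x => g x ^ 2)
    (h : ℝ) : Integrable (fun x => shiftAvg g h x ^ 2) ∧
      ∫ x, shiftAvg g h x ^ 2 ≤ ∫ x, g x ^ 2 := by
  have cA : ∀ {f : ℝ → ℝ}, Continuous f → Continuous fun x => shiftAvg f h x := fun {f} hf =>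
    (continuous_shiftAvg (g := fun _ => f) (hf.comp continuous_snd)).comp
      (f := fun x : ℝ => ((0:ℝ), h, x)) (by fun_prop)
  refine integrable_of_symm_intervalIntegral_le ((cA cg).pow 2) (fun x => sq_nonneg _)
    fun R hR => ?_
  have h1 : ∫ x in (-R)..R, shiftAvg g h x ^ 2 ≤ ∫ x in (-R)..R, shiftAvg (fun y => g y ^ 2) h x :=
    intervalIntegral.integral_mono_on (by linarith) (((cA cg).pow 2).intervalIntegrable _ _)
      ((cA (cg.pow 2)).intervalIntegrable _ _) fun x _ => sq_shiftAvg_le cg h x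
  refine h1.trans ?_
  unfold shiftAvg
  rw [intervalIntegral_intervalIntegral_swap (F := fun x r => g (x + h * r) ^ 2)]
  · have : ∀ r, ∫ x in (-R)..R, g (x + h * r) ^ 2 ≤ ∫ x, g x ^ 2 := fun r =>
      (intervalIntegral_le_integral_of_nonneg (ig.comp_add_right (h * r)) (fun x => sq_nonneg _)
        (by linarith)).trans (le_of_eq (integral_add_right_eq_self (fun x => g x ^ 2) (h * r)))
    have := intervalIntegral.integral_mono_on (μ := volume) (a := 0) (b := 1)
      (g := fun _ => ∫ x, g x ^ 2) zero_le_one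
      (f := fun r => ∫ x in (-R)..R, g (x + h * r) ^ 2)
      ((intervalIntegral.continuous_parametric_intervalIntegral_of_continuous' (μ := volume)
        (f := fun r x => g (x + h * r) ^ 2) (by fun_prop) _ _).intervalIntegrable _ _)
      ((continuous_const (y := ∫ x, g x ^ 2)).intervalIntegrable 0 1) (fun r _ => this r)
    simpa using this
  · have : Continuous (uncurry fun x r : ℝ => g (x + h * r) ^ 2) := by unfold uncurry; fun_prop
    exact (this.continuousOn.integrableOn_compact (isCompact_uIcc.prod isCompact_uIcc)).mono_set
      (prod_mono uIoc_subset_uIcc uIoc_subset_uIcc)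

theorem l2_conservation {q q1 q2 q3 : ℝ → ℝ → ℝ} (hq : KdVReg q q1 q2 q3) {s t M : ℝ}
    (hst : s ≤ t) (hM : ∀ τ ∈ Icc s t, Integrable (fun x => q τ x ^ 2) ∧
      Integrable (fun x => q1 τ x ^ 2) ∧ (∫ x, q τ x ^ 2) + ∫ x, q1 τ x ^ 2 ≤ M) :
    ∫ x, q t x ^ 2 = ∫ x, q s x ^ 2 := by
  have cont : ∀ {f : ℝ → ℝ → ℝ} {t}, Continuous (uncurry f) → Continuous (f t) := fun hf =>
      hf.uncurry_left _
  have c0 := hq.c0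
  have c1 := hq.c1
  have c2 := hq.c2
  have c3 := hq.c3
  have hb : ∀ τ ∈ Icc s t, ∀ x, |q τ x| ≤ √M := fun τ hτ x => by
    obtain ⟨i0, i1, e⟩ := hM τ hτ
    exact abs_le_sqrt ((sq_le_integral_sq_add (hq.d0 τ) (cont c1) i0 i1 x).trans e)
  have h := conservation_law (ρ := fun t x => q t x ^ 2) (σ := fun _ _ => 0)
    (F := fun t x => 3 * q1 t x ^ 2 - 4 * q t x ^ 3)
    (F' := fun t x => 6 * q1 t x * q2 t x - 12 * q t x ^ 2 * q1 t x)
    (G := fun t x => -2 * (q t x * q1 t x))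
    (G' := fun t x => -2 * (q1 t x * q1 t x + q t x * q2 t x))
    (G'' := fun t x => -2 * (2 * (q1 t x * q2 t x) + q1 t x * q2 t x + q t x * q3 t x))
    (s := s) (t := t) (a := 0) (C := (3 + 4 * √M + 2) * M) hst
    (fun τ x => ((hq.dt τ x).fun_pow 2).congr_deriv (by ring))
    (fun τ x => ((((hq.d1 τ x).fun_pow 2).const_mul 3).fun_sub
      (((hq.d0 τ x).fun_pow 3).const_mul 4)).congr_deriv (by ring))
    (fun τ x => ((hq.d0 τ x).fun_mul (hq.d1 τ x)).const_mul (-2))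
    (fun τ x => ((((hq.d1 τ x).fun_mul (hq.d1 τ x)).fun_add
      ((hq.d0 τ x).fun_mul (hq.d2 τ x))).const_mul (-2)).congr_deriv (by ring))
    (c0.pow 2) continuous_const (by unfold uncurry at *; fun_prop)
    (by unfold uncurry at *; fun_prop) (by simp)
  have dom : ∀ τ ∈ Icc s t, ∀ f : ℝ → ℝ, Continuous f →
      (∀ x, |f x| ≤ (3 + 4 * √M + 2) * (q τ x ^ 2 + q1 τ x ^ 2)) →
      Integrable f ∧ ∫ x, |f x| ≤ (3 + 4 * √M + 2) * M := by
    intro τ hτ f cf hf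
    obtain ⟨i0, i1, e⟩ := hM τ hτ
    have ig : Integrable fun x => (3 + 4 * √M + 2) * (q τ x ^ 2 + q1 τ x ^ 2) :=
      (i0.add i1).const_mul _
    have i := ig.mono' cf.aestronglyMeasurable (Eventually.of_forall hf)
    refine ⟨i, (integral_mono i.abs ig hf).trans ?_⟩
    rw [integral_const_mul, integral_add i0 i1]
    have : 0 ≤ √M := Real.sqrt_nonneg _
    gcongr
  have := h (fun τ hτ => dom τ hτ _ (by have := cont (t := τ) c0; have := cont (t := τ) c1; fun_prop)
      fun x => by
        have h1 := abs_le.1 (hb τ hτ x)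
        have := Real.sqrt_nonneg M
        have e3 : q τ x ^ 3 = q τ x * q τ x ^ 2 := by ring
        have p0 := sq_nonneg (q τ x)
        have p1 := sq_nonneg (q1 τ x)
        rw [e3, abs_le]
        constructor <;> nlinarith [mul_nonneg this p0, mul_nonneg this p1,
          mul_nonneg (sub_nonneg.2 h1.2) p0, mul_nonneg (sub_nonneg.2 h1.1) p0])
    (fun τ hτ => dom τ hτ _ (by have := cont (t := τ) c0; have := cont (t := τ) c1; fun_prop)
      fun x => by
        have := Real.sqrt_nonneg M
        have p0 := sq_nonneg (q τ x)
        have p1 := sq_nonneg (q1 τ x)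
        rw [abs_le]
        constructor <;> nlinarith [mul_nonneg this p0, mul_nonneg this p1,
          sq_nonneg (q τ x - q1 τ x), sq_nonneg (q τ x + q1 τ x)])
    (hM s ⟨le_rfl, hst⟩).1 (hM t ⟨hst, le_rfl⟩).1
  rw [zero_mul] at this
  exact sub_eq_zero.1 (abs_nonpos_iff.1 this)

theorem mul_shiftAvg_eq (g : ℝ → ℝ) (h x : ℝ) : h * shiftAvg g h x = ∫ y in x..(x + h), g y := by
  unfold shiftAvg
  rw [intervalIntegral.mul_integral_comp_add_mul]
  simp

theorem hasDerivAt_mul_shiftAvg {g : ℝ → ℝ} (cg : Continuous g) (h x : ℝ) :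
    HasDerivAt (fun y => h * shiftAvg g h y) (g (x + h) - g x) x := by
  have e : (fun y => h * shiftAvg g h y) =
      fun y => (∫ z in (0:ℝ)..(y + h), g z) - ∫ z in (0:ℝ)..y, g z := by
    funext y
    rw [mul_shiftAvg_eq, intervalIntegral.integral_interval_sub_left] <;>
      exact cg.intervalIntegrable _ _
  rw [e]
  have hd : ∀ y, HasDerivAt (fun y => ∫ z in (0:ℝ)..y, g z) (g y) y := fun y =>
    intervalIntegral.integral_hasDerivAt_right (cg.intervalIntegrable _ _)
      (cg.stronglyMeasurableAtFilter _ _) cg.continuousAt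
  exact ((hd (x + h)).comp_add_const x h).sub (hd x)

theorem abs_shiftAvg_le {g : ℝ → ℝ} {S : ℝ} (hS : ∀ x, |g x| ≤ S) (h x : ℝ) :
    |shiftAvg g h x| ≤ S := by
  have := intervalIntegral.norm_integral_le_of_norm_le_const (a := (0:ℝ)) (b := 1)
    (f := fun r => g (x + h * r)) (C := S) fun r _ => hS _
  simpa [shiftAvg] using this

theorem abs_sub_le_mul_shiftAvg {g g' : ℝ → ℝ} (hg : ∀ x, HasDerivAt g (g' x) x)
    (cg' : Continuous g') {h : ℝ} (hh : 0 ≤ h) {r : ℝ} (hr : r ∈ Icc (0:ℝ) 1) (x : ℝ) :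
    |g (x + h * r) - g x| ≤ h * shiftAvg (fun y => |g' y|) h x := by
  have hle : x ≤ x + h * r := by nlinarith [mul_nonneg hh hr.1]
  rw [mul_shiftAvg_eq, ← intervalIntegral.integral_eq_sub_of_hasDerivAt (fun y _ => hg y)
    (cg'.intervalIntegrable _ _)]
  refine (intervalIntegral.abs_integral_le_integral_abs hle).trans ?_
  exact intervalIntegral.integral_mono_interval le_rfl hle (by nlinarith [hr.2])
    (Eventually.of_forall fun y => abs_nonneg _) (cg'.abs.intervalIntegrable _ _)

theorem abs_sub_avg_le {g g' : ℝ → ℝ} (hg : ∀ x, HasDerivAt g (g' x) x)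
    (cg' : Continuous g') {h : ℝ} (hh : 0 ≤ h) (x : ℝ) :
    |g x + g (x + h) - 2 * shiftAvg g h x| ≤ 3 * (h * shiftAvg (fun y => |g' y|) h x) := by
  set P := h * shiftAvg (fun y => |g' y|) h x with hP
  have cg : Continuous g := continuous_iff_continuousAt.2 fun x => (hg x).continuousAt
  have c1 : Continuous fun r : ℝ => g (x + h * r) := by fun_prop
  have c2 : Continuous fun r : ℝ => 2 * g (x + h * r) := continuous_const.mul c1
  have e : g x + g (x + h) - 2 * shiftAvg g h x =
      ∫ r in (0:ℝ)..1, (g x + g (x + h) - 2 * g (x + h * r)) := by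
    rw [intervalIntegral.integral_sub (continuous_const.intervalIntegrable _ _)
      (c2.intervalIntegrable _ _), intervalIntegral.integral_const_mul]
    simp [shiftAvg]
  rw [e]
  have := intervalIntegral.norm_integral_le_of_norm_le_const (a := (0:ℝ)) (b := 1)
    (f := fun r => g x + g (x + h) - 2 * g (x + h * r)) (C := 3 * P) fun r hr => by
      rw [uIoc_of_le zero_le_one] at hr
      have h1 := abs_le.1 (abs_sub_le_mul_shiftAvg hg cg' hh ⟨hr.1.le, hr.2⟩ x)
      have h2 := abs_le.1 (abs_sub_le_mul_shiftAvg hg cg' hh (right_mem_Icc.2 zero_le_one) x)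
      rw [mul_one] at h2
      rw [Real.norm_eq_abs, abs_le]
      constructor <;> linarith [h1.1, h1.2, h2.1, h2.2]
  simpa using this

set_option maxHeartbeats 1000000 in
theorem abs_flux_le {a b a1 b1 A S h : ℝ} (hS : 0 ≤ S) (ha : |a| ≤ S) (hb : |b| ≤ S)
    (hA : |A| ≤ S) (h0 : 0 < h) (hAh : |A| ≤ h * S) :
    |3 * (b1 - a1) ^ 2 - 4 * ((a + b) * (b - a) ^ 2) + 2 * ((a + b) * (A * (b1 - a1)))
      - 4 * ((a1 + b1) * ((b - a) * A)) + 3 * ((a ^ 2 + b ^ 2) * A ^ 2) + 3 * A ^ 4 / h ^ 2| ≤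
    40 * (1 + S + S ^ 2) * (a ^ 2 + b ^ 2 + a1 ^ 2 + b1 ^ 2 + A ^ 2) := by
  set E := a ^ 2 + b ^ 2 + a1 ^ 2 + b1 ^ 2 + A ^ 2 with hE
  have hE0 : 0 ≤ E := by positivity
  have hab : |a + b| ≤ 2 * S := (abs_add_le a b).trans (by linarith)
  have hA2 : A ^ 2 ≤ S ^ 2 := sq_le_sq' (abs_le.1 hA).1 (abs_le.1 hA).2
  have hA3 : A ^ 2 / h ^ 2 ≤ S ^ 2 := by
    rw [div_le_iff₀ (by positivity), ← mul_pow, mul_comm S h]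
    exact sq_le_sq' (abs_le.1 hAh).1 (abs_le.1 hAh).2
  have t1 : |3 * (b1 - a1) ^ 2| ≤ 6 * E := by
    rw [abs_of_nonneg (by positivity)]
    nlinarith [sq_nonneg (b1 + a1), sq_nonneg a, sq_nonneg b, sq_nonneg A]
  have t2 : |4 * ((a + b) * (b - a) ^ 2)| ≤ 16 * S * E := by
    rw [abs_mul, abs_mul, abs_of_nonneg (sq_nonneg (b - a)), abs_of_pos (by norm_num : (0:ℝ) < 4)]
    have : (b - a) ^ 2 ≤ 2 * E := by
      nlinarith [sq_nonneg (b + a), sq_nonneg a1, sq_nonneg b1, sq_nonneg A]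
    have := mul_le_mul hab this (sq_nonneg _) (by positivity)
    linarith
  have t3 : |2 * ((a + b) * (A * (b1 - a1)))| ≤ 8 * S * E := by
    rw [abs_mul, abs_mul, abs_of_pos (by norm_num : (0:ℝ) < 2)]
    have : |A * (b1 - a1)| ≤ 2 * E := by
      rw [abs_le]
      constructor <;> nlinarith [sq_nonneg (A + b1), sq_nonneg (A - b1), sq_nonneg (A + a1),
        sq_nonneg (A - a1), sq_nonneg a, sq_nonneg b]
    have := mul_le_mul hab this (abs_nonneg _) (by positivity)
    linarith
  have t4 : |4 * ((a1 + b1) * ((b - a) * A))| ≤ 8 * S * E := by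
    have e : 4 * ((a1 + b1) * ((b - a) * A)) = 4 * (A * ((a1 + b1) * (b - a))) := by ring
    rw [e, abs_mul, abs_mul, abs_of_pos (by norm_num : (0:ℝ) < 4)]
    have : |(a1 + b1) * (b - a)| ≤ 2 * E := by
      rw [abs_le]
      constructor <;> nlinarith [sq_nonneg (a1 + b), sq_nonneg (a1 - b), sq_nonneg (a1 + a),
        sq_nonneg (a1 - a), sq_nonneg (b1 + b), sq_nonneg (b1 - b), sq_nonneg (b1 + a),
        sq_nonneg (b1 - a), sq_nonneg A]
    have := mul_le_mul hA this (abs_nonneg _) hS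
    linarith
  have t5 : |3 * ((a ^ 2 + b ^ 2) * A ^ 2)| ≤ 3 * S ^ 2 * E := by
    rw [abs_of_nonneg (by positivity)]
    have : a ^ 2 + b ^ 2 ≤ E := by nlinarith [sq_nonneg a1, sq_nonneg b1, sq_nonneg A]
    have := mul_le_mul this hA2 (sq_nonneg _) hE0
    linarith
  have t6 : |3 * A ^ 4 / h ^ 2| ≤ 3 * S ^ 2 * E := by
    rw [abs_of_nonneg (by positivity)]
    have : A ^ 2 ≤ E := by nlinarith [sq_nonneg a1, sq_nonneg b1, sq_nonneg a, sq_nonneg b]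
    have := mul_le_mul this hA3 (by positivity) hE0
    have e : 3 * A ^ 4 / h ^ 2 = 3 * (A ^ 2 * (A ^ 2 / h ^ 2)) := by ring
    linarith
  have hfin : 6 * E + 16 * S * E + 8 * S * E + 8 * S * E + 3 * S ^ 2 * E + 3 * S ^ 2 * E ≤
      40 * (1 + S + S ^ 2) * E := by
    nlinarith [mul_nonneg hS hE0, mul_nonneg (sq_nonneg S) hE0]
  refine le_trans ?_ hfin
  rw [abs_le] at t1 t2 t3 t4 t5 t6 ⊢
  constructor <;> linarith [t1.1, t1.2, t2.1, t2.2, t3.1, t3.2, t4.1, t4.2, t5.1, t5.2, t6.1, t6.2]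

theorem abs_source_le {a b A S h P : ℝ} (hS : 0 ≤ S) (ha : |a| ≤ S) (hb : |b| ≤ S)
    (h0 : 0 < h) (hA : |A / h| ≤ S) (hp : |b - a| ≤ P) (hB : |a + b - 2 * (A / h)| ≤ 3 * P) :
    |12 * a * b * A * (b - a) - 12 * A ^ 3 * (b - a) / h ^ 2| ≤ 42 * h * S ^ 2 * P ^ 2 := by
  have hP : 0 ≤ P := (abs_nonneg _).trans hp
  obtain ⟨m, rfl⟩ : ∃ m, A = h * m := ⟨A / h, by field_simp⟩
  rw [mul_div_cancel_left₀ _ h0.ne'] at hA hB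
  have e : 12 * a * b * (h * m) * (b - a) - 12 * (h * m) ^ 3 * (b - a) / h ^ 2 =
      3 * h * ((a + b - 2 * m) * (a + b + 2 * m) * (m * (b - a))) -
      3 * h * ((b - a) * (b - a) * ((b - a) * m)) := by
    field_simp; ring
  have t1 : |(a + b - 2 * m) * (a + b + 2 * m) * (m * (b - a))| ≤
      3 * P * (4 * S) * (S * P) := by
    rw [abs_mul, abs_mul, abs_mul m]
    have : |a + b + 2 * m| ≤ 4 * S := by
      rw [abs_le] at *; constructor <;> linarith [ha.1, ha.2, hb.1, hb.2, hA.1, hA.2]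
    gcongr
  have t2 : |(b - a) * (b - a) * ((b - a) * m)| ≤ P * P * (2 * S * S) := by
    rw [abs_mul, abs_mul, abs_mul _ m]
    have : |b - a| ≤ 2 * S := by
      rw [abs_le] at *; constructor <;> linarith [ha.1, ha.2, hb.1, hb.2]
    gcongr
  rw [e]
  refine (abs_sub _ _).trans ?_
  rw [abs_mul (3 * h), abs_mul (3 * h), abs_of_pos (by positivity : 0 < 3 * h)]
  nlinarith [mul_le_mul_of_nonneg_left t1 h0.le, mul_le_mul_of_nonneg_left t2 h0.le]

theorem h1_difference_estimate {q q1 q2 q3 : ℝ → ℝ → ℝ} (hq : KdVReg q q1 q2 q3) {s t M h : ℝ}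
    (hst : s ≤ t) (hM : ∀ τ ∈ Icc s t, Integrable (fun x => q τ x ^ 2) ∧
      Integrable (fun x => q1 τ x ^ 2) ∧ (∫ x, q τ x ^ 2) + ∫ x, q1 τ x ^ 2 ≤ M)
    (h0 : 0 < h) (h1 : h ≤ 1) :
    |(∫ x, ((q t (x + h) - q t x) ^ 2 - (q t x + q t (x + h)) * (h * shiftAvg (q t) h x) ^ 2)) -
      ∫ x, ((q s (x + h) - q s x) ^ 2 - (q s x + q s (x + h)) * (h * shiftAvg (q s) h x) ^ 2)| ≤
    42 * h ^ 3 * M ^ 2 * (t - s) := by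
  have cont : ∀ {f : ℝ → ℝ → ℝ} {t}, Continuous (uncurry f) → Continuous (f t) := fun hf =>
      hf.uncurry_left _
  set S := √M with hS
  have hS0 : 0 ≤ S := Real.sqrt_nonneg _
  have hM0 : 0 ≤ M := (add_nonneg (integral_nonneg fun x => sq_nonneg _)
    (integral_nonneg fun x => sq_nonneg _)).trans (hM s ⟨le_rfl, hst⟩).2.2
  have hSM : S ^ 2 = M := Real.sq_sqrt hM0
  have hb : ∀ τ ∈ Icc s t, ∀ x, |q τ x| ≤ S := fun τ hτ x => by
    obtain ⟨i0, i1, e⟩ := hM τ hτ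
    exact abs_le_sqrt ((sq_le_integral_sq_add (hq.d0 τ) (cont hq.c1) i0 i1 x).trans e)
  let A : ℝ → ℝ → ℝ := fun τ x => h * shiftAvg (q τ) h x
  have cA : Continuous (uncurry A) := continuous_const.mul ((continuous_shiftAvg hq.c0).comp
    (f := fun p : ℝ × ℝ => (p.1, h, p.2)) (by fun_prop))
  have sh : ∀ {f : ℝ → ℝ → ℝ}, Continuous (uncurry f) → Continuous (uncurry fun τ x => f τ (x + h)) :=
    fun hf => hf.comp (f := fun p : ℝ × ℝ => (p.1, p.2 + h)) (by fun_prop)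
  have c0 := hq.c0
  have c1 := hq.c1
  have c2 := hq.c2
  have c3 := hq.c3
  have e0 := sh c0
  have e1 := sh c1
  have e2 := sh c2
  have e3 := sh c3
  have b0 : ∀ τ x, HasDerivAt (fun x => q τ (x + h)) (q1 τ (x + h)) x := fun τ x =>
    (hq.d0 τ (x + h)).comp_add_const x h
  have b1 : ∀ τ x, HasDerivAt (fun x => q1 τ (x + h)) (q2 τ (x + h)) x := fun τ x =>
    (hq.d1 τ (x + h)).comp_add_const x h
  have b2 : ∀ τ x, HasDerivAt (fun x => q2 τ (x + h)) (q3 τ (x + h)) x := fun τ x =>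
    (hq.d2 τ (x + h)).comp_add_const x h
  have dA : ∀ τ x, HasDerivAt (A τ) (q τ (x + h) - q τ x) x := fun τ x =>
    hasDerivAt_mul_shiftAvg (cont c0) h x
  have dAt : ∀ τ x, HasDerivAt (fun τ => A τ x)
      (-(q2 τ (x + h) - q2 τ x) - 3 * (q τ (x + h) ^ 2 - q τ x ^ 2)) τ := by
    intro τ x
    have cc : Continuous (uncurry fun t x => -(q3 t x + 6 * q t x * q1 t x)) := by
      unfold uncurry at *; fun_prop
    have := hasDerivAt_intervalIntegral_param x (x + h) τ c0 cc hq.dt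
    have e : (fun τ => A τ x) = fun τ => ∫ y in x..(x + h), q τ y := by
      funext τ; exact mul_shiftAvg_eq _ _ _
    rw [e]
    refine this.congr_deriv ?_
    rw [intervalIntegral.integral_eq_sub_of_hasDerivAt
      (f := fun y => -q2 τ y - 3 * q τ y ^ 2)
      (fun y _ => ((hq.d2 τ y).fun_neg.fun_sub (((hq.d0 τ y).fun_pow 2).const_mul 3)).congr_deriv
        (by ring)) ((cont cc).intervalIntegrable _ _)]
    ring
  have hne : h ≠ 0 := h0.ne'
  have hρ := fun τ x => (((hq.dt τ (x + h)).fun_sub (hq.dt τ x)).fun_pow 2).fun_sub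
    (((hq.dt τ x).fun_add (hq.dt τ (x + h))).fun_mul ((dAt τ x).fun_pow 2))
  have claim := conservation_law
    (ρ := fun τ x => (q τ (x + h) - q τ x) ^ 2 - (q τ x + q τ (x + h)) * A τ x ^ 2)
    (σ := fun τ x => 12 * q τ x * q τ (x + h) * A τ x * (q τ (x + h) - q τ x) -
      12 * A τ x ^ 3 * (q τ (x + h) - q τ x) / h ^ 2)
    (F := fun τ x => 3 * (q1 τ (x + h) - q1 τ x) ^ 2
      - 4 * ((q τ x + q τ (x + h)) * (q τ (x + h) - q τ x) ^ 2)
      + 2 * ((q τ x + q τ (x + h)) * (A τ x * (q1 τ (x + h) - q1 τ x)))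
      - 4 * ((q1 τ x + q1 τ (x + h)) * ((q τ (x + h) - q τ x) * A τ x))
      + 3 * ((q τ x ^ 2 + q τ (x + h) ^ 2) * A τ x ^ 2) + 3 * A τ x ^ 4 / h ^ 2)
    (F' := fun τ x => 3 * (2 * (q1 τ (x + h) - q1 τ x) * (q2 τ (x + h) - q2 τ x))
      - 4 * ((q1 τ x + q1 τ (x + h)) * (q τ (x + h) - q τ x) ^ 2 +
        (q τ x + q τ (x + h)) * (2 * (q τ (x + h) - q τ x) * (q1 τ (x + h) - q1 τ x)))
      + 2 * ((q1 τ x + q1 τ (x + h)) * (A τ x * (q1 τ (x + h) - q1 τ x)) +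
        (q τ x + q τ (x + h)) * ((q τ (x + h) - q τ x) * (q1 τ (x + h) - q1 τ x)
          + A τ x * (q2 τ (x + h) - q2 τ x)))
      - 4 * ((q2 τ x + q2 τ (x + h)) * ((q τ (x + h) - q τ x) * A τ x) +
        (q1 τ x + q1 τ (x + h)) * ((q1 τ (x + h) - q1 τ x) * A τ x +
          (q τ (x + h) - q τ x) * (q τ (x + h) - q τ x)))
      + 3 * ((2 * q τ x * q1 τ x + 2 * q τ (x + h) * q1 τ (x + h)) * A τ x ^ 2 +
        (q τ x ^ 2 + q τ (x + h) ^ 2) * (2 * A τ x * (q τ (x + h) - q τ x)))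
      + 3 * (4 * A τ x ^ 3 * (q τ (x + h) - q τ x)) / h ^ 2)
    (G := fun τ x => -2 * ((q τ (x + h) - q τ x) * (q1 τ (x + h) - q1 τ x)) +
      (q1 τ x + q1 τ (x + h)) * A τ x ^ 2)
    (G' := fun τ x => -2 * ((q1 τ (x + h) - q1 τ x) * (q1 τ (x + h) - q1 τ x) +
        (q τ (x + h) - q τ x) * (q2 τ (x + h) - q2 τ x)) +
      ((q2 τ x + q2 τ (x + h)) * A τ x ^ 2 +
        (q1 τ x + q1 τ (x + h)) * (2 * A τ x * (q τ (x + h) - q τ x))))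
    (G'' := fun τ x => -6 * ((q1 τ (x + h) - q1 τ x) * (q2 τ (x + h) - q2 τ x))
      - 2 * ((q τ (x + h) - q τ x) * (q3 τ (x + h) - q3 τ x)) +
      ((q3 τ x + q3 τ (x + h)) * A τ x ^ 2 +
       4 * ((q2 τ x + q2 τ (x + h)) * (A τ x * (q τ (x + h) - q τ x))) +
       2 * ((q1 τ x + q1 τ (x + h)) * (q τ (x + h) - q τ x) ^ 2) +
       2 * ((q1 τ x + q1 τ (x + h)) * (A τ x * (q1 τ (x + h) - q1 τ x)))))
    (s := s) (t := t) (C := 40 * (1 + S + S ^ 2) * (3 * M)) (a := 42 * h ^ 3 * M ^ 2) hst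
    (fun τ x => (hρ τ x).congr_deriv (by ring))
    (fun τ x => by
      have B := (hq.d0 τ x).fun_add (b0 τ x)
      have B1 := (hq.d1 τ x).fun_add (b1 τ x)
      have p := (b0 τ x).fun_sub (hq.d0 τ x)
      have p1 := (b1 τ x).fun_sub (hq.d1 τ x)
      have a := dA τ x
      refine (((((((p1.fun_pow 2).const_mul 3).fun_sub ((B.fun_mul (p.fun_pow 2)).const_mul 4)).fun_add
        ((B.fun_mul (a.fun_mul p1)).const_mul 2)).fun_sub
        ((B1.fun_mul (p.fun_mul a)).const_mul 4)).fun_add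
        (((((hq.d0 τ x).fun_pow 2).fun_add ((b0 τ x).fun_pow 2)).fun_mul (a.fun_pow 2)).const_mul 3)).fun_add
        (((a.fun_pow 4).const_mul 3).div_const (h ^ 2))).congr_deriv ?_
      ring)
    (fun τ x => by
      have B1 := (hq.d1 τ x).fun_add (b1 τ x)
      have p := (b0 τ x).fun_sub (hq.d0 τ x)
      have p1 := (b1 τ x).fun_sub (hq.d1 τ x)
      have a := dA τ x
      refine (((p.fun_mul p1).const_mul (-2)).fun_add (B1.fun_mul (a.fun_pow 2))).congr_deriv ?_
      ring)
    (fun τ x => by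
      have B1 := (hq.d1 τ x).fun_add (b1 τ x)
      have B2 := (hq.d2 τ x).fun_add (b2 τ x)
      have p := (b0 τ x).fun_sub (hq.d0 τ x)
      have p1 := (b1 τ x).fun_sub (hq.d1 τ x)
      have p2 := (b2 τ x).fun_sub (hq.d2 τ x)
      have a := dA τ x
      refine ((((p1.fun_mul p1).fun_add (p.fun_mul p2)).const_mul (-2)).fun_add
        ((B2.fun_mul (a.fun_pow 2)).fun_add
        (B1.fun_mul ((a.const_mul 2).fun_mul p)))).congr_deriv ?_
      ring)
    (by unfold uncurry at *; fun_prop) (by unfold uncurry at *; fun_prop)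
    (by unfold uncurry at *; fun_prop) (by unfold uncurry at *; fun_prop)
  have hA1 : ∀ τ ∈ Icc s t, ∀ x, |A τ x / h| ≤ S := fun τ hτ x => by
    rw [show A τ x / h = shiftAvg (q τ) h x from mul_div_cancel_left₀ _ hne]
    exact abs_shiftAvg_le (hb τ hτ) h x
  have hA2 : ∀ τ ∈ Icc s t, ∀ x, |A τ x| ≤ h * S := fun τ hτ x => by
    have := hA1 τ hτ x
    rw [abs_div, abs_of_pos h0, div_le_iff₀ h0] at this
    linarith
  have hA3 : ∀ τ ∈ Icc s t, ∀ x, |A τ x| ≤ S := fun τ hτ x =>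
    (hA2 τ hτ x).trans (mul_le_of_le_one_left hS0 h1)
  have iA : ∀ τ ∈ Icc s t, Integrable (fun x => A τ x ^ 2) ∧ ∫ x, A τ x ^ 2 ≤ ∫ x, q τ x ^ 2 := by
    intro τ hτ
    have := integrable_shiftAvg_sq (cont (t := τ) c0) (hM τ hτ).1 h
    have e : (fun x => A τ x ^ 2) = fun x => h ^ 2 * shiftAvg (q τ) h x ^ 2 := by
      funext x; simp only [A]; ring
    rw [e, integral_const_mul]
    refine ⟨this.1.const_mul _, ?_⟩
    calc h ^ 2 * ∫ x, shiftAvg (q τ) h x ^ 2 ≤ 1 * ∫ x, shiftAvg (q τ) h x ^ 2 :=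
          mul_le_mul_of_nonneg_right (by nlinarith) (integral_nonneg fun x => sq_nonneg _)
      _ ≤ _ := by rw [one_mul]; exact this.2
  have ish : ∀ {f : ℝ → ℝ}, Integrable f → Integrable fun x => f (x + h) := fun hf =>
    hf.comp_add_right h
  have dom : ∀ τ ∈ Icc s t, ∀ K : ℝ, 0 ≤ K → ∀ f : ℝ → ℝ, Continuous f →
      (∀ x, |f x| ≤ K * (q τ x ^ 2 + q τ (x + h) ^ 2 + q1 τ x ^ 2 + q1 τ (x + h) ^ 2 + A τ x ^ 2)) →
      Integrable f ∧ ∫ x, |f x| ≤ K * (3 * M) := by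
    intro τ hτ K hK f cf hf
    obtain ⟨i0, i1, e⟩ := hM τ hτ
    have iq := (((i0.add (ish i0)).add i1).add (ish i1)).add (iA τ hτ).1
    have i := (iq.const_mul K).mono' cf.aestronglyMeasurable (Eventually.of_forall hf)
    refine ⟨i, (integral_mono i.abs (iq.const_mul K) hf).trans ?_⟩
    rw [integral_const_mul, integral_add' ((((i0.add (ish i0)).add i1).add (ish i1))) (iA τ hτ).1,
      integral_add' ((i0.add (ish i0)).add i1) (ish i1), integral_add' (i0.add (ish i0)) i1,
      integral_add' i0 (ish i0), integral_add_right_eq_self (fun x => q τ x ^ 2) h,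
      integral_add_right_eq_self (fun x => q1 τ x ^ 2) h]
    have := (iA τ hτ).2
    have : 0 ≤ ∫ x, q1 τ x ^ 2 := integral_nonneg fun x => sq_nonneg _
    gcongr
    linarith
  have hK0 : 0 ≤ 40 * (1 + S + S ^ 2) := by positivity
  have iρ : ∀ τ ∈ Icc s t, Integrable fun x =>
      (q τ (x + h) - q τ x) ^ 2 - (q τ x + q τ (x + h)) * A τ x ^ 2 := by
    intro τ hτ
    refine (dom τ hτ (2 + 2 * S) (by positivity) _ (cont (t := τ)
      (f := fun τ x => (q τ (x + h) - q τ x) ^ 2 - (q τ x + q τ (x + h)) * A τ x ^ 2)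
      (by unfold uncurry at *; fun_prop)) fun x => ?_).1
    have ha := abs_le.1 (hb τ hτ x)
    have hb := abs_le.1 (hb τ hτ (x + h))
    have hz := sq_nonneg (A τ x)
    rw [abs_le]
    constructor <;> nlinarith [mul_nonneg (sub_nonneg.2 ha.1) hz, mul_nonneg (sub_nonneg.2 ha.2) hz,
      mul_nonneg (sub_nonneg.2 hb.1) hz, mul_nonneg (sub_nonneg.2 hb.2) hz,
      sq_nonneg (q τ (x + h) + q τ x), mul_nonneg hS0 (sq_nonneg (q τ x)),
      mul_nonneg hS0 (sq_nonneg (q τ (x + h))), mul_nonneg hS0 (sq_nonneg (q1 τ x)),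
      mul_nonneg hS0 (sq_nonneg (q1 τ (x + h))), sq_nonneg (q1 τ x), sq_nonneg (q1 τ (x + h)),
      sq_nonneg (q τ x), sq_nonneg (q τ (x + h))]
  refine claim ?_ ?_ ?_ (iρ s ⟨le_rfl, hst⟩) (iρ t ⟨hst, le_rfl⟩)
  · intro τ hτ
    obtain ⟨i0, i1, e⟩ := hM τ hτ
    have cP := (cont (t := τ) c1).abs
    obtain ⟨j0, j1⟩ := integrable_shiftAvg_sq cP (by simpa only [sq_abs] using i1) h
    have hdom : ∀ x, |12 * q τ x * q τ (x + h) * A τ x * (q τ (x + h) - q τ x) -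
        12 * A τ x ^ 3 * (q τ (x + h) - q τ x) / h ^ 2| ≤
        42 * h ^ 3 * M * shiftAvg (fun y => |q1 τ y|) h x ^ 2 := fun x => by
      have hp := abs_sub_le_mul_shiftAvg (hq.d0 τ) (cont c1) h0.le (right_mem_Icc.2 zero_le_one) x
      rw [mul_one] at hp
      have hB := abs_sub_avg_le (hq.d0 τ) (cont c1) h0.le x
      have := abs_source_le hS0 (hb τ hτ x) (hb τ hτ (x + h)) h0 (hA1 τ hτ x) hp
        (by rw [show A τ x / h = shiftAvg (q τ) h x from mul_div_cancel_left₀ _ hne]; exact hB)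
      refine this.trans (le_of_eq ?_)
      rw [hSM]; ring
    have cσ : Continuous fun x => 12 * q τ x * q τ (x + h) * A τ x * (q τ (x + h) - q τ x) -
        12 * A τ x ^ 3 * (q τ (x + h) - q τ x) / h ^ 2 :=
      cont (t := τ) (f := fun τ x => 12 * q τ x * q τ (x + h) * A τ x * (q τ (x + h) - q τ x) -
        12 * A τ x ^ 3 * (q τ (x + h) - q τ x) / h ^ 2) (by unfold uncurry at *; fun_prop)
    have iσ := (j0.const_mul (42 * h ^ 3 * M)).mono' cσ.aestronglyMeasurable
      (Eventually.of_forall hdom)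
    refine ⟨iσ, (integral_mono iσ.abs (j0.const_mul _) hdom).trans ?_⟩
    rw [integral_const_mul, pow_two M, ← mul_assoc]
    simp only [sq_abs] at j1
    have : 0 ≤ ∫ x, q τ x ^ 2 := integral_nonneg fun x => sq_nonneg _
    gcongr
    linarith
  · intro τ hτ
    exact dom τ hτ _ hK0 _ (cont (t := τ)
      (f := fun τ x => 3 * (q1 τ (x + h) - q1 τ x) ^ 2
      - 4 * ((q τ x + q τ (x + h)) * (q τ (x + h) - q τ x) ^ 2)
      + 2 * ((q τ x + q τ (x + h)) * (A τ x * (q1 τ (x + h) - q1 τ x)))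
      - 4 * ((q1 τ x + q1 τ (x + h)) * ((q τ (x + h) - q τ x) * A τ x))
      + 3 * ((q τ x ^ 2 + q τ (x + h) ^ 2) * A τ x ^ 2) + 3 * A τ x ^ 4 / h ^ 2)
      (by unfold uncurry at *; fun_prop))
      fun x => abs_flux_le hS0 (hb τ hτ x) (hb τ hτ _) (hA3 τ hτ x) h0 (hA2 τ hτ x)
  · intro τ hτ
    refine dom τ hτ _ hK0 _ (cont (t := τ)
      (f := fun τ x => -2 * ((q τ (x + h) - q τ x) * (q1 τ (x + h) - q1 τ x)) +
      (q1 τ x + q1 τ (x + h)) * A τ x ^ 2)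
      (by unfold uncurry at *; fun_prop)) fun x => ?_
    set E := q τ x ^ 2 + q τ (x + h) ^ 2 + q1 τ x ^ 2 + q1 τ (x + h) ^ 2 + A τ x ^ 2 with hE
    have hE0 : 0 ≤ E := by positivity
    have t1 : |-2 * ((q τ (x + h) - q τ x) * (q1 τ (x + h) - q1 τ x))| ≤ 2 * E := by
      rw [abs_le]
      constructor <;> nlinarith [sq_nonneg (q τ (x + h) + q τ x), sq_nonneg (A τ x),
        sq_nonneg (q1 τ (x + h) + q1 τ x),
        sq_nonneg (q τ (x + h) - q τ x + (q1 τ (x + h) - q1 τ x)),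
        sq_nonneg (q τ (x + h) - q τ x - (q1 τ (x + h) - q1 τ x))]
    have t2 : |(q1 τ x + q1 τ (x + h)) * A τ x ^ 2| ≤ S * (2 * E) := by
      have e : (q1 τ x + q1 τ (x + h)) * A τ x ^ 2 =
        A τ x * ((q1 τ x + q1 τ (x + h)) * A τ x) := by ring
      rw [e, abs_mul]
      refine mul_le_mul (hA3 τ hτ x) ?_ (abs_nonneg _) hS0
      rw [abs_le]
      constructor <;> nlinarith [sq_nonneg (q1 τ x + A τ x), sq_nonneg (q1 τ x - A τ x),
        sq_nonneg (q1 τ (x + h) + A τ x), sq_nonneg (q1 τ (x + h) - A τ x),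
        sq_nonneg (q τ x), sq_nonneg (q τ (x + h))]
    refine (abs_add_le _ _).trans ?_
    nlinarith [mul_nonneg hS0 hE0, mul_nonneg (sq_nonneg S) hE0]

theorem deriv_sq_le_of_difference {f f' g g' : ℝ → ℝ} {E : ℝ}
    (hf : ∀ x, HasDerivAt f (f' x) x) (hg : ∀ x, HasDerivAt g (g' x) x)
    (cf' : Continuous f') (cg' : Continuous g')
    (if0 : Integrable fun x => f x ^ 2) (if1 : Integrable fun x => f' x ^ 2)
    (ig0 : Integrable fun x => g x ^ 2) (ig1 : Integrable fun x => g' x ^ 2)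
    (hE : ∀ h : ℝ, 0 < h → h ≤ 1 →
      |(∫ x, ((f (x + h) - f x) ^ 2 - (f x + f (x + h)) * (h * shiftAvg f h x) ^ 2)) -
      ∫ x, ((g (x + h) - g x) ^ 2 - (g x + g (x + h)) * (h * shiftAvg g h x) ^ 2)| ≤ E * h ^ 3) :
    ∫ x, f' x ^ 2 ≤ (∫ x, g' x ^ 2) +
      2 * √((∫ x, f x ^ 2) + ∫ x, f' x ^ 2) * (∫ x, f x ^ 2) +
      2 * √((∫ x, g x ^ 2) + ∫ x, g' x ^ 2) * (∫ x, g x ^ 2) := by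
  have aux : ∀ (f f' : ℝ → ℝ), (∀ x, HasDerivAt f (f' x) x) → Continuous f' →
      Integrable (fun x => f x ^ 2) → Integrable (fun x => f' x ^ 2) → ∀ h : ℝ,
      |(∫ x, ((f (x + h) - f x) ^ 2 - (f x + f (x + h)) * (h * shiftAvg f h x) ^ 2)) -
        h ^ 2 * ∫ x, shiftAvg f' h x ^ 2| ≤
      h ^ 2 * (2 * √((∫ x, f x ^ 2) + ∫ x, f' x ^ 2) * (∫ x, f x ^ 2)) := by
    intro f f' hf cf' i0 i1 h
    have cf : Continuous f := continuous_iff_continuousAt.2 fun x => (hf x).continuousAt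
    have hb : ∀ x, |f x| ≤ √((∫ x, f x ^ 2) + ∫ x, f' x ^ 2) := fun x =>
      abs_le_sqrt (sq_le_integral_sq_add hf cf' i0 i1 x)
    set S := √((∫ x, f x ^ 2) + ∫ x, f' x ^ 2)
    have hS0 : 0 ≤ S := Real.sqrt_nonneg _
    obtain ⟨j0, j1⟩ := integrable_shiftAvg_sq cf i0 h
    obtain ⟨k0, k1⟩ := integrable_shiftAvg_sq cf' i1 h
    have cA : Continuous fun x => shiftAvg f h x :=
      (continuous_shiftAvg (g := fun _ => f) (cf.comp continuous_snd)).comp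
        (f := fun x : ℝ => ((0:ℝ), h, x)) (by fun_prop)
    have hp : ∀ x, f (x + h) - f x = h * shiftAvg f' h x := fun x => by
      rw [mul_shiftAvg_eq]
      exact (intervalIntegral.integral_eq_sub_of_hasDerivAt (fun y _ => hf y)
        (cf'.intervalIntegrable _ _)).symm
    have hdom : ∀ x, |(f x + f (x + h)) * shiftAvg f h x ^ 2| ≤ 2 * S * shiftAvg f h x ^ 2 := by
      intro x
      rw [abs_mul, abs_of_nonneg (sq_nonneg (shiftAvg f h x))]
      exact mul_le_mul_of_nonneg_right ((abs_add_le _ _).trans (by linarith [hb x, hb (x + h)]))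
        (sq_nonneg _)
    have iB : Integrable fun x => (f x + f (x + h)) * shiftAvg f h x ^ 2 :=
      (j0.const_mul (2 * S)).mono' (by fun_prop) (Eventually.of_forall hdom)
    have e : ∫ x, ((f (x + h) - f x) ^ 2 - (f x + f (x + h)) * (h * shiftAvg f h x) ^ 2) =
        h ^ 2 * (∫ x, shiftAvg f' h x ^ 2) -
        h ^ 2 * ∫ x, (f x + f (x + h)) * shiftAvg f h x ^ 2 := by
      rw [← integral_const_mul, ← integral_const_mul,
        ← integral_sub (k0.const_mul _) (iB.const_mul _)]
      refine integral_congr_ae (Eventually.of_forall fun x => ?_)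
      simp only [hp x]; ring
    rw [e, sub_sub_cancel_left, abs_neg, abs_mul, abs_of_nonneg (sq_nonneg h)]
    refine mul_le_mul_of_nonneg_left ?_ (sq_nonneg h)
    calc |∫ x, (f x + f (x + h)) * shiftAvg f h x ^ 2|
        ≤ ∫ x, |(f x + f (x + h)) * shiftAvg f h x ^ 2| := abs_integral_le_integral_abs
      _ ≤ ∫ x, 2 * S * shiftAvg f h x ^ 2 := integral_mono iB.abs (j0.const_mul _) hdom
      _ ≤ _ := by
        rw [integral_const_mul]
        exact mul_le_mul_of_nonneg_left j1 (by positivity)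
  refine (integrable_of_symm_intervalIntegral_le (cf'.pow 2) (fun x => sq_nonneg _)
    fun R hR => ?_).2
  set K := (∫ x, g' x ^ 2) +
      2 * √((∫ x, f x ^ 2) + ∫ x, f' x ^ 2) * (∫ x, f x ^ 2) +
      2 * √((∫ x, g x ^ 2) + ∫ x, g' x ^ 2) * (∫ x, g x ^ 2) with hK
  have hle : ∀ h : ℝ, 0 < h → h ≤ 1 → ∫ x in (-R)..R, shiftAvg f' h x ^ 2 ≤ K + E * h := by
    intro h h0 h1
    have a1 := (abs_le.1 (aux f f' hf cf' if0 if1 h)).1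
    have a2 := (abs_le.1 (aux g g' hg cg' ig0 ig1 h)).2
    have a3 := (abs_le.1 (hE h h0 h1)).2
    obtain ⟨k0, -⟩ := integrable_shiftAvg_sq cf' if1 h
    obtain ⟨-, k1⟩ := integrable_shiftAvg_sq cg' ig1 h
    refine (intervalIntegral_le_integral_of_nonneg k0 (fun x => sq_nonneg _)
      (by linarith)).trans ?_
    have h2 : 0 < h ^ 2 := by positivity
    refine le_of_mul_le_mul_left ?_ h2
    have := mul_le_mul_of_nonneg_left k1 h2.le
    rw [hK]
    linarith
  have cS : Continuous fun h : ℝ => ∫ x in (-R)..R, shiftAvg f' h x ^ 2 := by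
    refine intervalIntegral.continuous_parametric_intervalIntegral_of_continuous'
      (f := fun h x => shiftAvg f' h x ^ 2) ?_ _ _
    exact ((continuous_shiftAvg (g := fun _ => f') (cf'.comp continuous_snd)).comp
      (f := fun p : ℝ × ℝ => ((0:ℝ), p.1, p.2)) (by fun_prop)).pow 2
  have l1 : Tendsto (fun h : ℝ => ∫ x in (-R)..R, shiftAvg f' h x ^ 2) (𝓝[>] 0)
      (𝓝 (∫ x in (-R)..R, f' x ^ 2)) := by
    have := (cS.tendsto 0).mono_left (nhdsWithin_le_nhds (s := Ioi 0))
    simpa [shiftAvg] using this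
  have l2 : Tendsto (fun h : ℝ => K + E * h) (𝓝[>] 0) (𝓝 K) := by
    have : Continuous fun h : ℝ => K + E * h := by fun_prop
    have := (this.tendsto 0).mono_left (nhdsWithin_le_nhds (s := Ioi 0))
    simpa using this
  refine le_of_tendsto_of_tendsto l1 l2 ?_
  filter_upwards [Ioc_mem_nhdsGT (zero_lt_one' ℝ)] with h hh using hle h hh.1 hh.2

theorem h1_growth {q q1 q2 q3 : ℝ → ℝ → ℝ} (hq : KdVReg q q1 q2 q3) {s t M : ℝ}
    (hM : ∀ τ ∈ uIcc s t, Integrable (fun x => q τ x ^ 2) ∧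
      Integrable (fun x => q1 τ x ^ 2) ∧ (∫ x, q τ x ^ 2) + ∫ x, q1 τ x ^ 2 ≤ M) :
    (∫ x, q t x ^ 2) + ∫ x, q1 t x ^ 2 ≤ 6 * ((∫ x, q s x ^ 2) + ∫ x, q1 s x ^ 2) +
      8 * ((∫ x, q s x ^ 2) + ∫ x, q1 s x ^ 2) ^ 2 := by
  have hm : ∫ x, q t x ^ 2 = ∫ x, q s x ^ 2 := by
    rcases le_total s t with h | h
    · rw [uIcc_of_le h] at hM; exact l2_conservation hq h hM
    · rw [uIcc_of_ge h] at hM; exact (l2_conservation hq h hM).symm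
  have hE : ∀ h : ℝ, 0 < h → h ≤ 1 →
      |(∫ x, ((q t (x + h) - q t x) ^ 2 - (q t x + q t (x + h)) * (h * shiftAvg (q t) h x) ^ 2)) -
      ∫ x, ((q s (x + h) - q s x) ^ 2 - (q s x + q s (x + h)) * (h * shiftAvg (q s) h x) ^ 2)| ≤
      (42 * M ^ 2 * |t - s|) * h ^ 3 := by
    intro h h0 h1
    rcases le_total s t with hst | hst
    · rw [uIcc_of_le hst] at hM
      rw [abs_of_nonneg (sub_nonneg.2 hst)]
      exact (h1_difference_estimate hq hst hM h0 h1).trans (le_of_eq (by ring))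
    · rw [uIcc_of_ge hst] at hM
      rw [abs_sub_comm, abs_sub_comm t s, abs_of_nonneg (sub_nonneg.2 hst)]
      exact (h1_difference_estimate hq hst hM h0 h1).trans (le_of_eq (by ring))
  obtain ⟨t0, t1, -⟩ := hM t right_mem_uIcc
  obtain ⟨s0, s1, -⟩ := hM s left_mem_uIcc
  have key := deriv_sq_le_of_difference (hq.d0 t) (hq.d0 s) (hq.c1.uncurry_left t)
    (hq.c1.uncurry_left s) t0 t1 s0 s1 hE
  have p0 : 0 ≤ ∫ x, q s x ^ 2 := integral_nonneg fun x => sq_nonneg _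
  have p1 : 0 ≤ ∫ x, q1 s x ^ 2 := integral_nonneg fun x => sq_nonneg _
  have p2 : 0 ≤ ∫ x, q1 t x ^ 2 := integral_nonneg fun x => sq_nonneg _
  rw [hm] at key ⊢
  set m := ∫ x, q s x ^ 2
  set D := ∫ x, q1 s x ^ 2
  set D' := ∫ x, q1 t x ^ 2
  have e1 := Real.sq_sqrt (add_nonneg p0 p2)
  have e2 := Real.sq_sqrt (add_nonneg p0 p1)
  have r1 := Real.sqrt_nonneg (m + D')
  have r2 := Real.sqrt_nonneg (m + D)
  set a := √(m + D')
  set b := √(m + D)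
  have i1 : 2 * a * m ≤ (m + D') / 2 + 2 * m ^ 2 := by nlinarith [sq_nonneg (a - 2 * m)]
  have i2 : 2 * b * m ≤ (1 + (m + D)) * m := by nlinarith [sq_nonneg (b - 1)]
  nlinarith [mul_nonneg p0 p1, sq_nonneg D]

/-- A lower semicontinuous function which cannot grow uncontrollably on intervals where it is
bounded is locally bounded. -/
theorem bounded_of_growth {N Φ : ℝ → ℝ} (hΦ : MonotoneOn Φ (Ici 0)) (h0 : ∀ t, 0 ≤ N t)
    (hc : ∀ M, IsClosed {t | N t ≤ M})
    (hg : ∀ s t M, (∀ τ ∈ uIcc s t, N τ ≤ M) → N t ≤ Φ (N s)) (T : ℝ) :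
    ∃ M, ∀ t, |t| ≤ T → N t ≤ M := by
  have compact_bdd : ∀ (N : ℝ → ℝ) (K : Set ℝ), IsCompact K →
      (∀ t ∈ K, ∃ M, ∀ᶠ τ in 𝓝 t, N τ ≤ M) → ∃ M, ∀ t ∈ K, N t ≤ M := by
    intro N K hK hl
    refine hK.induction_on (p := fun s => ∃ M, ∀ t ∈ s, N t ≤ M) ⟨0, by simp⟩
      (fun s t hst ⟨M, hM⟩ => ⟨M, fun x hx => hM x (hst hx)⟩)
      (fun s t ⟨M, hM⟩ ⟨M', hM'⟩ => ⟨max M M', fun x hx => hx.elim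
        (fun h => (hM x h).trans (le_max_left _ _)) fun h => (hM' x h).trans (le_max_right _ _)⟩)
      fun x hx => ?_
    obtain ⟨M, hM⟩ := hl x hx
    exact ⟨_, mem_nhdsWithin_of_mem_nhds hM, M, fun t ht => ht⟩
  have step : ∀ (N : ℝ → ℝ), (∀ t, 0 ≤ N t) → (∀ M, IsClosed {t | N t ≤ M}) →
      (∀ s t M, (∀ τ ∈ uIcc s t, N τ ≤ M) → N t ≤ Φ (N s)) → ∀ F : Set ℝ, IsClosed F →
      (∀ t, t ∉ F → ∃ M, ∀ᶠ τ in 𝓝 t, N τ ≤ M) → ∀ n t0 t : ℝ, t0 ≤ t → t0 ∈ F →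
      (∀ τ ∈ F ∩ Icc t0 t, N τ ≤ n) → N t ≤ max n (Φ n) := by
    intro N h0 hc hg F hF hl n t0 t htt ht0 hn
    have hcomp : IsCompact (F ∩ Icc t0 t) := isCompact_Icc.inter_left hF
    obtain ⟨a, ha, hmax⟩ := hcomp.exists_isGreatest ⟨t0, ht0, le_rfl, htt⟩
    rcases eq_or_lt_of_le ha.2.2 with hat | hat
    · rw [← hat]; exact (hn a ha).trans (le_max_left _ _)
    have hs : ∀ s ∈ Ioc a t, N s ≤ Φ (N t) := by
      intro s hs
      obtain ⟨M, hM⟩ := compact_bdd N (Icc s t) isCompact_Icc fun τ hτ => hl τ fun hτF => by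
        have := hmax ⟨hτF, ha.2.1.trans (hs.1.le.trans hτ.1), hτ.2⟩
        linarith [hs.1, hτ.1]
      exact hg t s M (by rw [uIcc_of_ge hs.2]; exact hM)
    have hs' : ∀ s ∈ Icc a t, N s ≤ Φ (N t) := by
      intro s hs1
      have h1 : Ioc a t ⊆ {s | N s ≤ Φ (N t)} := hs
      have h2 := (hc _).closure_subset_iff.2 h1
      rw [closure_Ioc hat.ne] at h2
      exact h2 hs1
    have h3 := hg a t _ (by rw [uIcc_of_le hat.le]; exact hs')
    exact h3.trans ((hΦ (h0 a) ((h0 a).trans (hn a ha)) (hn a ha)).trans (le_max_right _ _))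
  let F : Set ℝ := {t | ¬ ∃ M, ∀ᶠ τ in 𝓝 t, N τ ≤ M}
  have hFc : IsClosed F := by
    rw [← isOpen_compl_iff, isOpen_iff_mem_nhds]
    intro t ht
    have ht' : ∃ M, ∀ᶠ τ in 𝓝 t, N τ ≤ M := not_not.1 ht
    obtain ⟨M, hM⟩ := ht'
    filter_upwards [eventually_eventually_nhds.2 hM] with τ hτ
    exact not_not.2 ⟨M, hτ⟩
  have hFl : ∀ t, t ∉ F → ∃ M, ∀ᶠ τ in 𝓝 t, N τ ≤ M := fun t ht => not_not.1 ht
  have hF : F = ∅ := by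
    by_contra hne
    obtain ⟨x, hx⟩ := nonempty_iff_ne_empty.2 hne
    have : Nonempty F := ⟨⟨x, hx⟩⟩
    have : CompleteSpace F := hFc.completeSpace_coe
    obtain ⟨n, hn⟩ := nonempty_interior_of_iUnion_of_closed
      (f := fun n : ℕ => {t : F | N t ≤ n}) (fun n => (hc n).preimage continuous_subtype_val)
      (eq_univ_of_forall fun t => by
        obtain ⟨n, hn⟩ := exists_nat_ge (N t)
        exact mem_iUnion.2 ⟨n, hn⟩)
    obtain ⟨⟨t0, ht0⟩, hi⟩ := hn
    rw [mem_interior_iff_mem_nhds, Metric.mem_nhds_iff] at hi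
    obtain ⟨δ, hδ, hball⟩ := hi
    have hball' : ∀ t ∈ F, |t - t0| < δ → N t ≤ n := fun t ht htt =>
      hball (a := ⟨t, ht⟩) (by rw [Metric.mem_ball, Subtype.dist_eq, Real.dist_eq]; exact htt)
    refine ht0 ⟨max n (Φ n), ?_⟩
    filter_upwards [Metric.ball_mem_nhds t0 hδ] with t ht
    rw [Metric.mem_ball, Real.dist_eq] at ht
    rcases le_total t0 t with h | h
    · refine step N h0 hc hg F hFc hFl n t0 t h ht0 fun τ hτ => hball' τ hτ.1 ?_
      rw [abs_lt] at ht ⊢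
      constructor <;> linarith [hτ.2.1, hτ.2.2]
    · have := step (fun t => N (-t)) (fun t => h0 _) (fun M => (hc M).preimage continuous_neg)
        (fun s t M hM => hg (-s) (-t) M fun τ hτ => by
          have := hM (-τ) (by
            rw [mem_uIcc] at hτ ⊢
            rcases hτ with h | h
            · right; constructor <;> linarith [h.1, h.2]
            · left; constructor <;> linarith [h.1, h.2])
          simpa using this) (Neg.neg ⁻¹' F) (hFc.preimage continuous_neg)
        (fun t ht => by
          obtain ⟨M, hM⟩ := hFl (-t) ht
          exact ⟨M, (continuous_neg.tendsto t).eventually hM⟩) n (-t0) (-t) (by linarith)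
        (by simpa using ht0) (fun τ hτ => hball' (-τ) hτ.1 (by
          rw [abs_lt] at ht ⊢
          constructor <;> linarith [hτ.2.1, hτ.2.2]))
      simpa using this
  obtain ⟨M, hM⟩ := compact_bdd N (Icc (-T) T) isCompact_Icc fun t _ => hFl t (by simp [hF])
  exact ⟨M, fun t ht => hM t (abs_le.1 ht)⟩

theorem KdVReg.kdVClass {q q1 q2 q3 : ℝ → ℝ → ℝ} (hq : KdVReg q q1 q2 q3)
    (i0 : ∀ t, Integrable fun x => q t x ^ 2) (i1 : ∀ t, Integrable fun x => q1 t x ^ 2) :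
    KdVClass q q1 q2 q3 := by
  refine ⟨hq, fun T => ?_⟩
  let N : ℝ → ℝ := fun t => (∫ x, q t x ^ 2) + ∫ x, q1 t x ^ 2
  have p0 : ∀ t, 0 ≤ ∫ x, q t x ^ 2 := fun t => integral_nonneg fun x => sq_nonneg _
  have p1 : ∀ t, 0 ≤ ∫ x, q1 t x ^ 2 := fun t => integral_nonneg fun x => sq_nonneg _
  have cN : Continuous (uncurry fun t x => q t x ^ 2 + q1 t x ^ 2) :=
    (hq.c0.pow 2).add (hq.c1.pow 2)
  have hc : ∀ M, IsClosed {t | N t ≤ M} := by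
    intro M
    have : {t | N t ≤ M} =
        ⋂ R : Ici (0:ℝ), {t | ∫ x in (-(R:ℝ))..R, (q t x ^ 2 + q1 t x ^ 2) ≤ M} := by
      ext t
      rw [mem_iInter]
      have e : N t = ∫ x, (q t x ^ 2 + q1 t x ^ 2) := (integral_add (i0 t) (i1 t)).symm
      constructor
      · intro h R
        have hR : (0:ℝ) ≤ R := R.2
        refine (intervalIntegral_le_integral_of_nonneg ((i0 t).add (i1 t))
          (fun x => add_nonneg (sq_nonneg _) (sq_nonneg _)) (by linarith)).trans ?_
        exact e ▸ h
      · intro h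
        change N t ≤ M
        rw [e]
        exact (integrable_of_symm_intervalIntegral_le (cN.uncurry_left t)
          (fun x => add_nonneg (sq_nonneg _) (sq_nonneg _)) fun R hR => h ⟨R, hR⟩).2
    rw [this]
    exact isClosed_iInter fun R => isClosed_le
      (intervalIntegral.continuous_parametric_intervalIntegral_of_continuous' cN _ _)
      continuous_const
  obtain ⟨M, hM⟩ := bounded_of_growth (N := N) (Φ := fun y => 6 * y + 8 * y ^ 2)
    (fun a ha b hb hab => by
      have ha : 0 ≤ a := ha
      have : a ^ 2 ≤ b ^ 2 := pow_le_pow_left₀ ha hab 2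
      simp only; linarith) (fun t => add_nonneg (p0 t) (p1 t)) hc
    (fun s t M hM => h1_growth hq fun τ hτ => ⟨i0 τ, i1 τ, hM τ hτ⟩) T
  refine ⟨max M (√M), fun t ht => ⟨fun x => ?_, i0 t, i1 t, ?_, ?_⟩⟩
  · exact (abs_le_sqrt ((sq_le_integral_sq_add (hq.d0 t) (hq.c1.uncurry_left t) (i0 t) (i1 t)
      x).trans (hM t ht))).trans (le_max_right _ _)
  · exact (by linarith [hM t ht, p1 t] : ∫ x, q t x ^ 2 ≤ M).trans (le_max_left _ _)
  · exact (by linarith [hM t ht, p0 t] : ∫ x, q1 t x ^ 2 ≤ M).trans (le_max_left _ _)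

theorem contDiff_fderiv_snd {f : ℝ × ℝ → ℝ} (hf : ContDiff ℝ (⊤ : ℕ∞) f) :
    ContDiff ℝ (⊤ : ℕ∞) fun p => fderiv ℝ f p (0, 1) :=
  (hf.fderiv_right (m := (⊤ : ℕ∞)) (by norm_cast)).clm_apply contDiff_const

theorem hasDerivAt_fderiv_snd {f : ℝ × ℝ → ℝ} (hf : ContDiff ℝ (⊤ : ℕ∞) f) (t x : ℝ) :
    HasDerivAt (fun y => f (t, y)) (fderiv ℝ f (t, x) (0, 1)) x := by
  have h := (hf.differentiable (by simp) (t, x)).hasFDerivAt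
  exact h.comp_hasDerivAt x ((hasDerivAt_const x t).prodMk (hasDerivAt_id x))

theorem integrable_sq_of_decay {f : ℝ → ℝ} (hf : Continuous f)
    (h0 : ∃ C, ∀ x, |f x| ≤ C) (h2 : ∃ C, ∀ x, |x| ^ 2 * |f x| ≤ C) :
    Integrable fun x => f x ^ 2 := by
  obtain ⟨A, hA⟩ := h0
  obtain ⟨B, hB⟩ := h2
  refine Integrable.mono' (integrable_inv_one_add_sq.const_mul (A * (A + B)))
    (hf.pow 2).aestronglyMeasurable (Eventually.of_forall fun x => ?_)
  have hp : 0 < 1 + x ^ 2 := by positivity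
  have h0 : 0 ≤ |f x| := abs_nonneg _
  rw [norm_of_nonneg (sq_nonneg _), ← div_eq_mul_inv, le_div_iff₀ hp, ← sq_abs (f x)]
  have h2 := hB x
  rw [sq_abs] at h2
  have h1 := hA x
  have e : (1 + x ^ 2) * |f x| ≤ A + B := by linarith
  calc |f x| ^ 2 * (1 + x ^ 2) = |f x| * ((1 + x ^ 2) * |f x|) := by ring
    _ ≤ A * (A + B) := mul_le_mul h1 e (by positivity) (h0.trans h1)

theorem IsKdVSolution.kdVClass {u : ℝ → ℝ → ℝ} (hu : IsKdVSolution u) :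
    ∃ q1 q2 q3, KdVClass (fun t x => u t x / 3) q1 q2 q3 := by
  obtain ⟨hs, hd, he⟩ := hu
  have s1 := contDiff_fderiv_snd hs
  have s2 := contDiff_fderiv_snd s1
  have s3 := contDiff_fderiv_snd s2
  have d0 := hasDerivAt_fderiv_snd hs
  have d1 := hasDerivAt_fderiv_snd s1
  have d2 := hasDerivAt_fderiv_snd s2
  set u1 : ℝ × ℝ → ℝ := fun p => fderiv ℝ (uncurry u) p (0, 1) with hu1
  set u2 : ℝ × ℝ → ℝ := fun p => fderiv ℝ u1 p (0, 1) with hu2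
  set u3 : ℝ × ℝ → ℝ := fun p => fderiv ℝ u2 p (0, 1) with hu3
  have e1 : ∀ t, deriv (u t) = fun x => u1 (t, x) := fun t => funext fun x => (d0 t x).deriv
  have e2 : ∀ t, deriv (deriv (u t)) = fun x => u2 (t, x) := fun t => by
    rw [e1]; exact funext fun x => (d1 t x).deriv
  refine ⟨fun t x => u1 (t, x) / 3, fun t x => u2 (t, x) / 3, fun t x => u3 (t, x) / 3,
    KdVReg.kdVClass
      { d0 := fun t x => (d0 t x).div_const 3
        d1 := fun t x => (d1 t x).div_const 3
        d2 := fun t x => (d2 t x).div_const 3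
        dt := fun t x => ?_
        c0 := hs.continuous.div_const 3
        c1 := s1.continuous.div_const 3
        c2 := s2.continuous.div_const 3
        c3 := s3.continuous.div_const 3 } (fun t => ?_) fun t => ?_⟩
  · have h : DifferentiableAt ℝ (fun τ => u τ x) t := by
      have : (fun τ => u τ x) = uncurry u ∘ fun τ => (τ, x) := rfl
      rw [this]
      exact (hs.differentiable (by simp) _).comp t (by fun_prop)
    have hx : deriv (fun y => deriv (deriv (u t)) y + (u t y) ^ 2) x =
        u3 (t, x) + 2 * u t x * u1 (t, x) := by
      rw [e2]
      exact ((d2 t x).fun_add ((d0 t x).fun_pow 2)).deriv.trans (by simp [uncurry, hu1, hu3])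
    have := he t x
    rw [hx] at this
    exact (h.hasDerivAt.div_const 3).congr_deriv (by linarith)
  · refine integrable_sq_of_decay ((hs.continuous.uncurry_left t).div_const 3) ?_ ?_
    · obtain ⟨C, hC⟩ := hd t 0 0
      refine ⟨C, fun x => ?_⟩
      have := hC x
      simp only [pow_zero, one_mul, iteratedDeriv_zero] at this
      rw [abs_div, abs_of_pos (three_pos : (0:ℝ) < 3)]
      linarith [abs_nonneg (u t x)]
    · obtain ⟨C, hC⟩ := hd t 2 0
      refine ⟨C, fun x => ?_⟩
      have := hC x
      simp only [iteratedDeriv_zero] at this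
      rw [abs_div, abs_of_pos (three_pos : (0:ℝ) < 3), ← mul_div_assoc]
      linarith [mul_nonneg (sq_nonneg |x|) (abs_nonneg (u t x))]
  · refine integrable_sq_of_decay ((s1.continuous.comp (by fun_prop : Continuous fun x => (t, x))).div_const 3) ?_ ?_
    · obtain ⟨C, hC⟩ := hd t 0 1
      refine ⟨C, fun x => ?_⟩
      have := hC x
      simp only [pow_zero, one_mul, iteratedDeriv_one, e1] at this
      rw [abs_div, abs_of_pos (three_pos : (0:ℝ) < 3)]
      linarith [abs_nonneg (u1 (t, x))]
    · obtain ⟨C, hC⟩ := hd t 2 1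
      refine ⟨C, fun x => ?_⟩
      have := hC x
      simp only [iteratedDeriv_one, e1] at this
      rw [abs_div, abs_of_pos (three_pos : (0:ℝ) < 3), ← mul_div_assoc]
      linarith [mul_nonneg (sq_nonneg |x|) (abs_nonneg (u1 (t, x)))]

theorem hasDerivAt_tanh (x : ℝ) : HasDerivAt tanh (1 - tanh x ^ 2) x := by
  have hc : cosh x ≠ 0 := (cosh_pos x).ne'
  have h := (hasDerivAt_sinh x).fun_div (hasDerivAt_cosh x) hc
  have e : tanh = fun y => sinh y / cosh y := funext tanh_eq_sinh_div_cosh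
  rw [e]
  exact h.congr_deriv (by field_simp)

theorem continuous_tanh : Continuous tanh :=
  continuous_iff_continuousAt.2 fun x => (hasDerivAt_tanh x).continuousAt

theorem one_sub_tanh_sq (x : ℝ) : 1 - tanh x ^ 2 = 1 / cosh x ^ 2 := by
  have hc : cosh x ≠ 0 := (cosh_pos x).ne'
  rw [tanh_eq_sinh_div_cosh]
  field_simp
  linarith [cosh_sq x]

theorem inv_cosh_le_two_exp (x : ℝ) : 1 / cosh x ≤ 2 * exp (-|x|) := by
  rw [← cosh_abs, div_le_iff₀ (cosh_pos _), cosh_eq]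
  have : exp (-|x|) * exp |x| = 1 := by rw [← exp_add]; simp
  nlinarith [exp_pos (-|x|)]

theorem exp_neg_abs_le_inv_cosh (x : ℝ) : exp (-|x|) ≤ 1 / cosh x := by
  rw [← cosh_abs, le_div_iff₀ (cosh_pos _), cosh_eq]
  have h1 : exp (-|x|) * exp |x| = 1 := by rw [← exp_add]; simp
  have h2 : exp (-|x|) ≤ 1 := exp_le_one_iff.2 (by simp)
  nlinarith [exp_pos (-|x|)]

theorem one_add_tanh_le (x : ℝ) : 1 + tanh x ≤ 2 * exp (2 * x) := by
  have h : exp x * exp (-x) = 1 := by rw [← exp_add]; simp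
  have h2 : exp (2 * x) = exp x * exp x := by rw [← exp_add]; ring_nf
  have : 1 + tanh x = exp x / cosh x := by
    rw [tanh_eq_sinh_div_cosh, eq_div_iff (cosh_pos x).ne', add_mul,
      div_mul_cancel₀ _ (cosh_pos x).ne', cosh_eq, sinh_eq]
    ring
  rw [this, div_le_iff₀ (cosh_pos x), h2, cosh_eq]
  nlinarith [exp_pos x, exp_pos (-x), mul_pos (exp_pos x) (exp_pos x),
    mul_pos (mul_pos (exp_pos x) (exp_pos x)) (exp_pos x)]

/-- A continuous function with `L²` norm at most `δ`. -/
def L2le (f : ℝ → ℝ) (δ : ℝ) : Prop :=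
  Continuous f ∧ 0 ≤ δ ∧ Integrable (fun x => f x ^ 2) ∧ ∫ x, f x ^ 2 ≤ δ ^ 2

namespace L2le

variable {f g : ℝ → ℝ} {a b : ℝ}

theorem mono (h : L2le f a) (hab : a ≤ b) : L2le f b :=
  ⟨h.1, h.2.1.trans hab, h.2.2.1, h.2.2.2.trans (pow_le_pow_left₀ h.2.1 hab 2)⟩

theorem of_abs_le (h : L2le f a) (hg : Continuous g) {C : ℝ} (hC : 0 ≤ C)
    (hle : ∀ x, |g x| ≤ C * |f x|) : L2le g (C * a) := by
  have hp : ∀ x, g x ^ 2 ≤ C ^ 2 * f x ^ 2 := fun x => by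
    rw [← sq_abs (g x), ← sq_abs (f x), ← mul_pow]
    exact pow_le_pow_left₀ (abs_nonneg _) (hle x) 2
  have hi : Integrable fun x => C ^ 2 * f x ^ 2 := h.2.2.1.const_mul _
  refine ⟨hg, mul_nonneg hC h.2.1, hi.mono' (hg.pow 2).aestronglyMeasurable
    (Eventually.of_forall fun x => by rw [norm_of_nonneg (sq_nonneg _)]; exact hp x), ?_⟩
  refine (integral_mono_of_nonneg (Eventually.of_forall fun x => sq_nonneg _) hi
    (Eventually.of_forall hp)).trans ?_
  rw [integral_const_mul, mul_pow]
  exact mul_le_mul_of_nonneg_left h.2.2.2 (sq_nonneg _)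

theorem add (hf : L2le f a) (hg : L2le g b) : L2le (fun x => f x + g x) (a + b) := by
  have hfg := integrable_mul_of_sq hf.1 hg.1 hf.2.2.1 hg.2.2.1
  have e : (fun x => (f x + g x) ^ 2) = fun x => (f x ^ 2 + 2 * (f x * g x)) + g x ^ 2 := by
    funext x; ring
  have hi : Integrable fun x => f x ^ 2 + 2 * (f x * g x) := hf.2.2.1.add (hfg.const_mul 2)
  refine ⟨hf.1.add hg.1, add_nonneg hf.2.1 hg.2.1, e ▸ hi.add hg.2.2.1, ?_⟩
  rw [e, integral_add hi hg.2.2.1, integral_add hf.2.2.1 (hfg.const_mul 2), integral_const_mul]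
  have hd : discrim (∫ x, g x ^ 2) (2 * ∫ x, f x * g x) (∫ x, f x ^ 2) ≤ 0 := by
    refine discrim_le_zero fun t => ?_
    have : 0 ≤ ∫ x, (f x + t * g x) ^ 2 := integral_nonneg fun x => sq_nonneg _
    have e2 : (fun x => (f x + t * g x) ^ 2) =
        fun x => (f x ^ 2 + 2 * t * (f x * g x)) + t ^ 2 * g x ^ 2 := by
      funext x; ring
    have hi : Integrable fun x => f x ^ 2 + 2 * t * (f x * g x) :=
      hf.2.2.1.add (hfg.const_mul (2 * t))
    rw [e2, integral_add hi (hg.2.2.1.const_mul _), integral_add hf.2.2.1 (hfg.const_mul _),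
      integral_const_mul, integral_const_mul] at this
    linarith
  have h1 : (∫ x, f x * g x) ^ 2 ≤ (a * b) ^ 2 := by
    have : (∫ x, g x ^ 2) * (∫ x, f x ^ 2) ≤ b ^ 2 * a ^ 2 :=
      mul_le_mul hg.2.2.2 hf.2.2.2 (integral_nonneg fun x => sq_nonneg _) (sq_nonneg _)
    unfold discrim at hd
    nlinarith
  have h2 := abs_le_of_sq_le_sq' h1 (mul_nonneg hf.2.1 hg.2.1)
  nlinarith [hf.2.2.2, hg.2.2.2, h2.2]

theorem neg (h : L2le f a) : L2le (fun x => -f x) a := by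
  have := h.of_abs_le h.1.neg zero_le_one (fun x => by simp)
  rwa [one_mul] at this

theorem sub (hf : L2le f a) (hg : L2le g b) : L2le (fun x => f x - g x) (a + b) := by
  simpa only [sub_eq_add_neg] using hf.add hg.neg

theorem sum {n : ℕ} {F : Fin n → ℝ → ℝ} (h : ∀ j, L2le (F j) a) :
    L2le (fun x => ∑ j, F j x) (n * a) := by
  induction n with
  | zero => exact ⟨by simpa using continuous_const, by simp, by simp, by simp⟩
  | succ n ih =>
    simp only [Fin.sum_univ_castSucc]
    push_cast
    rw [add_mul, one_mul]
    exact (ih fun j => h j.castSucc).add (h (Fin.last n))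

theorem comp_sub (h : L2le f a) (y : ℝ) : L2le (fun x => f (x - y)) a :=
  ⟨h.1.comp (continuous_id.sub continuous_const), h.2.1, h.2.2.1.comp_sub_right y,
    (integral_sub_right_eq_self (fun x => f x ^ 2) y).trans_le h.2.2.2⟩

theorem comp_neg (h : L2le f a) : L2le (fun x => f (-x)) a :=
  ⟨h.1.comp continuous_neg, h.2.1, h.2.2.1.comp_neg,
    (integral_neg_eq_self (fun x => f x ^ 2) volume).trans_le h.2.2.2⟩

theorem of_symm (hf : Continuous f) (ha : 0 ≤ a)
    (h : ∀ R, 0 ≤ R → ∫ x in (-R)..R, f x ^ 2 ≤ a ^ 2) : L2le f a := by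
  have := integrable_of_symm_intervalIntegral_le (hf.pow 2) (fun x => sq_nonneg _) h
  exact ⟨hf, ha, this.1, this.2⟩

theorem intervalIntegral_le (h : L2le f a) {x y : ℝ} (hxy : x ≤ y) :
    ∫ s in x..y, f s ^ 2 ≤ a ^ 2 :=
  (intervalIntegral_le_integral_of_nonneg h.2.2.1 (fun _ => sq_nonneg _) hxy).trans h.2.2.2

end L2le

theorem l2le_inv_cosh {k : ℝ} (hk : 0 < k) : L2le (fun x => 1 / cosh (k * x)) (√(2 / k)) := by
  have hc : ∀ x, cosh (k * x) ≠ 0 := fun x => (cosh_pos _).ne'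
  have hcont : Continuous fun x => 1 / cosh (k * x) :=
    continuous_const.div (by fun_prop) hc
  refine L2le.of_symm hcont (sqrt_nonneg _) fun R hR => ?_
  have hd : ∀ x, HasDerivAt (fun y => tanh (k * y) / k) ((1 / cosh (k * x)) ^ 2) x := by
    intro x
    have := ((hasDerivAt_tanh (k * x)).comp x ((hasDerivAt_id x).const_mul k)).div_const k
    refine this.congr_deriv ?_
    rw [one_sub_tanh_sq]
    field_simp
  rw [intervalIntegral.integral_eq_sub_of_hasDerivAt (fun x _ => hd x)
    ((hcont.pow 2).intervalIntegrable _ _), sq_sqrt (by positivity), ← sub_div]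
  gcongr
  have h1 := abs_lt.1 (abs_tanh_lt_one (k * R))
  have h2 := abs_lt.1 (abs_tanh_lt_one (k * -R))
  linarith [h1.2, h2.1]

/-- The soliton `2 k² sech²(k y)` of `q_t + q_xxx + 6 q q_x = 0`. -/
noncomputable def sol (k y : ℝ) : ℝ := 2 * k ^ 2 / cosh (k * y) ^ 2

/-- Minus the logarithmic derivative of `κ - k tanh(k y)`. -/
noncomputable def gfun (κ k y : ℝ) : ℝ := k ^ 2 / (cosh (k * y) ^ 2 * (κ - k * tanh (k * y)))

/-- The phase shift of a soliton produced by removing a soliton of parameter `κ`. -/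
noncomputable def phase (κ k : ℝ) : ℝ := artanh (k / κ) / k

theorem abs_mul_tanh_lt {k : ℝ} (hk : 0 < k) (y : ℝ) : |k * tanh y| < k := by
  rw [abs_mul, abs_of_pos hk]
  nlinarith [abs_tanh_lt_one y]

theorem theta_bounds {κ k : ℝ} (hk : 0 < k) (y : ℝ) :
    κ - k < κ - k * tanh y ∧ κ - k * tanh y < κ + k := by
  have := abs_lt.1 (abs_mul_tanh_lt hk y)
  constructor <;> linarith [this.1, this.2]

theorem hasDerivAt_tanh_mul (k a x : ℝ) :
    HasDerivAt (fun x => k * tanh (k * (x - a))) (k ^ 2 - (k * tanh (k * (x - a))) ^ 2) x := by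
  have h : HasDerivAt (fun x => k * (x - a)) (k * 1) x :=
    ((hasDerivAt_id x).sub_const a).const_mul k
  exact (((hasDerivAt_tanh _).comp x h).const_mul k).congr_deriv (by ring)

theorem gfun_eq (κ k y : ℝ) :
    gfun κ k y = k ^ 2 * (1 - tanh (k * y) ^ 2) / (κ - k * tanh (k * y)) := by
  rw [gfun, one_sub_tanh_sq, mul_one_div, div_div]

theorem sol_eq (k y : ℝ) : sol k y = 2 * (k ^ 2 - (k * tanh (k * y)) ^ 2) := by
  have := one_sub_tanh_sq (k * y)
  rw [sol, div_eq_mul_one_div, ← this]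
  ring

theorem hasDerivAt_gfun {κ k : ℝ} (hk : 0 < k) (hκ : k < κ) (a x : ℝ) :
    HasDerivAt (fun x => gfun κ k (x - a))
      (gfun κ k (x - a) ^ 2 - 2 * κ * gfun κ k (x - a) + sol k (x - a)) x := by
  have hpos : ∀ x, κ - k * tanh (k * (x - a)) ≠ 0 := fun x => by
    linarith [(theta_bounds (κ := κ) hk (k * (x - a))).1]
  have ht := hasDerivAt_tanh_mul k a x
  have h := (((ht.fun_pow 2).const_sub (k ^ 2)).fun_div (ht.const_sub κ) (hpos x))
  have e : (fun x => gfun κ k (x - a)) =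
      fun x => (k ^ 2 - (k * tanh (k * (x - a))) ^ 2) / (κ - k * tanh (k * (x - a))) := by
    funext x; rw [gfun_eq]; congr 1; ring
  rw [e]
  refine h.congr_deriv ?_
  rw [gfun_eq, sol_eq]
  have := hpos x
  field_simp
  ring

theorem sol_phase {κ k : ℝ} (hk : 0 < k) (hκ : k < κ) (y : ℝ) :
    sol k (y - phase κ k) = 4 * κ * gfun κ k y - 2 * gfun κ k y ^ 2 - sol k y := by
  have hm : k / κ ∈ Ioo (-1 : ℝ) 1 := by
    have : 0 < κ := hk.trans hκ
    constructor
    · have : 0 < k / κ := by positivity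
      linarith
    · rwa [div_lt_one this]
  have hκ0 : 0 < κ := hk.trans hκ
  have hθ : 0 < κ - k * tanh (k * y) := by
    linarith [(theta_bounds (κ := κ) hk (k * y)).1]
  have hC := cosh_pos (k * y)
  have hs : 0 < 1 - (k / κ) ^ 2 := by nlinarith [hm.1, hm.2]
  have h1 : k * (y - phase κ k) = k * y - artanh (k / κ) := by
    rw [phase]; field_simp
  have hc : cosh (k * y - artanh (k / κ)) ^ 2 * (κ ^ 2 - k ^ 2) =
      cosh (k * y) ^ 2 * (κ - k * tanh (k * y)) ^ 2 := by
    rw [cosh_sub, cosh_artanh hm, sinh_artanh hm, tanh_eq_sinh_div_cosh]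
    have e : (κ ^ 2 - k ^ 2) = κ ^ 2 * √(1 - (k / κ) ^ 2) ^ 2 := by
      rw [sq_sqrt hs.le]; field_simp
    have : √(1 - (k / κ) ^ 2) ≠ 0 := (sqrt_pos.2 hs).ne'
    generalize √(1 - (k / κ) ^ 2) = r at e this ⊢
    rw [e]
    field_simp
  have hkk : 0 < κ ^ 2 - k ^ 2 := by nlinarith
  have hc2 : cosh (k * y - artanh (k / κ)) ^ 2 =
      cosh (k * y) ^ 2 * (κ - k * tanh (k * y)) ^ 2 / (κ ^ 2 - k ^ 2) := by
    rw [eq_div_iff hkk.ne', hc]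
  have e1 : sol k (y - phase κ k) =
      2 * k ^ 2 * (1 - tanh (k * y) ^ 2) * (κ ^ 2 - k ^ 2) / (κ - k * tanh (k * y)) ^ 2 := by
    rw [sol, h1, hc2, one_sub_tanh_sq]
    field_simp
  rw [e1, gfun_eq, sol_eq]
  field_simp
  ring

/-- Bounds on the parameters `k` of the slow solitons and `κ` of the fast one. -/
structure WaveParams {n : ℕ} (k0 d K κ : ℝ) (k : Fin n → ℝ) : Prop where
  k0_pos : 0 < k0
  d_pos : 0 < d
  k0_le : ∀ j, k0 ≤ k j
  gap : ∀ j, k j + d ≤ κ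
  k0_le_top : k0 ≤ κ
  top_le : κ ≤ K

/-- The slow solitons are at mutual distance `ℓ`, and at distance `ℓ` to the left of `X`. -/
structure Separated {n : ℕ} (ℓ X : ℝ) (a : Fin n → ℝ) : Prop where
  dist : ∀ i j, i ≠ j → ℓ ≤ |a i - a j|
  top : ∀ j, a j + ℓ ≤ X

/-- The sum of the functions `gfun`. -/
noncomputable def gsum {n : ℕ} (κ : ℝ) (k a : Fin n → ℝ) (x : ℝ) : ℝ :=
  ∑ j, gfun κ (k j) (x - a j)

/-- The approximate solution of the Riccati equation. -/
noncomputable def kink {n : ℕ} (κ X : ℝ) (k a : Fin n → ℝ) (x : ℝ) : ℝ :=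
  κ * tanh (κ * (x - X)) + gsum κ k a x

/-- The interaction error of the approximate solution. -/
noncomputable def interaction {n : ℕ} (κ X : ℝ) (k a : Fin n → ℝ) (x : ℝ) : ℝ :=
  -2 * (κ * tanh (κ * (x - X)) + κ) * gsum κ k a x -
    (gsum κ k a x ^ 2 - ∑ j, gfun κ (k j) (x - a j) ^ 2)

/-- The product of the functions `κ - k tanh(k (x - a))`. -/
noncomputable def thetaProd {n : ℕ} (κ : ℝ) (k a : Fin n → ℝ) (x : ℝ) : ℝ :=
  ∏ j, (κ - k j * tanh (k j * (x - a j)))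

namespace WaveParams

variable {n : ℕ} {k0 d K κ : ℝ} {k : Fin n → ℝ}

theorem pos (h : WaveParams k0 d K κ k) (j : Fin n) : 0 < k j := h.k0_pos.trans_le (h.k0_le j)

theorem lt_top (h : WaveParams k0 d K κ k) (j : Fin n) : k j < κ := by
  linarith [h.gap j, h.d_pos]

theorem top_pos (h : WaveParams k0 d K κ k) : 0 < κ := h.k0_pos.trans_le h.k0_le_top

theorem K_pos (h : WaveParams k0 d K κ k) : 0 < K := h.top_pos.trans_le h.top_le

theorem hasDerivAt_gsum (h : WaveParams k0 d K κ k) (a : Fin n → ℝ) (x : ℝ) :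
    HasDerivAt (gsum κ k a) ((∑ j, gfun κ (k j) (x - a j) ^ 2) - 2 * κ * gsum κ k a x +
      ∑ j, sol (k j) (x - a j)) x := by
  have := HasDerivAt.fun_sum (u := Finset.univ) fun j _ =>
    hasDerivAt_gfun (h.pos j) (h.lt_top j) (a j) x
  refine this.congr_deriv ?_
  rw [Finset.sum_add_distrib, Finset.sum_sub_distrib, gsum, Finset.mul_sum]

theorem sum_sol_phase (h : WaveParams k0 d K κ k) (a : Fin n → ℝ) (x : ℝ) :
    ∑ j, sol (k j) (x - a j - phase κ (k j)) = 4 * κ * gsum κ k a x -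
      2 * (∑ j, gfun κ (k j) (x - a j) ^ 2) - ∑ j, sol (k j) (x - a j) := by
  simp only [fun j => sol_phase (h.pos j) (h.lt_top j) (x - a j)]
  rw [Finset.sum_sub_distrib, Finset.sum_sub_distrib, gsum, Finset.mul_sum, Finset.mul_sum]

theorem hasDerivAt_kink (h : WaveParams k0 d K κ k) (X : ℝ) (a : Fin n → ℝ) (x : ℝ) :
    HasDerivAt (kink κ X k a) (κ ^ 2 - kink κ X k a x ^ 2 -
      ((∑ j, sol (k j) (x - a j - phase κ (k j))) + interaction κ X k a x)) x := by
  refine ((hasDerivAt_tanh_mul κ X x).fun_add (h.hasDerivAt_gsum a x)).congr_deriv ?_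
  rw [h.sum_sol_phase, interaction, kink]
  ring

theorem sol_add_sum_sol (h : WaveParams k0 d K κ k) (X : ℝ) (a : Fin n → ℝ) (x : ℝ) :
    sol κ (x - X) + (∑ j, sol (k j) (x - a j)) + (∑ j, sol (k j) (x - a j - phase κ (k j))) +
      2 * interaction κ X k a x = 2 * κ ^ 2 - 2 * kink κ X k a x ^ 2 := by
  rw [h.sum_sol_phase, interaction, kink, sol_eq]
  ring

theorem hasDerivAt_thetaProd (h : WaveParams k0 d K κ k) (a : Fin n → ℝ) (x : ℝ) :
    HasDerivAt (thetaProd κ k a) (-(thetaProd κ k a x * gsum κ k a x)) x := by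
  have := HasDerivAt.fun_finsetProd (u := Finset.univ) fun j _ =>
    (hasDerivAt_tanh_mul (k j) (a j) x).const_sub κ
  refine this.congr_deriv ?_
  rw [gsum, Finset.mul_sum, ← Finset.sum_neg_distrib]
  refine Finset.sum_congr rfl fun i _ => ?_
  have hne : κ - k i * tanh (k i * (x - a i)) ≠ 0 := by
    linarith [(theta_bounds (κ := κ) (h.pos i) (k i * (x - a i))).1, h.lt_top i]
  rw [thetaProd, ← Finset.prod_erase_mul _ _ (Finset.mem_univ i), gfun_eq, smul_eq_mul]
  field_simp

theorem thetaProd_bounds (h : WaveParams k0 d K κ k) (a : Fin n → ℝ) (x : ℝ) :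
    d ^ n ≤ thetaProd κ k a x ∧ thetaProd κ k a x ≤ (2 * K) ^ n := by
  have hb := fun j => theta_bounds (κ := κ) (h.pos j) (k j * (x - a j))
  have h0 := h.d_pos
  constructor
  · have := Finset.prod_le_prod (s := (Finset.univ : Finset (Fin n))) (fun _ _ => h.d_pos.le)
      (fun j _ => (by linarith [(hb j).1, h.gap j] : d ≤ κ - k j * tanh (k j * (x - a j))))
    simpa [thetaProd] using this
  · have := Finset.prod_le_prod (s := (Finset.univ : Finset (Fin n)))
      (f := fun j => κ - k j * tanh (k j * (x - a j))) (g := fun _ => 2 * K)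
      (fun j _ => by linarith [(hb j).1, h.gap j])
      (fun j _ => by linarith [(hb j).2, h.gap j, h.top_le])
    simpa [thetaProd] using this

theorem gfun_nonneg (h : WaveParams k0 d K κ k) (j : Fin n) (y : ℝ) : 0 ≤ gfun κ (k j) y := by
  have : 0 < κ - k j * tanh (k j * y) := by
    linarith [(theta_bounds (κ := κ) (h.pos j) (k j * y)).1, h.lt_top j]
  exact div_nonneg (sq_nonneg _) (mul_nonneg (sq_nonneg _) this.le)

theorem gfun_le (h : WaveParams k0 d K κ k) (j : Fin n) (y : ℝ) :
    gfun κ (k j) y ≤ K ^ 2 / d * (1 / cosh (k0 * y)) ^ 2 := by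
  have h1 : d ≤ κ - k j * tanh (k j * y) := by
    linarith [(theta_bounds (κ := κ) (h.pos j) (k j * y)).1, h.gap j]
  have h2 : cosh (k0 * y) ≤ cosh (k j * y) := by
    rw [cosh_le_cosh, abs_mul, abs_mul, abs_of_pos h.k0_pos, abs_of_pos (h.pos j)]
    exact mul_le_mul_of_nonneg_right (h.k0_le j) (abs_nonneg _)
  have h3 : k j ≤ K := (h.lt_top j).le.trans h.top_le
  have hc := cosh_pos (k0 * y)
  have hd := h.d_pos
  calc gfun κ (k j) y ≤ K ^ 2 / (cosh (k0 * y) ^ 2 * d) := by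
        unfold gfun
        have := h.pos j
        gcongr
    _ = _ := by field_simp

theorem inv_cosh_le_one (x : ℝ) : 1 / cosh x ≤ 1 := by
  rw [div_le_one (cosh_pos x)]; exact one_le_cosh x

theorem gsum_nonneg (h : WaveParams k0 d K κ k) (a : Fin n → ℝ) (x : ℝ) : 0 ≤ gsum κ k a x :=
  Finset.sum_nonneg fun j _ => h.gfun_nonneg j _

theorem gsum_le_of_forall {B : ℝ} {a : Fin n → ℝ} {x : ℝ}
    (hB : ∀ j, gfun κ (k j) (x - a j) ≤ B) : gsum κ k a x ≤ n * B := by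
  have := Finset.sum_le_card_nsmul Finset.univ _ _ fun j _ => hB j
  simpa [gsum] using this

theorem gsum_le (h : WaveParams k0 d K κ k) (a : Fin n → ℝ) (x : ℝ) :
    gsum κ k a x ≤ n * (K ^ 2 / d) := by
  refine gsum_le_of_forall fun j => (h.gfun_le j _).trans ?_
  have h1 := inv_cosh_le_one (k0 * (x - a j))
  have h2 : 0 ≤ 1 / cosh (k0 * (x - a j)) := (one_div_pos.2 (cosh_pos _)).le
  have h3 : 0 ≤ K ^ 2 / d := div_nonneg (sq_nonneg _) h.d_pos.le
  exact mul_le_of_le_one_right h3 (pow_le_one₀ h2 h1)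

theorem abs_kink_le (h : WaveParams k0 d K κ k) (X : ℝ) (a : Fin n → ℝ) (x : ℝ) :
    |kink κ X k a x| ≤ K + n * (K ^ 2 / d) := by
  have h1 := abs_mul_tanh_lt h.top_pos (κ * (x - X))
  have h2 := abs_add_le (κ * tanh (κ * (x - X))) (gsum κ k a x)
  rw [abs_of_nonneg (h.gsum_nonneg a x)] at h2
  unfold kink
  linarith [h.gsum_le a x, h.top_le]

theorem gsum_le_exp (h : WaveParams k0 d K κ k) {ℓ X m : ℝ} {a : Fin n → ℝ}
    (hs : Separated ℓ X a) {x : ℝ} (hx : X - m ≤ x) :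
    gsum κ k a x ≤ n * (K ^ 2 / d * (2 * exp (-(k0 * (ℓ - m))))) := by
  refine gsum_le_of_forall fun j => (h.gfun_le j _).trans ?_
  have h1 := inv_cosh_le_one (k0 * (x - a j))
  have h2 : 0 ≤ 1 / cosh (k0 * (x - a j)) := (one_div_pos.2 (cosh_pos _)).le
  have h3 : 0 ≤ K ^ 2 / d := div_nonneg (sq_nonneg _) h.d_pos.le
  refine mul_le_mul_of_nonneg_left ?_ h3
  calc (1 / cosh (k0 * (x - a j))) ^ 2 ≤ 1 / cosh (k0 * (x - a j)) := by
        rw [sq]; exact mul_le_of_le_one_left h2 h1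
    _ ≤ 2 * exp (-|k0 * (x - a j)|) := inv_cosh_le_two_exp _
    _ ≤ _ := by
      gcongr
      refine le_trans ?_ (le_abs_self _)
      exact mul_le_mul_of_nonneg_left (by linarith [hs.top j]) h.k0_pos.le

theorem abs_interaction_le (h : WaveParams k0 d K κ k) {ℓ X : ℝ} {a : Fin n → ℝ}
    (hs : Separated ℓ X a) (x : ℝ) :
    |interaction κ X k a x| ≤ (8 * K * (K ^ 2 / d) + n * (4 * (K ^ 2 / d) ^ 2)) *
      exp (-(k0 * ℓ)) * ∑ j, 1 / cosh (k0 * (x - a j)) := by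
  set D := K ^ 2 / d with hD
  have hD0 : 0 ≤ D := div_nonneg (sq_nonneg _) h.d_pos.le
  set E := exp (-(k0 * ℓ)) with hE
  have hE0 : 0 < E := exp_pos _
  let c : Fin n → ℝ := fun j => 1 / cosh (k0 * (x - a j))
  let g : Fin n → ℝ := fun j => gfun κ (k j) (x - a j)
  have c0 : ∀ j, 0 ≤ c j := fun j => (one_div_pos.2 (cosh_pos _)).le
  have c1 : ∀ j, c j ≤ 1 := fun j => inv_cosh_le_one _
  have ce : ∀ j, c j ≤ 2 * exp (-(k0 * |x - a j|)) := fun j => by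
    have := inv_cosh_le_two_exp (k0 * (x - a j))
    rwa [abs_mul, abs_of_pos h.k0_pos] at this
  have g0 : ∀ j, 0 ≤ g j := fun j => h.gfun_nonneg j _
  have gc : ∀ j, g j ≤ D * c j ^ 2 := fun j => h.gfun_le j _
  have hK := h.K_pos
  have hT0 : 0 ≤ κ * tanh (κ * (x - X)) + κ := by
    linarith [(abs_lt.1 (abs_mul_tanh_lt h.top_pos (κ * (x - X)))).1]
  have hT : κ * tanh (κ * (x - X)) + κ ≤ 2 * K * exp (k0 * (x - X)) := by
    have h1 : 1 + tanh (κ * (x - X)) ≤ 2 * exp (k0 * (x - X)) := by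
      rcases le_total 0 (x - X) with hx | hx
      · have : 1 ≤ exp (k0 * (x - X)) := one_le_exp (mul_nonneg h.k0_pos.le hx)
        linarith [tanh_lt_one (κ * (x - X))]
      · refine (one_add_tanh_le _).trans ?_
        exact mul_le_mul_of_nonneg_left
          (exp_le_exp.2 (by nlinarith [h.k0_le_top, h.top_pos])) two_pos.le
    have := mul_le_mul h.top_le h1 (by linarith [neg_one_lt_tanh (κ * (x - X))]) hK.le
    linarith
  have hTg : ∀ j, (κ * tanh (κ * (x - X)) + κ) * g j ≤ 4 * K * D * E * c j := by
    intro j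
    have e : exp (k0 * (x - X)) * exp (-(k0 * |x - a j|)) ≤ E := by
      rw [← exp_add, hE]
      gcongr
      have := hs.top j
      nlinarith [le_abs_self (x - a j), h.k0_pos]
    calc _ ≤ (2 * K * exp (k0 * (x - X))) * (D * c j ^ 2) :=
          mul_le_mul hT (gc j) (g0 j) (by positivity)
      _ = (2 * K * D * c j) * (exp (k0 * (x - X)) * c j) := by ring
      _ ≤ (2 * K * D * c j) * (exp (k0 * (x - X)) * (2 * exp (-(k0 * |x - a j|)))) := by
          have := c0 j
          gcongr
          exact ce j
      _ = (4 * K * D * c j) * (exp (k0 * (x - X)) * exp (-(k0 * |x - a j|))) := by ring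
      _ ≤ (4 * K * D * c j) * E := mul_le_mul_of_nonneg_left e (by have := c0 j; positivity)
      _ = _ := by ring
  have hgg : ∀ i j, i ≠ j → g i * g j ≤ 4 * D ^ 2 * E * c j := by
    intro i j hij
    have e : exp (-(k0 * |x - a i|)) * exp (-(k0 * |x - a j|)) ≤ E := by
      rw [← exp_add, hE]
      gcongr
      have h1 := hs.dist i j hij
      have h2 : |a i - a j| ≤ |x - a i| + |x - a j| := by
        rw [abs_sub_comm x (a i)]
        simpa using abs_add_le (a i - x) (x - a j)
      nlinarith [h.k0_pos]
    have hcc : c i * c j ≤ 4 * E := by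
      calc c i * c j ≤ (2 * exp (-(k0 * |x - a i|))) * (2 * exp (-(k0 * |x - a j|))) :=
            mul_le_mul (ce i) (ce j) (c0 j) (by positivity)
        _ = 4 * (exp (-(k0 * |x - a i|)) * exp (-(k0 * |x - a j|))) := by ring
        _ ≤ 4 * E := by linarith
    calc g i * g j ≤ (D * c i ^ 2) * (D * c j ^ 2) :=
          mul_le_mul (gc i) (gc j) (g0 j) (by positivity)
      _ = D ^ 2 * c j * (c i * (c i * c j)) := by ring
      _ ≤ D ^ 2 * c j * (1 * (4 * E)) := by
          have := c0 i
          have := c0 j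
          gcongr
          exact c1 i
      _ = _ := by ring
  have hsplit : gsum κ k a x ^ 2 - ∑ j, gfun κ (k j) (x - a j) ^ 2 =
      ∑ j, ∑ i ∈ Finset.univ.erase j, g i * g j := by
    rw [gsum, sq, Finset.sum_mul_sum, Finset.sum_comm, ← Finset.sum_sub_distrib]
    refine Finset.sum_congr rfl fun j _ => ?_
    rw [← Finset.sum_erase_add _ _ (Finset.mem_univ j)]
    simp only [g]
    ring
  have hA0 : 0 ≤ ∑ j, ∑ i ∈ Finset.univ.erase j, g i * g j :=
    Finset.sum_nonneg fun j _ => Finset.sum_nonneg fun i _ => mul_nonneg (g0 i) (g0 j)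
  have hA : ∑ j, ∑ i ∈ Finset.univ.erase j, g i * g j ≤ n * (4 * D ^ 2) * E * ∑ j, c j := by
    rw [Finset.mul_sum]
    refine Finset.sum_le_sum fun j _ => ?_
    have h0 : 0 ≤ 4 * D ^ 2 * E * c j := by have := c0 j; positivity
    calc ∑ i ∈ Finset.univ.erase j, g i * g j
        ≤ ∑ i ∈ Finset.univ.erase j, 4 * D ^ 2 * E * c j :=
          Finset.sum_le_sum fun i hi => hgg i j (Finset.ne_of_mem_erase hi)
      _ ≤ ∑ _i : Fin n, 4 * D ^ 2 * E * c j :=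
          Finset.sum_le_sum_of_subset_of_nonneg (Finset.erase_subset _ _) fun _ _ _ => h0
      _ = _ := by simp; ring
  have hB : (κ * tanh (κ * (x - X)) + κ) * gsum κ k a x ≤ 4 * K * D * E * ∑ j, c j := by
    rw [gsum, Finset.mul_sum, Finset.mul_sum]
    exact Finset.sum_le_sum fun j _ => hTg j
  have hB0 : 0 ≤ (κ * tanh (κ * (x - X)) + κ) * gsum κ k a x :=
    mul_nonneg hT0 (h.gsum_nonneg a x)
  have hc : ∑ j, 1 / cosh (k0 * (x - a j)) = ∑ j, c j := rfl
  rw [interaction, hsplit, abs_le, hc]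
  constructor <;> nlinarith

theorem continuous_kink (h : WaveParams k0 d K κ k) (X : ℝ) (a : Fin n → ℝ) :
    Continuous (kink κ X k a) :=
  continuous_iff_continuousAt.2 fun x => (h.hasDerivAt_kink X a x).continuousAt

theorem continuous_gsum (h : WaveParams k0 d K κ k) (a : Fin n → ℝ) :
    Continuous (gsum κ k a) :=
  continuous_iff_continuousAt.2 fun x => (h.hasDerivAt_gsum a x).continuousAt

theorem continuous_interaction (h : WaveParams k0 d K κ k) (X : ℝ) (a : Fin n → ℝ) :
    Continuous (interaction κ X k a) := by
  have c1 := h.continuous_gsum a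
  have c2 : ∀ j, Continuous fun x => gfun κ (k j) (x - a j) := fun j =>
    continuous_iff_continuousAt.2 fun x =>
      (hasDerivAt_gfun (h.pos j) (h.lt_top j) (a j) x).continuousAt
  have c3 := continuous_tanh
  unfold interaction
  fun_prop

end WaveParams

theorem l2le_interaction (n : ℕ) {k0 d K : ℝ} (hk0 : 0 < k0) (hd : 0 < d) (hK : 0 < K) :
    ∃ C, 0 < C ∧ ∀ (κ X ℓ : ℝ) (k a : Fin n → ℝ), WaveParams k0 d K κ k → Separated ℓ X a →
      L2le (interaction κ X k a) (C * exp (-(k0 * ℓ))) := by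
  refine ⟨(8 * K * (K ^ 2 / d) + n * (4 * (K ^ 2 / d) ^ 2)) * (n * √(2 / k0)) + 1,
    by positivity, fun κ X ℓ k a h hs => ?_⟩
  have h1 : L2le (fun x => ∑ j, 1 / cosh (k0 * (x - a j))) (n * √(2 / k0)) :=
    L2le.sum fun j => (l2le_inv_cosh hk0).comp_sub (a j)
  have hE := exp_pos (-(k0 * ℓ))
  have := h1.of_abs_le (C := (8 * K * (K ^ 2 / d) + n * (4 * (K ^ 2 / d) ^ 2)) * exp (-(k0 * ℓ)))
    (h.continuous_interaction X a) (by positivity) (fun x => by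
      refine (h.abs_interaction_le hs x).trans ?_
      refine mul_le_mul_of_nonneg_left (le_abs_self _) (by positivity))
  refine this.mono ?_
  nlinarith

theorem lt_of_bootstrap {f : ℝ → ℝ} (hf : Continuous f) {η : ℝ} (h0 : f 0 < η)
    (h : ∀ x, 0 ≤ x → (∀ y ∈ Icc 0 x, f y ≤ η) → f x < η) {x : ℝ} (hx : 0 ≤ x) : f x < η := by
  by_contra! hc
  have hS : IsCompact (Icc 0 x ∩ f ⁻¹' {η}) :=
    isCompact_Icc.inter_right (isClosed_singleton.preimage hf)
  have hne : (Icc 0 x ∩ f ⁻¹' {η}).Nonempty := by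
    obtain ⟨y, hy, e⟩ := intermediate_value_Icc hx hf.continuousOn ⟨h0.le, hc⟩
    exact ⟨y, hy, e⟩
  obtain ⟨z, ⟨hz, hzη⟩, hmin⟩ := hS.exists_isLeast hne
  have hzη : f z = η := hzη
  refine (h z hz.1 fun y hy => ?_).ne hzη
  by_contra! hyc
  obtain ⟨v, hv, e⟩ := intermediate_value_Icc hy.1 hf.continuousOn ⟨h0.le, hyc.le⟩
  have h1 : z ≤ v := hmin ⟨⟨hv.1, hv.2.trans (hy.2.trans hz.2)⟩, e⟩
  have : y = z := le_antisymm hy.2 (h1.trans hv.2)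
  rw [this] at hyc
  linarith

theorem energy_deriv_le {κ T e e' r φ s : ℝ} (hκ : 0 < κ) (hs : s * e' = -2 * T * e - r * e ^ 2 - φ)
    (hr : |r * e| ≤ κ / 2) : s * (2 * (e * e')) ≤ (-4 * T + 2 * κ) * e ^ 2 + φ ^ 2 / κ := by
  have h1 : s * (2 * (e * e')) = -4 * T * e ^ 2 - 2 * (r * e) * e ^ 2 - 2 * (φ * e) := by
    calc s * (2 * (e * e')) = 2 * e * (s * e') := by ring
      _ = _ := by rw [hs]; ring
  have h2 : -2 * (r * e) * e ^ 2 ≤ κ * e ^ 2 := by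
    have := (abs_le.1 hr).1
    nlinarith [sq_nonneg e]
  have h3 : -2 * (φ * e) ≤ κ * e ^ 2 + φ ^ 2 / κ := by
    have h : φ ^ 2 / κ = κ * (φ / κ) ^ 2 := by field_simp
    have h' : φ = κ * (φ / κ) := by field_simp
    rw [h]
    generalize φ / κ = z at h'
    rw [h']
    nlinarith [mul_nonneg hκ.le (sq_nonneg (z + e))]
  nlinarith

theorem tanh_defect_le (x : ℝ) : 1 - tanh x ≤ 2 * exp (-(2 * x)) := by
  have := one_add_tanh_le (-x)
  rwa [tanh_neg, mul_neg] at this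

theorem riccati_energy {κ s M Δ : ℝ} {e e' r φ : ℝ → ℝ} (hκ : 0 < κ) (hs : s = 1 ∨ s = -1)
    (hd : ∀ x, HasDerivAt e (e' x) x) (ce : Continuous e') (cφ : Continuous φ)
    (heq : ∀ x, 0 ≤ x → s * e' x = -2 * (κ * tanh (κ * x)) * e x - r x * e x ^ 2 - φ x)
    (hr : ∀ x, 0 ≤ x → |r x * e x| ≤ κ / 2) (hM : ∀ x, 0 ≤ x → e x ^ 2 ≤ M)
    (hφ : ∀ R, 0 ≤ R → ∫ x in (0:ℝ)..R, φ x ^ 2 ≤ Δ) {R : ℝ} (hR : 0 ≤ R) :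
    2 * κ * ∫ x in (0:ℝ)..R, e x ^ 2 ≤ 5 * M + Δ / κ := by
  have c0 : Continuous e := continuous_iff_continuousAt.2 fun x => (hd x).continuousAt
  have hM0 : 0 ≤ M := (sq_nonneg _).trans (hM 0 le_rfl)
  have hE : ∀ x, HasDerivAt (fun y => s * e y ^ 2) (s * (2 * (e x * e' x))) x := fun x =>
    (((hd x).fun_pow 2).const_mul s).congr_deriv (by ring)
  have hI := intervalIntegral.integral_eq_sub_of_hasDerivAt (a := 0) (b := R)
    (fun x _ => hE x) (Continuous.intervalIntegrable (by fun_prop) _ _)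
  have hG : ∀ x, HasDerivAt (fun y => -4 * M * exp (-(2 * (κ * y))))
      (8 * κ * M * exp (-(2 * (κ * x)))) x := fun x => by
    have := ((((hasDerivAt_id x).const_mul κ).const_mul 2).neg.exp).const_mul (-4 * M)
    exact this.congr_deriv (by simp; ring)
  have hJ := intervalIntegral.integral_eq_sub_of_hasDerivAt (a := 0) (b := R)
    (fun x _ => hG x) (Continuous.intervalIntegrable (by fun_prop) _ _)
  have c1 : Continuous fun x => 8 * κ * M * exp (-(2 * (κ * x))) := by fun_prop
  have c2 : Continuous fun x => 2 * κ * e x ^ 2 := by fun_prop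
  have c3 : Continuous fun x => φ x ^ 2 / κ := by fun_prop
  have c4 : Continuous fun x => 8 * κ * M * exp (-(2 * (κ * x))) - 2 * κ * e x ^ 2 := by fun_prop
  have hmono := intervalIntegral.integral_mono_on (μ := volume) hR
    (f := fun x => s * (2 * (e x * e' x)))
    (g := fun x => (8 * κ * M * exp (-(2 * (κ * x))) - 2 * κ * e x ^ 2) + φ x ^ 2 / κ)
    (Continuous.intervalIntegrable (by fun_prop) _ _)
    (Continuous.intervalIntegrable (by fun_prop) _ _) (fun x hx => by
      have h1 := energy_deriv_le hκ (heq x hx.1) (hr x hx.1)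
      have h2 := tanh_defect_le (κ * x)
      have h3 : 4 * (κ * (1 - tanh (κ * x))) * e x ^ 2 ≤
          4 * (κ * (2 * exp (-(2 * (κ * x))))) * M := by
        have : 0 ≤ exp (-(2 * (κ * x))) := (exp_pos _).le
        gcongr
        exact hM x hx.1
      nlinarith)
  rw [hI, intervalIntegral.integral_add (c4.intervalIntegrable _ _) (c3.intervalIntegrable _ _),
    intervalIntegral.integral_sub (c1.intervalIntegrable _ _) (c2.intervalIntegrable _ _), hJ,
    intervalIntegral.integral_const_mul, intervalIntegral.integral_div] at hmono
  have h1 : (∫ x in (0:ℝ)..R, φ x ^ 2) / κ ≤ Δ / κ := by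
    gcongr
    exact hφ R hR
  have h2 : 0 ≤ 4 * M * exp (-(2 * (κ * R))) := by positivity
  have h3 : -(s * e R ^ 2 - s * e 0 ^ 2) ≤ M := by
    have a1 := hM R hR
    have a2 := hM 0 le_rfl
    rcases hs with rfl | rfl <;> nlinarith [sq_nonneg (e R), sq_nonneg (e 0)]
  simp only [mul_zero, neg_zero, exp_zero] at hmono
  linarith

theorem riccati_sup {κ P A Δ : ℝ} {e e' r φ : ℝ → ℝ} (hκ : 0 < κ) (hP : 0 < P)
    (hd : ∀ x, HasDerivAt e (e' x) x) (ce : Continuous e') (cφ : Continuous φ)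
    (heq : ∀ x, 0 ≤ x → e' x = -2 * (κ * tanh (κ * x)) * e x - r x * e x ^ 2 - φ x)
    (hr : ∀ x, 0 ≤ x → |r x| ≤ P) (hA : e 0 ^ 2 ≤ A)
    (hφ : ∀ R, 0 ≤ R → ∫ x in (0:ℝ)..R, φ x ^ 2 ≤ Δ)
    (hsmall : 16 * (A + Δ / κ) < (κ / (2 * P)) ^ 2) {x : ℝ} (hx : 0 ≤ x) :
    e x ^ 2 ≤ 16 * (A + Δ / κ) := by
  have c0 : Continuous e := continuous_iff_continuousAt.2 fun x => (hd x).continuousAt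
  have hΔ : 0 ≤ Δ := by simpa using hφ 0 le_rfl
  have hA0 : 0 ≤ A := (sq_nonneg _).trans hA
  have hη : 0 < κ / (2 * P) := by positivity
  have step : ∀ x, 0 ≤ x → (∀ y ∈ Icc 0 x, |e y| ≤ κ / (2 * P)) →
      e x ^ 2 ≤ 16 * (A + Δ / κ) := by
    intro x hx hb
    let b : ℝ → ℝ := fun y => cosh (κ * y) ^ 4 * exp (-(2 * (κ * y)))
    have cb : Continuous b := by fun_prop
    have ct := continuous_tanh
    have hb' : ∀ y, HasDerivAt b (b y * (4 * (κ * tanh (κ * y)) - 2 * κ)) y := fun y => by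
      have h1 : HasDerivAt (fun y => κ * y) (κ * 1) y := (hasDerivAt_id y).const_mul κ
      have := (h1.cosh.fun_pow 4).fun_mul (h1.const_mul 2).fun_neg.exp
      refine this.congr_deriv ?_
      have hc : cosh (κ * y) ≠ 0 := (cosh_pos _).ne'
      simp only [b, tanh_eq_sinh_div_cosh]
      field_simp
      ring
    have hF : ∀ y, HasDerivAt (fun y => b y * e y ^ 2)
        (b y * (4 * (κ * tanh (κ * y)) - 2 * κ) * e y ^ 2 + b y * (2 * (e y * e' y))) y :=
      fun y => ((hb' y).fun_mul ((hd y).fun_pow 2)).congr_deriv (by ring)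
    have cF : Continuous fun y =>
        b y * (4 * (κ * tanh (κ * y)) - 2 * κ) * e y ^ 2 + b y * (2 * (e y * e' y)) := by
      fun_prop
    have hI := intervalIntegral.integral_eq_sub_of_hasDerivAt (a := 0) (b := x)
      (fun y _ => hF y) (cF.intervalIntegrable _ _)
    have hb0 : ∀ y, 0 ≤ b y := fun y => by
      have := cosh_pos (κ * y)
      positivity
    have hble : ∀ y ∈ Icc 0 x, b y ≤ exp (2 * (κ * x)) := by
      intro y hy
      have h1 : cosh (κ * y) ≤ exp (κ * y) := by
        rw [cosh_eq]
        have : exp (-(κ * y)) ≤ exp (κ * y) := by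
          gcongr
          nlinarith [hy.1]
        linarith
      calc b y ≤ exp (κ * y) ^ 4 * exp (-(2 * (κ * y))) := by
            have := cosh_pos (κ * y)
            simp only [b]
            gcongr
        _ = exp (2 * (κ * y)) := by
            rw [← exp_nat_mul, ← exp_add]; congr 1; push_cast; ring
        _ ≤ _ := by gcongr; exact hy.2
    have hbx : exp (2 * (κ * x)) / 16 ≤ b x := by
      have h1 : exp (κ * x) / 2 ≤ cosh (κ * x) := by
        rw [cosh_eq]
        linarith [exp_pos (-(κ * x))]
      calc exp (2 * (κ * x)) / 16 = (exp (κ * x) / 2) ^ 4 * exp (-(2 * (κ * x))) := by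
            rw [div_pow, ← exp_nat_mul, div_mul_eq_mul_div, ← exp_add]
            norm_num
            ring
        _ ≤ _ := by
            simp only [b]
            gcongr
    have hmono := intervalIntegral.integral_mono_on (μ := volume) hx
      (g := fun y => exp (2 * (κ * x)) / κ * φ y ^ 2) (cF.intervalIntegrable _ _)
      (Continuous.intervalIntegrable (by fun_prop) _ _) (fun y hy => by
        have hre : |r y * e y| ≤ κ / 2 := by
          rw [abs_mul]
          calc |r y| * |e y| ≤ P * (κ / (2 * P)) :=
                mul_le_mul (hr y hy.1) (hb y hy) (abs_nonneg _) hP.le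
            _ = κ / 2 := by field_simp
        have h1 := energy_deriv_le (s := 1) hκ ((one_mul _).trans (heq y hy.1)) hre
        rw [one_mul] at h1
        have h2 := mul_le_mul_of_nonneg_left h1 (hb0 y)
        have h3 : b y * (φ y ^ 2 / κ) ≤ exp (2 * (κ * x)) * (φ y ^ 2 / κ) :=
          mul_le_mul_of_nonneg_right (hble y hy) (by positivity)
        calc _ ≤ b y * (φ y ^ 2 / κ) := by linarith
          _ ≤ _ := h3
          _ = _ := by ring)
    rw [hI, intervalIntegral.integral_const_mul] at hmono
    have hb00 : b 0 = 1 := by simp [b]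
    have hX := exp_pos (2 * (κ * x))
    have hX1 : 1 ≤ exp (2 * (κ * x)) := one_le_exp (by positivity)
    have h4 : exp (2 * (κ * x)) / κ * ∫ y in (0:ℝ)..x, φ y ^ 2 ≤ exp (2 * (κ * x)) * (Δ / κ) := by
      calc _ ≤ exp (2 * (κ * x)) / κ * Δ := by gcongr; exact hφ x hx
        _ = _ := by ring
    rw [hb00, one_mul] at hmono
    have h5 := mul_le_mul_of_nonneg_right hbx (sq_nonneg (e x))
    have h6 : A ≤ exp (2 * (κ * x)) * A := le_mul_of_one_le_left hA0 hX1
    have h7 : exp (2 * (κ * x)) * (e x ^ 2) ≤ exp (2 * (κ * x)) * (16 * (A + Δ / κ)) := by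
      linarith
    exact le_of_mul_le_mul_left h7 hX
  have hlt : ∀ z, e z ^ 2 ≤ 16 * (A + Δ / κ) → |e z| < κ / (2 * P) := fun z hz =>
    abs_lt_of_sq_lt_sq (hz.trans_lt hsmall) hη.le
  have hall : |e x| < κ / (2 * P) :=
    lt_of_bootstrap (f := fun x => |e x|) c0.abs (hlt 0 (step 0 le_rfl fun y hy => ?_))
      (fun z hz h => hlt z (step z hz h)) hx
  · refine step x hx fun y hy => (lt_of_bootstrap (f := fun x => |e x|) c0.abs ?_
      (fun z hz h => hlt z (step z hz h)) hy.1).le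
    exact hlt 0 (hA.trans (by have : 0 ≤ Δ / κ := by positivity
                              linarith))
  · obtain rfl : y = 0 := le_antisymm hy.2 hy.1
    exact (hlt 0 (hA.trans (by have : 0 ≤ Δ / κ := by positivity
                               linarith))).le

theorem riccati_line_energy {k0 κ s S δ : ℝ} {e e' r φ : ℝ → ℝ} (hk0 : 0 < k0) (hκ : k0 ≤ κ)
    (hs : s = 1 ∨ s = -1) (hd : ∀ x, HasDerivAt e (e' x) x) (ce : Continuous e')
    (heq : ∀ x, s * e' x = -2 * (κ * tanh (κ * x)) * e x - r x * e x ^ 2 - φ x)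
    (hr : ∀ x, |r x * e x| ≤ κ / 2) (he : ∀ x, |e x| ≤ S * δ) (hφ : L2le φ δ) :
    L2le e ((1 + (5 * S ^ 2 + 1 / k0) / k0) * δ) := by
  have hκ0 : 0 < κ := hk0.trans_le hκ
  have hδ := hφ.2.1
  have c0 : Continuous e := continuous_iff_continuousAt.2 fun x => (hd x).continuousAt
  have hM : ∀ x, e x ^ 2 ≤ S ^ 2 * δ ^ 2 := fun x => by
    rw [← mul_pow]; exact sq_le_sq' (abs_le.1 (he x)).1 (abs_le.1 (he x)).2
  set B := (5 * S ^ 2 + 1 / k0) / k0 with hB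
  have hB0 : 0 ≤ B := by positivity
  have fin : ∀ I : ℝ, 2 * κ * I ≤ 5 * (S ^ 2 * δ ^ 2) + δ ^ 2 / κ → 2 * I ≤ B * δ ^ 2 := by
    intro I hI
    have h1 : δ ^ 2 / κ ≤ δ ^ 2 / k0 := by gcongr
    rw [hB, div_mul_eq_mul_div, le_div_iff₀ hk0]
    have h2 : (5 * S ^ 2 + 1 / k0) * δ ^ 2 = 5 * (S ^ 2 * δ ^ 2) + δ ^ 2 / k0 := by ring
    rw [h2]
    rcases le_total 0 I with h | h
    · nlinarith
    · have : 0 ≤ 5 * (S ^ 2 * δ ^ 2) + δ ^ 2 / k0 := by positivity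
      nlinarith
  refine L2le.of_symm c0 (by positivity) fun R hR => ?_
  have h1 := riccati_energy hκ0 hs hd ce hφ.1 (fun x _ => heq x) (fun x _ => hr x)
    (fun x _ => hM x) (fun R hR => hφ.intervalIntegral_le hR) hR
  have h2 := riccati_energy (e := fun x => -e (-x)) (e' := fun x => e' (-x))
    (r := fun x => r (-x)) (φ := fun x => φ (-x)) (M := S ^ 2 * δ ^ 2) hκ0 hs (fun x =>
      ((hd (-x)).comp x (hasDerivAt_neg x)).fun_neg.congr_deriv (by simp))
    (by fun_prop) hφ.comp_neg.1
    (fun x _ => by rw [heq (-x), mul_neg κ x, tanh_neg]; ring)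
    (fun x _ => by rw [mul_neg, abs_neg]; exact hr (-x)) (fun x _ => by rw [neg_sq]; exact hM _)
    (fun R hR => hφ.comp_neg.intervalIntegral_le hR) hR
  have h3 : ∫ x in (0:ℝ)..R, (-e (-x)) ^ 2 = ∫ x in (-R)..0, e x ^ 2 := by
    have := intervalIntegral.integral_comp_neg (a := 0) (b := R) (fun x => e x ^ 2)
    simpa using this
  rw [h3] at h2
  have cc : Continuous fun x => e x ^ 2 := by fun_prop
  rw [← intervalIntegral.integral_add_adjacent_intervals (cc.intervalIntegrable (-R) 0)
    (cc.intervalIntegrable 0 R)]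
  have f1 := fin _ h1
  have f2 := fin _ h2
  have : B * δ ^ 2 ≤ ((1 + B) * δ) ^ 2 := by
    rw [mul_pow]
    gcongr
    nlinarith
  linarith

/-- The constant in the uniform bound for perturbed Riccati equations. -/
noncomputable def supConst (k0 : ℝ) : ℝ := 16 * (1 + 1 / k0)

/-- The constant in the energy bound for perturbed Riccati equations. -/
noncomputable def energyConst (k0 S : ℝ) : ℝ := 1 + (5 * S ^ 2 + 1 / k0) / k0

theorem supConst_pos {k0 : ℝ} (h : 0 < k0) : 0 < supConst k0 := by
  unfold supConst; positivity

theorem energyConst_pos {k0 : ℝ} (h : 0 < k0) (S : ℝ) : 0 < energyConst k0 S := by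
  unfold energyConst; positivity

theorem riccati_line {k0 κ P δ : ℝ} {e e' r φ : ℝ → ℝ} (hk0 : 0 < k0) (hκ : k0 ≤ κ)
    (hP : 0 < P) (hd : ∀ x, HasDerivAt e (e' x) x) (ce : Continuous e')
    (heq : ∀ x, e' x = -2 * (κ * tanh (κ * x)) * e x - r x * e x ^ 2 - φ x)
    (hr : ∀ x, |r x| ≤ P) (h0 : |e 0| ≤ δ) (hφ : L2le φ δ)
    (hsmall : supConst k0 * δ < k0 / (2 * P)) :
    (∀ x, |e x| ≤ supConst k0 * δ) ∧ L2le e (energyConst k0 (supConst k0) * δ) := by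
  have hκ0 : 0 < κ := hk0.trans_le hκ
  have hδ := hφ.2.1
  have hS := supConst_pos hk0
  have hS1 : 1 ≤ supConst k0 := by
    have : 0 < 1 / k0 := by positivity
    unfold supConst; linarith
  have h16 : 16 * (δ ^ 2 + δ ^ 2 / κ) ≤ (supConst k0 * δ) ^ 2 := by
    have h1 : δ ^ 2 / κ ≤ δ ^ 2 / k0 := by gcongr
    calc 16 * (δ ^ 2 + δ ^ 2 / κ) ≤ 16 * (δ ^ 2 + δ ^ 2 / k0) := by linarith
      _ = supConst k0 * δ ^ 2 := by unfold supConst; ring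
      _ ≤ (supConst k0 * δ) ^ 2 := by
        rw [mul_pow]
        gcongr
        nlinarith
  have hsm : 16 * (δ ^ 2 + δ ^ 2 / κ) < (κ / (2 * P)) ^ 2 := by
    refine h16.trans_lt (pow_lt_pow_left₀ (hsmall.trans_le ?_) (by positivity) two_ne_zero)
    gcongr
  have hA : ∀ {z : ℝ}, |z| ≤ δ → z ^ 2 ≤ δ ^ 2 := fun hz =>
    sq_le_sq' (abs_le.1 hz).1 (abs_le.1 hz).2
  have hpos : ∀ x, 0 ≤ x → |e x| ≤ supConst k0 * δ := fun x hx =>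
    abs_le_of_sq_le_sq ((riccati_sup hκ0 hP hd ce hφ.1 (fun x _ => heq x) (fun x _ => hr x)
      (hA h0) (fun R hR => hφ.intervalIntegral_le hR) hsm hx).trans h16) (by positivity)
  have hneg : ∀ x, 0 ≤ x → |-e (-x)| ≤ supConst k0 * δ := fun x hx =>
    abs_le_of_sq_le_sq ((riccati_sup (e := fun x => -e (-x)) (e' := fun x => e' (-x))
      (r := fun x => r (-x)) (φ := fun x => φ (-x)) hκ0 hP
      (fun x => ((hd (-x)).comp x (hasDerivAt_neg x)).fun_neg.congr_deriv (by simp))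
      (by fun_prop) hφ.comp_neg.1
      (fun x _ => by rw [heq (-x), mul_neg κ x, tanh_neg]; ring) (fun x _ => hr _)
      (by simpa using hA h0) (fun R hR => hφ.comp_neg.intervalIntegral_le hR) hsm hx).trans h16)
      (by positivity)
  have hsup : ∀ x, |e x| ≤ supConst k0 * δ := fun x => by
    rcases le_total 0 x with hx | hx
    · exact hpos x hx
    · simpa using hneg (-x) (by linarith)
  refine ⟨hsup, riccati_line_energy hk0 hκ (Or.inl rfl) hd ce
    (fun x => (one_mul _).trans (heq x)) (fun x => ?_) hsup hφ⟩
  rw [abs_mul]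
  calc |r x| * |e x| ≤ P * (k0 / (2 * P)) :=
        mul_le_mul (hr x) ((hsup x).trans hsmall.le) (abs_nonneg _) hP.le
    _ = k0 / 2 := by field_simp
    _ ≤ κ / 2 := by linarith

/-- A solution of the Riccati equation whose potential is close to a sum of solitons is close to
the kink, and the transformed potential is close to a sum with one more soliton. -/
theorem adding_soliton (n : ℕ) {k0 d K : ℝ} (hk0 : 0 < k0) (hdp : 0 < d) (hK : 0 < K) :
    ∃ δ1 C, 0 < δ1 ∧ 0 < C ∧ ∀ (κ X ℓ δ : ℝ) (k a : Fin n → ℝ) (h w : ℝ → ℝ),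
      WaveParams k0 d K κ k → Separated ℓ X a → δ + exp (-(k0 * ℓ)) ≤ δ1 → Continuous w →
      (∀ x, HasDerivAt h (κ ^ 2 - h x ^ 2 - w x) x) → h X = 0 →
      L2le (fun x => w x - ∑ j, sol (k j) (x - a j - phase κ (k j))) δ →
      (∀ x, |h x - kink κ X k a x| ≤ C * (δ + exp (-(k0 * ℓ)))) ∧
      L2le (fun x => 2 * κ ^ 2 - 2 * h x ^ 2 - w x -
        (sol κ (x - X) + ∑ j, sol (k j) (x - a j))) (C * (δ + exp (-(k0 * ℓ)))) := by
  obtain ⟨CI, hCI, hI⟩ := l2le_interaction n hk0 hdp hK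
  set m := d ^ n with hm
  set P := ((2 * K) ^ n) ^ 2 with hP
  have hm0 : 0 < m := by positivity
  have hP0 : 0 < P := by positivity
  set G := n * (K ^ 2 / d * 2) with hG
  have hG0 : 0 ≤ G := by positivity
  set C1 := (1 / m ^ 2) * (1 + CI + G) with hC1
  have hC10 : 0 < C1 := by positivity
  set A := supConst k0 with hA
  set B := energyConst k0 A with hB
  have hA0 : 0 < A := supConst_pos hk0
  have hB0 : 0 < B := energyConst_pos hk0 A
  set Hb := K + n * (K ^ 2 / d) with hHb
  have hHb0 : 0 < Hb := by positivity
  refine ⟨k0 / (4 * P * A * C1), P * A * C1 + ((k0 + 4 * Hb) * (P * (B * C1)) + (1 + 2 * CI)),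
    by positivity, by positivity, fun κ X ℓ δ k a h w hp hs hδ1 cw hd hX hw => ?_⟩
  set E := exp (-(k0 * ℓ)) with hE
  have hE0 : 0 < E := exp_pos _
  have hδ := hw.2.1
  have hI := hI κ X ℓ k a hp hs
  have hκ := hp.top_pos
  have ch : Continuous h := continuous_iff_continuousAt.2 fun x => (hd x).continuousAt
  have cH := hp.continuous_kink X a
  have cG := hp.continuous_gsum a
  have ct := continuous_tanh
  have cΘ : Continuous (thetaProd κ k a) :=
    continuous_iff_continuousAt.2 fun x => (hp.hasDerivAt_thetaProd a x).continuousAt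
  have hΘm : ∀ x, m ≤ thetaProd κ k a x := fun x => (hp.thetaProd_bounds a x).1
  have hΘ0 : ∀ x, 0 < thetaProd κ k a x := fun x => hm0.trans_le (hΘm x)
  have hΘP : ∀ x, thetaProd κ k a x ^ 2 ≤ P := fun x =>
    pow_le_pow_left₀ (hΘ0 x).le (hp.thetaProd_bounds a x).2 2
  have hinv : ∀ x, 1 / thetaProd κ k a x ^ 2 ≤ 1 / m ^ 2 := fun x =>
    one_div_le_one_div_of_le (by positivity) (pow_le_pow_left₀ hm0.le (hΘm x) 2)
  let F : ℝ → ℝ := fun x =>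
    (w x - ∑ j, sol (k j) (x - a j - phase κ (k j))) - interaction κ X k a x
  have hF : L2le F (δ + CI * E) := hw.sub hI
  have cF := hF.1
  let φ : ℝ → ℝ := fun x => F x / thetaProd κ k a x ^ 2
  have cφ : Continuous φ := cF.div (cΘ.pow 2) fun x => (pow_pos (hΘ0 x) 2).ne'
  have hφ : L2le φ (C1 * (δ + E)) := by
    refine (hF.of_abs_le cφ (C := 1 / m ^ 2) (by positivity) fun x => ?_).mono ?_
    · simp only [φ]
      rw [abs_div, abs_of_pos (pow_pos (hΘ0 x) 2), div_eq_mul_one_div, mul_comm]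
      exact mul_le_mul_of_nonneg_right (hinv x) (abs_nonneg _)
    · rw [hC1, mul_assoc]
      refine mul_le_mul_of_nonneg_left ?_ (by positivity)
      nlinarith [mul_nonneg hCI.le hδ, mul_nonneg hG0 hδ, mul_nonneg hG0 hE0.le]
  let ε : ℝ → ℝ := fun x => (h x - kink κ X k a x) / thetaProd κ k a x ^ 2
  let ε' : ℝ → ℝ := fun x => -2 * (κ * tanh (κ * (x - X))) * ε x -
    thetaProd κ k a x ^ 2 * ε x ^ 2 - φ x
  have hε : ∀ x, HasDerivAt ε (ε' x) x := by
    intro x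
    have := ((hd x).fun_sub (hp.hasDerivAt_kink X a x)).fun_div
      ((hp.hasDerivAt_thetaProd a x).fun_pow 2) (pow_pos (hΘ0 x) 2).ne'
    refine this.congr_deriv ?_
    have h1 := (hΘ0 x).ne'
    have hk : kink κ X k a x = κ * tanh (κ * (x - X)) + gsum κ k a x := rfl
    simp only [ε', ε, φ, F]
    generalize kink κ X k a x = H at hk
    generalize thetaProd κ k a x = Θ at h1
    generalize (∑ j, sol (k j) (x - a j - phase κ (k j))) = Sg
    subst hk
    field_simp
    ring
  have cε : Continuous ε := continuous_iff_continuousAt.2 fun x => (hε x).continuousAt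
  have cε' : Continuous ε' := by fun_prop
  have hsm : A * (C1 * (δ + E)) ≤ k0 / (4 * P) := by
    rw [le_div_iff₀ (by positivity)] at hδ1 ⊢
    linarith
  have hsm' : A * (C1 * (δ + E)) < k0 / (2 * P) := by
    refine hsm.trans_lt ?_
    gcongr
    norm_num
  have key := riccati_line (e := fun x => ε (x + X)) (e' := fun x => ε' (x + X))
    (r := fun x => thetaProd κ k a (x + X) ^ 2) (φ := fun x => φ (x + X)) (P := P) hk0
    hp.k0_le_top hP0 (fun x => (hε (x + X)).comp_add_const x X)
    (by fun_prop) (fun x => by simp only [ε', add_sub_cancel_right])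
    (fun x => by rw [abs_of_nonneg (sq_nonneg _)]; exact hΘP _)
    (by
      have hg := hp.gsum_nonneg a X
      have hg2 := hp.gsum_le_exp hs (m := 0) (x := X) (by simp)
      simp only [ε, zero_add, hX, kink, sub_self, mul_zero, tanh_zero, zero_sub]
      rw [abs_div, abs_neg, abs_of_nonneg hg, abs_of_pos (pow_pos (hΘ0 X) 2),
        div_eq_mul_one_div, mul_comm, hC1, mul_assoc]
      refine mul_le_mul (hinv X) ?_ hg (by positivity)
      refine hg2.trans ?_
      rw [sub_zero, ← hE]
      have : (n:ℝ) * (K ^ 2 / d * (2 * E)) = G * E := by rw [hG]; ring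
      rw [this]
      nlinarith [mul_nonneg hCI.le hδ, mul_nonneg hG0 hδ, mul_nonneg hCI.le hE0.le])
    (by simpa using hφ.comp_sub (-X)) hsm'
  obtain ⟨k1, k2⟩ := key
  have he : ∀ x, h x - kink κ X k a x = thetaProd κ k a x ^ 2 * ε x := fun x => by
    simp only [ε]
    have := (hΘ0 x).ne'
    field_simp
  have hsup : ∀ x, |h x - kink κ X k a x| ≤ P * (A * (C1 * (δ + E))) := fun x => by
    rw [he, abs_mul, abs_of_pos (pow_pos (hΘ0 x) 2)]
    have := k1 (x - X)
    rw [sub_add_cancel] at this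
    exact mul_le_mul (hΘP x) this (abs_nonneg _) hP0.le
  have hL : L2le (fun x => h x - kink κ X k a x) (P * (B * (C1 * (δ + E)))) := by
    have h2 : L2le ε (B * (C1 * (δ + E))) := by simpa using k2.comp_sub X
    refine h2.of_abs_le (g := fun x => h x - kink κ X k a x) (by fun_prop) hP0.le fun x => ?_
    rw [he, abs_mul, abs_of_pos (pow_pos (hΘ0 x) 2)]
    exact mul_le_mul_of_nonneg_right (hΘP x) (abs_nonneg _)
  have hsum : ∀ x, |2 * (h x + kink κ X k a x)| ≤ k0 + 4 * Hb := by
    intro x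
    have h1 := hp.abs_kink_le X a x
    have h2 := hsup x
    have h3 : P * (A * (C1 * (δ + E))) ≤ k0 / 4 := by
      calc _ ≤ P * (k0 / (4 * P)) := by gcongr
        _ = k0 / 4 := by field_simp
    rw [abs_le] at h1 h2 ⊢
    constructor <;> linarith [h1.1, h1.2, h2.1, h2.2]
  constructor
  · intro x
    refine (hsup x).trans ?_
    have : 0 ≤ ((k0 + 4 * Hb) * (P * (B * C1)) + (1 + 2 * CI)) * (δ + E) := by positivity
    linarith
  · have h1 := hL.of_abs_le
      (g := fun x => -(2 * (h x + kink κ X k a x)) * (h x - kink κ X k a x))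
      (C := k0 + 4 * Hb) (by fun_prop) (by positivity) (fun x => by
        rw [abs_mul, abs_neg]
        exact mul_le_mul_of_nonneg_right (hsum x) (abs_nonneg _))
    have h2 := (h1.sub hw).add (hI.add hI)
    have e : (fun x => 2 * κ ^ 2 - 2 * h x ^ 2 - w x -
        (sol κ (x - X) + ∑ j, sol (k j) (x - a j))) = fun x =>
        -(2 * (h x + kink κ X k a x)) * (h x - kink κ X k a x) -
        (w x - ∑ j, sol (k j) (x - a j - phase κ (k j))) +
        (interaction κ X k a x + interaction κ X k a x) := by
      funext x
      have := hp.sol_add_sum_sol X a x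
      linear_combination (-1 : ℝ) * this
    rw [e]
    refine h2.mono ?_
    have : 0 ≤ P * A * C1 * (δ + E) := by positivity
    nlinarith [mul_nonneg hCI.le hδ]

/-- A continuous function dominated by a constant plus an `L²` function. -/
def MixedLe (N : ℝ → ℝ) (β δ : ℝ) : Prop :=
  Continuous N ∧ 0 ≤ β ∧ 0 < δ ∧ ∃ g, L2le g δ ∧ ∀ x, |N x| ≤ β + |g x|

/-- The weight `1 / cosh² (κ y)`. -/
noncomputable def sechSq (κ y : ℝ) : ℝ := 1 / cosh (κ * y) ^ 2

theorem sechSq_pos (κ y : ℝ) : 0 < sechSq κ y := by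
  have := cosh_pos (κ * y)
  unfold sechSq; positivity

theorem sechSq_le_one (κ y : ℝ) : sechSq κ y ≤ 1 := by
  unfold sechSq
  rw [div_le_one (pow_pos (cosh_pos _) 2)]
  exact one_le_pow₀ (one_le_cosh _)

theorem sechSq_neg (κ y : ℝ) : sechSq κ (-y) = sechSq κ y := by
  unfold sechSq; rw [mul_neg, cosh_neg]

theorem continuous_sechSq (κ : ℝ) : Continuous (sechSq κ) :=
  continuous_const.div (by fun_prop) fun _ => pow_ne_zero 2 (cosh_pos _).ne'

theorem integrable_sechSq {κ : ℝ} (hκ : 0 < κ) : Integrable (sechSq κ) := by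
  have := (l2le_inv_cosh hκ).2.2.1
  have e : sechSq κ = fun x => (1 / cosh (κ * x)) ^ 2 := by
    funext x; unfold sechSq; rw [div_pow, one_pow]
  rwa [e]

theorem le_integral_sechSq {κ : ℝ} (hκ : 0 < κ) : 1 / (2 * κ) ≤ ∫ y, sechSq κ y := by
  have h2 : -(2 * κ) < 0 := by linarith
  have h1 : ∫ y in Ioi (0:ℝ), exp (-(2 * κ) * y) = 1 / (2 * κ) := by
    rw [integral_exp_mul_Ioi h2]
    simp
  rw [← h1]
  refine le_trans (setIntegral_mono_on (integrableOn_exp_mul_Ioi h2 0)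
    (integrable_sechSq hκ).integrableOn measurableSet_Ioi fun y hy => ?_)
    (setIntegral_le_integral (integrable_sechSq hκ) (ae_of_all _ fun y => (sechSq_pos κ y).le))
  have hy : (0:ℝ) < y := hy
  have := exp_neg_abs_le_inv_cosh (κ * y)
  rw [abs_of_pos (by positivity)] at this
  calc exp (-(2 * κ) * y) = exp (-(κ * y)) ^ 2 := by rw [← exp_nat_mul]; push_cast; ring_nf
    _ ≤ (1 / cosh (κ * y)) ^ 2 := pow_le_pow_left₀ (exp_pos _).le this 2
    _ = sechSq κ y := by unfold sechSq; rw [div_pow, one_pow]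

theorem abs_le_half_add {z δ : ℝ} (hδ : 0 < δ) : |z| ≤ δ / 2 + z ^ 2 / (2 * δ) := by
  have : δ / 2 + z ^ 2 / (2 * δ) = (δ ^ 2 + z ^ 2) / (2 * δ) := by field_simp
  rw [this, le_div_iff₀ (by positivity), ← sq_abs z]
  nlinarith [sq_nonneg (δ - |z|)]

namespace MixedLe

variable {N : ℝ → ℝ} {β δ : ℝ}

theorem mul_le (hN : MixedLe N β δ) : ∃ g, Integrable g ∧ (∀ x, 0 ≤ g x) ∧ ∫ x, g x ≤ δ / 2 ∧
    ∀ r x, 0 ≤ r → r ≤ 1 → r * |N x| ≤ r * (β + δ / 2) + g x := by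
  obtain ⟨cN, hβ, hδ, g, hg, h⟩ := hN
  refine ⟨fun x => g x ^ 2 / (2 * δ), hg.2.2.1.div_const _, fun x => by positivity, ?_,
    fun r x h0 h1 => ?_⟩
  · rw [integral_div, div_le_iff₀ (by positivity)]
    calc _ ≤ δ ^ 2 := hg.2.2.2
      _ = _ := by ring
  · have h2 := abs_le_half_add (z := g x) hδ
    have h3 : r * |N x| ≤ r * (β + |g x|) := mul_le_mul_of_nonneg_left (h x) h0
    have h4 : r * |g x| ≤ r * (δ / 2 + g x ^ 2 / (2 * δ)) := mul_le_mul_of_nonneg_left h2 h0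
    have h5 : r * (g x ^ 2 / (2 * δ)) ≤ 1 * (g x ^ 2 / (2 * δ)) :=
      mul_le_mul_of_nonneg_right h1 (by positivity)
    nlinarith

theorem comp_neg (hN : MixedLe N β δ) : MixedLe (fun x => N (-x)) β δ := by
  obtain ⟨cN, hβ, hδ, g, hg, h⟩ := hN
  exact ⟨cN.comp continuous_neg, hβ, hδ, _, hg.comp_neg, fun x => h (-x)⟩

theorem sub_of_bounded (hN : MixedLe N β δ) {b : ℝ → ℝ} {B : ℝ} (cb : Continuous b)
    (hb : ∀ x, |b x| ≤ B) : MixedLe (fun x => N x - b x) (β + B) δ := by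
  obtain ⟨cN, hβ, hδ, g, hg, h⟩ := hN
  refine ⟨cN.sub cb, add_nonneg hβ ((abs_nonneg _).trans (hb 0)), hδ, g, hg, fun x => ?_⟩
  linarith [abs_sub (N x) (b x), h x, hb x]

theorem of_bounded {b : ℝ → ℝ} {B : ℝ} (cb : Continuous b) (hb : ∀ x, |b x| ≤ B) (hδ : 0 < δ) :
    MixedLe b B δ := by
  refine ⟨cb, (abs_nonneg _).trans (hb 0), hδ, fun _ => 0,
    ⟨continuous_const, hδ.le, by simp, by simp; positivity⟩, fun x => by simpa using hb x⟩

theorem integrable_mul (hN : MixedLe N β δ) {κ : ℝ} (hκ : 0 < κ) :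
    Integrable fun y => sechSq κ y * N y := by
  obtain ⟨g, hg, -, -, h⟩ := hN.mul_le
  refine (((integrable_sechSq hκ).mul_const (β + δ / 2)).add hg).mono'
    ((continuous_sechSq κ).mul hN.1).aestronglyMeasurable (ae_of_all _ fun y => ?_)
  rw [norm_eq_abs, abs_mul, abs_of_pos (sechSq_pos κ y)]
  exact h _ y (sechSq_pos κ y).le (sechSq_le_one κ y)

theorem abs_integral_le (hN : MixedLe N β δ) {κ : ℝ} (hκ : 0 < κ) :
    |∫ y, sechSq κ y * N y| ≤ (∫ y, sechSq κ y) * (β + δ / 2) + δ / 2 := by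
  obtain ⟨g, hg, -, hgi, h⟩ := hN.mul_le
  have hi := ((integrable_sechSq hκ).mul_const (β + δ / 2))
  have := norm_integral_le_of_norm_le (f := fun y => sechSq κ y * N y) (hi.add hg)
    (ae_of_all _ fun y => by
      rw [norm_eq_abs, abs_mul, abs_of_pos (sechSq_pos κ y)]
      exact h _ y (sechSq_pos κ y).le (sechSq_le_one κ y))
  rw [norm_eq_abs] at this
  simp only [Pi.add_apply] at this
  rw [integral_add hi hg, integral_mul_const] at this
  linarith

end MixedLe

/-- The bounded solution of `Λ' = 2 κ tanh (κ x) Λ + N`, when `N` is orthogonal to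
`1 / cosh² (κ x)`. -/
noncomputable def growthOp (κ : ℝ) (N : ℝ → ℝ) (x : ℝ) : ℝ :=
  -(cosh (κ * x) ^ 2 * ∫ y in Ioi x, sechSq κ y * N y)

theorem hasDerivAt_growthOp {κ β δ : ℝ} {N : ℝ → ℝ} (hκ : 0 < κ) (hN : MixedLe N β δ) (x : ℝ) :
    HasDerivAt (growthOp κ N) (2 * (κ * tanh (κ * x)) * growthOp κ N x + N x) x := by
  have hi := hN.integrable_mul hκ
  have cF : Continuous fun y => sechSq κ y * N y := (continuous_sechSq κ).mul hN.1
  have e : (fun x => ∫ y in Ioi x, sechSq κ y * N y) =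
      fun x => (∫ y in Ioi 0, sechSq κ y * N y) - ∫ y in (0:ℝ)..x, sechSq κ y * N y := by
    funext z
    rw [← intervalIntegral.integral_interval_add_Ioi (a := 0) (b := z) hi.integrableOn
      hi.integrableOn]
    ring
  have h1 : HasDerivAt (fun x => ∫ y in Ioi x, sechSq κ y * N y) (-(sechSq κ x * N x)) x := by
    rw [e]
    exact ((intervalIntegral.integral_hasDerivAt_right (cF.intervalIntegrable _ _)
      (cF.stronglyMeasurableAtFilter _ _) cF.continuousAt).const_sub _)
  have h2 : HasDerivAt (fun x => cosh (κ * x) ^ 2) (2 * cosh (κ * x) * (sinh (κ * x) * κ)) x := by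
    have := ((hasDerivAt_cosh (κ * x)).comp x ((hasDerivAt_id x).const_mul κ)).fun_pow 2
    exact this.congr_deriv (by simp)
  refine (h2.fun_mul h1).fun_neg.congr_deriv ?_
  have hc := (cosh_pos (κ * x)).ne'
  unfold growthOp sechSq
  rw [tanh_eq_sinh_div_cosh]
  field_simp
  ring

theorem growthOp_neg {κ β δ : ℝ} {N : ℝ → ℝ} (hκ : 0 < κ) (hN : MixedLe N β δ)
    (h0 : ∫ y, sechSq κ y * N y = 0) (x : ℝ) :
    growthOp κ N (-x) = -growthOp κ (fun y => N (-y)) x := by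
  have h1 : ∫ y in Ioi x, sechSq κ y * N (-y) = ∫ y in Iic (-x), sechSq κ y * N y := by
    rw [← integral_comp_neg_Ioi]
    simp only [sechSq_neg]
  have hi := hN.integrable_mul hκ
  have h2 := intervalIntegral.integral_Iic_add_Ioi (b := -x) hi.integrableOn hi.integrableOn
  rw [h0] at h2
  unfold growthOp
  rw [h1, mul_neg, cosh_neg]
  linear_combination (-(cosh (κ * x)) ^ 2) * h2

theorem abs_growthOp_le {k0 κ β δ : ℝ} {N : ℝ → ℝ} (hk0 : 0 < k0) (hκ : k0 ≤ κ)
    (hN : MixedLe N β δ) (h0 : ∫ y, sechSq κ y * N y = 0) (x : ℝ) :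
    |growthOp κ N x| ≤ (2 / k0 + 1) * (β + δ) := by
  have hκ0 := hk0.trans_le hκ
  have half : ∀ {N : ℝ → ℝ}, MixedLe N β δ → ∀ x, 0 ≤ x →
      |growthOp κ N x| ≤ (2 / k0 + 1) * (β + δ) := by
    intro N hN x hx
    have hβ := hN.2.1
    have hδ := hN.2.2.1
    obtain ⟨g, hg, hg0, hgi, h⟩ := hN.mul_le
    have h2 : -(2 * κ) < 0 := by linarith
    have hei := integrableOn_exp_mul_Ioi h2 x
    have hD : IntegrableOn (fun y => 4 * exp (2 * κ * x) * (β + δ / 2) * exp (-(2 * κ) * y) + g y)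
        (Ioi x) := (hei.const_mul _).add hg.integrableOn
    have key := norm_integral_le_of_norm_le (μ := volume.restrict (Ioi x))
      (f := fun y => cosh (κ * x) ^ 2 * (sechSq κ y * N y)) hD
      ((ae_restrict_iff' measurableSet_Ioi).2 (ae_of_all _ fun y hy => by
        have hy : x < y := hy
        have hcy := cosh_pos (κ * y)
        have hr1 : cosh (κ * x) ^ 2 * sechSq κ y ≤ 1 := by
          unfold sechSq
          rw [mul_one_div, div_le_one (pow_pos hcy 2)]
          refine pow_le_pow_left₀ (cosh_pos _).le (cosh_le_cosh.2 ?_) 2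
          rw [abs_of_nonneg (by positivity), abs_of_nonneg (by nlinarith)]
          nlinarith
        have hr2 : cosh (κ * x) ^ 2 * sechSq κ y ≤ 4 * exp (2 * κ * x) * exp (-(2 * κ) * y) := by
          have a1 : cosh (κ * x) ≤ exp (κ * x) := by
            rw [cosh_eq]
            have : exp (-(κ * x)) ≤ exp (κ * x) := exp_le_exp.2 (by nlinarith [mul_nonneg hκ0.le hx])
            linarith
          have a2 := inv_cosh_le_two_exp (κ * y)
          rw [abs_of_nonneg (by nlinarith)] at a2
          have a3 : sechSq κ y = (1 / cosh (κ * y)) ^ 2 := by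
            unfold sechSq; rw [div_pow, one_pow]
          calc _ ≤ exp (κ * x) ^ 2 * (2 * exp (-(κ * y))) ^ 2 := by
                rw [a3]
                exact mul_le_mul (pow_le_pow_left₀ (cosh_pos _).le a1 2)
                  (pow_le_pow_left₀ (by positivity) a2 2) (by positivity) (by positivity)
            _ = _ := by
                rw [mul_pow, ← exp_nat_mul, ← exp_nat_mul]; push_cast; ring_nf
        have hr0 : 0 ≤ cosh (κ * x) ^ 2 * sechSq κ y :=
          mul_nonneg (sq_nonneg _) (sechSq_pos κ y).le
        have := h _ y hr0 hr1
        rw [← mul_assoc, norm_eq_abs, abs_mul, abs_of_nonneg hr0]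
        have h3 := mul_le_mul_of_nonneg_right hr2 (add_nonneg hβ (half_pos hδ).le)
        linarith))
    rw [integral_const_mul, integral_add (hei.const_mul _) hg.integrableOn, integral_const_mul,
      integral_exp_mul_Ioi h2, norm_eq_abs] at key
    have h4 : ∫ y in Ioi x, g y ≤ δ / 2 :=
      (setIntegral_le_integral hg (ae_of_all _ hg0)).trans hgi
    have h5 : 4 * exp (2 * κ * x) * (β + δ / 2) * (-exp (-(2 * κ) * x) / -(2 * κ)) =
        2 / κ * (β + δ / 2) := by
      have : exp (-(2 * κ) * x) * exp (2 * κ * x) = 1 := by rw [← exp_add]; simp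
      rw [neg_div_neg_eq]
      have hk := hκ0.ne'
      have h8 : 4 * exp (2 * κ * x) * (β + δ / 2) * (exp (-(2 * κ) * x) / (2 * κ)) =
          exp (-(2 * κ) * x) * exp (2 * κ * x) * (2 / κ * (β + δ / 2)) := by
        generalize exp (-(2 * κ) * x) = e1
        field_simp
        ring
      rw [h8, this, one_mul]
    rw [h5] at key
    have h6 : 2 / κ ≤ 2 / k0 := by gcongr
    have h7 : 2 / κ * (β + δ / 2) ≤ 2 / k0 * (β + δ) := by
      apply mul_le_mul h6 _ (by positivity) (by positivity)
      linarith
    unfold growthOp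
    rw [abs_neg]
    refine key.trans ?_
    rw [add_mul, one_mul]
    linarith
  rcases le_total 0 x with hx | hx
  · exact half hN x hx
  · have h1 := growthOp_neg hκ0 hN h0 (-x)
    rw [neg_neg] at h1
    rw [h1, abs_neg]
    exact half hN.comp_neg (-x) (by linarith)

/-- The multiple of `b` that has to be subtracted from `N` to make it orthogonal to the weight. -/
noncomputable def growthMean (κ : ℝ) (b N : ℝ → ℝ) : ℝ :=
  (∫ y, sechSq κ y * N y) / ∫ y, sechSq κ y * b y

theorem abs_growthMean_le {κ K m B β δ : ℝ} {b N : ℝ → ℝ} (hκ : 0 < κ) (hK : κ ≤ K) (hm : 0 < m)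
    (cb : Continuous b) (hb : ∀ x, m ≤ b x) (hB : ∀ x, b x ≤ B) (hN : MixedLe N β δ) :
    |growthMean κ b N| ≤ (1 + K) / m * (β + δ) ∧ 0 < ∫ y, sechSq κ y * b y := by
  have hβ := hN.2.1
  have hδ := hN.2.2.1
  have hI := le_integral_sechSq hκ
  have hbm : MixedLe b B δ := MixedLe.of_bounded cb (fun x => by
    rw [abs_of_nonneg (hm.le.trans (hb x))]; exact hB x) hδ
  set I := ∫ y, sechSq κ y with hIdef
  have hI0 : 0 < I := lt_of_lt_of_le (by positivity) hI
  have h1 : I * m ≤ ∫ y, sechSq κ y * b y := by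
    rw [hIdef, ← integral_mul_const]
    exact integral_mono ((integrable_sechSq hκ).mul_const m) (hbm.integrable_mul hκ) fun y =>
      mul_le_mul_of_nonneg_left (hb y) (sechSq_pos κ y).le
  have h0 : 0 < ∫ y, sechSq κ y * b y := lt_of_lt_of_le (by positivity) h1
  refine ⟨?_, h0⟩
  unfold growthMean
  rw [abs_div, abs_of_pos h0]
  have h2 := hN.abs_integral_le hκ
  rw [← hIdef] at h2
  have h3 : 1 ≤ 2 * K * I := by
    have : 1 / (2 * K) ≤ I := le_trans (by gcongr) hI
    rw [div_le_iff₀ (by linarith)] at this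
    linarith
  calc _ ≤ (I * (β + δ / 2) + δ / 2) / (I * m) := by gcongr
    _ ≤ (1 + K) / m * (β + δ) := by
      rw [div_mul_eq_mul_div, div_le_div_iff₀ (by positivity) hm]
      have hK0 : 0 < K := hκ.trans_le hK
      have : I * (β + δ / 2) + δ / 2 ≤ (1 + K) * (β + δ) * I := by
        nlinarith [mul_nonneg (mul_nonneg hK0.le hI0.le) hβ, mul_pos hI0 hδ,
          mul_le_mul_of_nonneg_left h3 hδ.le]
      nlinarith

/-- `growthOp` applied to the part of `N` that is orthogonal to the weight. -/
noncomputable def corrOp (κ : ℝ) (b N : ℝ → ℝ) : ℝ → ℝ :=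
  growthOp κ fun x => N x - growthMean κ b N * b x

/-- The constant in the bound for `corrOp`. -/
noncomputable def corrConst (k0 K m B : ℝ) : ℝ := (2 / k0 + 1) * (1 + B * ((1 + K) / m))

section corrOp

variable {k0 κ K m B β δ : ℝ} {b N : ℝ → ℝ}

theorem MixedLe.corr (hN : MixedLe N β δ) (hm : 0 < m) (cb : Continuous b) (hb : ∀ x, m ≤ b x)
    (hB : ∀ x, b x ≤ B) (μ : ℝ) : MixedLe (fun x => N x - μ * b x) (β + |μ| * B) δ :=
  hN.sub_of_bounded (cb.const_mul μ) fun x => by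
    rw [abs_mul, abs_of_pos (hm.trans_le (hb x))]
    exact mul_le_mul_of_nonneg_left (hB x) (abs_nonneg _)

theorem hasDerivAt_corrOp (hκ : 0 < κ) (hm : 0 < m) (cb : Continuous b)
    (hb : ∀ x, m ≤ b x) (hB : ∀ x, b x ≤ B) (hN : MixedLe N β δ) (x : ℝ) :
    HasDerivAt (corrOp κ b N)
      (2 * (κ * tanh (κ * x)) * corrOp κ b N x + (N x - growthMean κ b N * b x)) x :=
  hasDerivAt_growthOp hκ (hN.corr hm cb hb hB _) x

theorem abs_corrOp_le (hk0 : 0 < k0) (hκ : k0 ≤ κ) (hK : κ ≤ K) (hm : 0 < m)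
    (cb : Continuous b) (hb : ∀ x, m ≤ b x) (hB : ∀ x, b x ≤ B) (hN : MixedLe N β δ) (x : ℝ) :
    |corrOp κ b N x| ≤ corrConst k0 K m B * (β + δ) := by
  have hκ0 := hk0.trans_le hκ
  have hβ := hN.2.1
  have hδ := hN.2.2.1
  obtain ⟨h1, h2⟩ := abs_growthMean_le hκ0 hK hm cb hb hB hN
  have hB0 : 0 < B := (hm.trans_le (hb 0)).trans_le (hB 0)
  have hbm : MixedLe b B δ := MixedLe.of_bounded cb (fun x => by
    rw [abs_of_nonneg (hm.le.trans (hb x))]; exact hB x) hδ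
  have h0 : ∫ y, sechSq κ y * (N y - growthMean κ b N * b y) = 0 := by
    have e : (fun y => sechSq κ y * (N y - growthMean κ b N * b y)) =
        fun y => sechSq κ y * N y - growthMean κ b N * (sechSq κ y * b y) := by
      funext y; ring
    rw [e, integral_sub (hN.integrable_mul hκ0) ((hbm.integrable_mul hκ0).const_mul _),
      integral_const_mul]
    unfold growthMean
    rw [div_mul_cancel₀ _ h2.ne', sub_self]
  refine (abs_growthOp_le hk0 hκ (hN.corr hm cb hb hB _) h0 x).trans ?_
  unfold corrConst
  rw [mul_assoc]
  refine mul_le_mul_of_nonneg_left ?_ (by positivity)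
  have := mul_le_mul_of_nonneg_right h1 hB0.le
  linarith

theorem corrOp_sub {N' : ℝ → ℝ} {β' δ' : ℝ} (hκ : 0 < κ) (hm : 0 < m)
    (cb : Continuous b) (hb : ∀ x, m ≤ b x) (hB : ∀ x, b x ≤ B) (hN : MixedLe N β δ)
    (hN' : MixedLe N' β' δ') (x : ℝ) :
    corrOp κ b N x - corrOp κ b N' x = corrOp κ b (fun y => N y - N' y) x := by
  have i1 := hN.integrable_mul hκ
  have i2 := hN'.integrable_mul hκ
  have e1 : growthMean κ b (fun y => N y - N' y) = growthMean κ b N - growthMean κ b N' := by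
    unfold growthMean
    simp only [mul_sub]
    rw [integral_sub i1 i2, sub_div]
  unfold corrOp
  rw [e1]
  generalize hp : growthMean κ b N = p
  generalize hp' : growthMean κ b N' = p'
  have j1 := (hN.corr hm cb hb hB p).integrable_mul hκ
  have j2 := (hN'.corr hm cb hb hB p').integrable_mul hκ
  unfold growthOp
  have e : (fun y => sechSq κ y * (N y - N' y - (p - p') * b y)) =
      fun y => sechSq κ y * (N y - p * b y) - sechSq κ y * (N' y - p' * b y) := by
    funext y; ring
  rw [e, integral_sub j1.integrableOn j2.integrableOn]
  ring

end corrOp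

theorem corrConst_pos {k0 K m B : ℝ} (h0 : 0 < k0) (hK : 0 < K) (hm : 0 < m) (hB : 0 < B) :
    0 < corrConst k0 K m B := by
  unfold corrConst; positivity

/-- Truncation to `[-ρ, ρ]`. -/
noncomputable def clampTo (ρ z : ℝ) : ℝ := max (-ρ) (min z ρ)

theorem continuous_clampTo (ρ : ℝ) : Continuous (clampTo ρ) := by
  unfold clampTo; fun_prop

theorem abs_clampTo_le {ρ : ℝ} (hρ : 0 ≤ ρ) (z : ℝ) : |clampTo ρ z| ≤ ρ := by
  unfold clampTo
  exact abs_le.2 ⟨le_max_left _ _, max_le (by linarith) (min_le_right _ _)⟩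

theorem clampTo_of_abs_le {ρ z : ℝ} (h : |z| ≤ ρ) : clampTo ρ z = z := by
  unfold clampTo
  rw [abs_le] at h
  rw [min_eq_left h.2, max_eq_right h.1]

theorem abs_clampTo_sub_le (ρ y z : ℝ) : |clampTo ρ y - clampTo ρ z| ≤ |y - z| := by
  unfold clampTo
  calc _ ≤ |min y ρ - min z ρ| := by
        have := abs_max_sub_max_le_max (-ρ) (min y ρ) (-ρ) (min z ρ)
        simpa using this
    _ ≤ |y - z| := by
        have := abs_min_sub_min_le_max y ρ z ρ
        simpa using this

theorem abs_clampTo_sq_sub_le {ρ : ℝ} (hρ : 0 ≤ ρ) (y z : ℝ) :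
    |clampTo ρ y ^ 2 - clampTo ρ z ^ 2| ≤ 2 * ρ * |y - z| := by
  have e : clampTo ρ y ^ 2 - clampTo ρ z ^ 2 =
      (clampTo ρ y + clampTo ρ z) * (clampTo ρ y - clampTo ρ z) := by ring
  rw [e, abs_mul]
  refine mul_le_mul ?_ (abs_clampTo_sub_le ρ y z) (abs_nonneg _) (by positivity)
  linarith [abs_add_le (clampTo ρ y) (clampTo ρ z), abs_clampTo_le hρ y, abs_clampTo_le hρ z]

open BoundedContinuousFunction in
/-- Bounded small solutions of a perturbed Riccati equation, after adjusting the spectral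
parameter. -/
theorem exists_riccati_bounded {k0 K m B : ℝ} (hk0 : 0 < k0) (hK0 : 0 < K) (hm : 0 < m)
    (hB0 : 0 < B) :
    ∃ δ1 C, 0 < δ1 ∧ 0 < C ∧ ∀ (κ δ : ℝ) (b f : ℝ → ℝ), k0 ≤ κ → κ ≤ K → Continuous b →
      (∀ x, m ≤ b x) → (∀ x, b x ≤ B) → L2le f δ → 0 < δ → δ ≤ δ1 →
      ∃ (e : ℝ → ℝ) (μ : ℝ), (∀ x, HasDerivAt e
          (2 * (κ * tanh (κ * x)) * e x + e x ^ 2 / b x + b x * (f x - μ)) x) ∧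
        (∀ x, |e x| ≤ C * δ) ∧ |μ| ≤ C * δ := by
  set Γ := corrConst k0 K m B with hΓ
  have hΓ0 : 0 < Γ := corrConst_pos hk0 hK0 hm hB0
  set A := 4 * Γ * B with hA
  have hA0 : 0 < A := by positivity
  set M := (1 + K) / m * (A + B) with hM
  have hM0 : 0 < M := by positivity
  refine ⟨min 1 (m / (4 * Γ * A)), A + M * (1 + A / m), by positivity, by positivity,
    fun κ δ b f hκ hκK cb hb hB hf hδ hδ1 => ?_⟩
  have hκ0 := hk0.trans_le hκ
  have hδ1' : δ ≤ 1 := hδ1.trans (min_le_left _ _)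
  set ρ := A * δ with hρ
  have hρ0 : 0 < ρ := by positivity
  have hsm : Γ * (ρ / m) ≤ 1 / 4 := by
    have := hδ1.trans (min_le_right _ _)
    rw [le_div_iff₀ (by positivity)] at this
    rw [hρ, mul_div_assoc', div_le_iff₀ hm]
    linarith
  have hb0 : ∀ x, 0 < b x := fun x => hm.trans_le (hb x)
  let N : (ℝ →ᵇ ℝ) → ℝ → ℝ := fun e x => clampTo ρ (e x) ^ 2 / b x + b x * f x
  have cN : ∀ e, Continuous (N e) := fun e => by
    have c1 : Continuous fun x => clampTo ρ (e x) := (continuous_clampTo ρ).comp e.continuous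
    exact ((c1.pow 2).div cb fun x => (hb0 x).ne').add (cb.mul hf.1)
  have hbf : L2le (fun x => b x * f x) (B * δ) := hf.of_abs_le (g := fun x => b x * f x)
      (cb.mul hf.1) hB0.le fun x => by
    rw [abs_mul, abs_of_pos (hb0 x)]
    exact mul_le_mul_of_nonneg_right (hB x) (abs_nonneg _)
  have hN : ∀ e, MixedLe (N e) (ρ * (ρ / m)) (B * δ) := fun e =>
    ⟨cN e, by positivity, by positivity, _, hbf, fun x => by
      refine (abs_add_le _ _).trans (add_le_add_left ?_ _)
      rw [abs_div, abs_of_pos (hb0 x), abs_of_nonneg (sq_nonneg _), mul_div_assoc', ← sq]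
      refine div_le_div₀ (by positivity) ?_ hm (hb x)
      rw [← sq_abs]
      exact pow_le_pow_left₀ (abs_nonneg _) (abs_clampTo_le hρ0.le _) 2⟩
  have hbd : ∀ e x, |corrOp κ b (N e) x| ≤ ρ := fun e x => by
    refine (abs_corrOp_le hk0 hκ hκK hm cb hb hB (hN e) x).trans ?_
    rw [← hΓ, mul_add]
    have h1 : Γ * (ρ * (ρ / m)) ≤ ρ * (1 / 4) := by
      calc Γ * (ρ * (ρ / m)) = ρ * (Γ * (ρ / m)) := by ring
        _ ≤ _ := mul_le_mul_of_nonneg_left hsm hρ0.le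
    have h2 : Γ * (B * δ) = ρ / 4 := by rw [hρ, hA]; ring
    linarith
  let Φ : (ℝ →ᵇ ℝ) → (ℝ →ᵇ ℝ) := fun e => ofNormedAddCommGroup (corrOp κ b (N e))
    (continuous_iff_continuousAt.2 fun x =>
      (hasDerivAt_corrOp hκ0 hm cb hb hB (hN e) x).continuousAt) ρ (hbd e)
  have hΦ : ContractingWith (1 / 2) Φ := by
    refine ⟨by norm_num, LipschitzWith.of_dist_le_mul fun e1 e2 => ?_⟩
    have hd0 : 0 ≤ dist e1 e2 := dist_nonneg
    rw [BoundedContinuousFunction.dist_le (by positivity)]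
    intro x
    change dist (corrOp κ b (N e1) x) (corrOp κ b (N e2) x) ≤ _
    rw [Real.dist_eq, corrOp_sub hκ0 hm cb hb hB (hN e1) (hN e2)]
    have hdiff : ∀ y, |N e1 y - N e2 y| ≤ 2 * (ρ / m) * dist e1 e2 := fun y => by
      simp only [N]
      rw [add_sub_add_right_eq_sub, ← sub_div, abs_div, abs_of_pos (hb0 y),
        div_le_iff₀ (hb0 y)]
      refine (abs_clampTo_sq_sub_le hρ0.le _ _).trans ?_
      have h1 : |e1 y - e2 y| ≤ dist e1 e2 := by
        rw [← Real.dist_eq]; exact dist_coe_le_dist y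
      have h2 : ρ ≤ ρ / m * b y := by
        rw [div_mul_eq_mul_div, le_div_iff₀ hm]
        exact mul_le_mul_of_nonneg_left (hb y) hρ0.le
      calc 2 * ρ * |e1 y - e2 y| ≤ 2 * (ρ / m * b y) * dist e1 e2 :=
            mul_le_mul (by linarith) h1 (abs_nonneg _) (by nlinarith)
        _ = _ := by ring
    refine le_of_forall_pos_le_add fun η hη => ?_
    have h1 := abs_corrOp_le hk0 hκ hκK hm cb hb hB
      (MixedLe.of_bounded ((cN e1).sub (cN e2)) hdiff (div_pos hη hΓ0)) x
    rw [← hΓ, mul_add, mul_div_cancel₀ _ hΓ0.ne'] at h1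
    refine h1.trans (add_le_add_left ?_ _)
    have : ((1 / 2 : NNReal) : ℝ) = 1 / 2 := by norm_num
    rw [this]
    calc Γ * (2 * (ρ / m) * dist e1 e2) = 2 * (Γ * (ρ / m)) * dist e1 e2 := by ring
      _ ≤ 2 * (1 / 4) * dist e1 e2 := by gcongr
      _ = _ := by ring
  let e := hΦ.fixedPoint
  have he : Φ e = e := hΦ.fixedPoint_isFixedPt
  have hex : ∀ x, e x = corrOp κ b (N e) x := fun x => by
    conv_lhs => rw [← he]
    rfl
  have heρ : ∀ x, |e x| ≤ ρ := fun x => by rw [hex]; exact hbd e x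
  refine ⟨e, growthMean κ b (N e), fun x => ?_, fun x => (heρ x).trans ?_, ?_⟩
  · have := hasDerivAt_corrOp hκ0 hm cb hb hB (hN e) x
    rw [← hex, ← funext hex] at this
    refine this.congr_deriv ?_
    simp only [N]
    rw [clampTo_of_abs_le (heρ x)]
    ring
  · have : 0 ≤ M * (1 + A / m) * δ := by positivity
    rw [hρ]
    linarith
  · refine (abs_growthMean_le hκ0 hκK hm cb hb hB (hN e)).1.trans ?_
    have h1 : ρ * (ρ / m) ≤ A * (A / m) * δ := by
      calc ρ * (ρ / m) = A * (A / m) * δ * δ := by rw [hρ]; ring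
        _ ≤ A * (A / m) * δ * 1 := by gcongr
        _ = _ := by ring
    have h2 : 0 ≤ (1 + K) / m := by positivity
    calc (1 + K) / m * (ρ * (ρ / m) + B * δ) ≤ (1 + K) / m * (A * (A / m) * δ + B * δ) := by
          gcongr
      _ ≤ (A + M * (1 + A / m)) * δ := by
          have h3 : A * (A / m) * δ + B * δ ≤ (A + B) * (1 + A / m) * δ := by
            have : 0 ≤ (A + B * (A / m)) * δ := by positivity
            nlinarith
          have h4 := mul_le_mul_of_nonneg_left h3 h2
          have h5 : 0 ≤ A * δ := by positivity
          rw [hM]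
          linarith

theorem abs_le_cosh (z : ℝ) : |z| ≤ cosh z := by
  rw [← cosh_abs]
  have h1 := add_one_le_exp |z|
  have h2 : exp |z| * exp (-|z|) = 1 := by rw [← exp_add]; simp
  have h3 := cosh_sq |z|
  have h4 : |z| ≤ sinh |z| := by
    rcases (abs_nonneg z).eq_or_lt with h | h
    · rw [← h]; simp
    · exact (self_lt_sinh_iff.2 h).le
  exact h4.trans (sinh_lt_cosh _).le

theorem abs_mul_inv_cosh_sq_le (z : ℝ) : |z| * (1 / cosh z ^ 2) ≤ 1 / cosh z := by
  have h0 := cosh_pos z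
  have := abs_le_cosh z
  rw [mul_one_div, div_le_div_iff₀ (by positivity) h0]
  nlinarith

theorem inv_cosh_sq_le (z : ℝ) : 1 / cosh z ^ 2 ≤ 1 / cosh z := by
  have h0 := cosh_pos z
  have := one_le_cosh z
  rw [div_le_div_iff₀ (by positivity) h0]
  nlinarith

theorem abs_sub_le_of_hasDerivAt_Icc {f f' : ℝ → ℝ} {C k0 K x y : ℝ}
    (hf : ∀ z ∈ Icc k0 K, HasDerivAt f (f' z) z) (hb : ∀ z ∈ Icc k0 K, |f' z| ≤ C)
    (hx : x ∈ Icc k0 K) (hy : y ∈ Icc k0 K) : |f y - f x| ≤ C * |y - x| :=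
  (convex_Icc k0 K).norm_image_sub_le_of_norm_hasDerivWithin_le
    (fun z hz => (hf z hz).hasDerivWithinAt) hb hx hy

theorem hasDerivAt_tanh_mul_left (y κ : ℝ) :
    HasDerivAt (fun κ => tanh (κ * y)) (1 / cosh (κ * y) ^ 2 * y) κ := by
  have := (hasDerivAt_tanh (κ * y)).comp κ ((hasDerivAt_id κ).mul_const y)
  rw [one_sub_tanh_sq] at this
  exact this.congr_deriv (by ring)

theorem abs_mul_tanh_sub_le {k0 K κ κ' : ℝ} (h : κ ∈ Icc k0 K)
    (h' : κ' ∈ Icc k0 K) (y : ℝ) :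
    |κ' * tanh (κ' * y) - κ * tanh (κ * y)| ≤ 2 * |κ' - κ| := by
  refine abs_sub_le_of_hasDerivAt_Icc (f := fun κ => κ * tanh (κ * y))
    (fun z _ => (hasDerivAt_id z).fun_mul (hasDerivAt_tanh_mul_left y z)) (fun z hz => ?_) h h'
  have h1 := (abs_tanh_lt_one (z * y)).le
  have h2 := (abs_mul_inv_cosh_sq_le (z * y)).trans
    ((div_le_one (cosh_pos _)).2 (one_le_cosh (z * y)))
  have e : z * (1 / cosh (z * y) ^ 2 * y) = (z * y) * (1 / cosh (z * y) ^ 2) := by ring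
  have h3 : 0 ≤ 1 / cosh (z * y) ^ 2 := by positivity
  simp only [id, e, one_mul]
  refine (abs_add_le _ _).trans ?_
  rw [abs_mul, abs_of_nonneg h3]
  linarith

theorem abs_sol_sub_le {k0 K κ κ' : ℝ} (hk0 : 0 < k0) (h : κ ∈ Icc k0 K)
    (h' : κ' ∈ Icc k0 K) (y : ℝ) :
    |sol κ' y - sol κ y| ≤ 8 * K * (1 / cosh (k0 * y)) * |κ' - κ| := by
  have hd : ∀ z, HasDerivAt (fun κ => sol κ y)
      (4 * z * (1 / cosh (z * y) ^ 2) -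
        4 * z * tanh (z * y) * (z * y * (1 / cosh (z * y) ^ 2))) z := fun z => by
    have := (((hasDerivAt_id z).fun_pow 2).fun_sub
      (((hasDerivAt_id z).fun_mul (hasDerivAt_tanh_mul_left y z)).fun_pow 2)).const_mul 2
    have e : (fun κ => sol κ y) = fun κ => 2 * (id κ ^ 2 - (id κ * tanh (κ * y)) ^ 2) := by
      funext κ; rw [sol_eq]; rfl
    rw [e]
    refine this.congr_deriv ?_
    simp only [id]
    rw [← one_sub_tanh_sq]
    push_cast
    ring
  refine abs_sub_le_of_hasDerivAt_Icc (fun z _ => hd z) (fun z hz => ?_) h h'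
  have hz0 : 0 < z := hk0.trans_le hz.1
  have h1 := (abs_tanh_lt_one (z * y)).le
  have h2 := abs_mul_inv_cosh_sq_le (z * y)
  have h3 := inv_cosh_sq_le (z * y)
  have h4 : 0 ≤ 1 / cosh (z * y) ^ 2 := by positivity
  have h5 : 1 / cosh (z * y) ≤ 1 / cosh (k0 * y) := by
    refine one_div_le_one_div_of_le (cosh_pos _) ?_
    rw [cosh_le_cosh, abs_mul, abs_mul, abs_of_pos hk0, abs_of_pos hz0]
    exact mul_le_mul_of_nonneg_right hz.1 (abs_nonneg _)
  have h6 : 0 < 1 / cosh (z * y) := one_div_pos.2 (cosh_pos _)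
  calc _ ≤ |4 * z * (1 / cosh (z * y) ^ 2)| +
        |4 * z * tanh (z * y) * (z * y * (1 / cosh (z * y) ^ 2))| := abs_sub _ _
    _ = 4 * z * (1 / cosh (z * y) ^ 2) +
        4 * z * |tanh (z * y)| * (|z * y| * (1 / cosh (z * y) ^ 2)) := by
        simp only [abs_mul, abs_of_nonneg h4, abs_of_pos hz0, abs_of_pos (four_pos (α := ℝ))]
    _ ≤ 4 * z * (1 / cosh (z * y)) + 4 * z * 1 * (1 / cosh (z * y)) := by gcongr
    _ = 8 * z * (1 / cosh (z * y)) := by ring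
    _ ≤ 8 * K * (1 / cosh (k0 * y)) := by
        have hzK := hz.2
        have hK0 : 0 < K := hz0.trans_le hzK
        gcongr

theorem continuous_sol (k : ℝ) : Continuous (sol k) :=
  continuous_const.div (by fun_prop) fun _ => pow_ne_zero 2 (cosh_pos _).ne'

theorem l2le_sol_sub {k0 K κ κ' : ℝ} (hk0 : 0 < k0) (h : κ ∈ Icc k0 K) (h' : κ' ∈ Icc k0 K)
    (X : ℝ) :
    L2le (fun x => sol κ' (x - X) - sol κ (x - X)) (8 * K * √(2 / k0) * |κ' - κ|) := by
  have hK : 0 < K := hk0.trans_le (h.1.trans h.2)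
  have h1 := (l2le_inv_cosh hk0).comp_sub X
  have c1 := continuous_sol κ
  have c2 := continuous_sol κ'
  refine (h1.of_abs_le (g := fun x => sol κ' (x - X) - sol κ (x - X))
    (C := 8 * K * |κ' - κ|) (by fun_prop) (by positivity) fun x => ?_).mono
    (le_of_eq (by ring))
  rw [abs_of_pos (one_div_pos.2 (cosh_pos _))]
  refine (abs_sol_sub_le hk0 h h' (x - X)).trans (le_of_eq (by ring))

theorem abs_kink_sub_le {n : ℕ} {k0 d K κ κ' : ℝ} {k : Fin n → ℝ} (hp : WaveParams k0 d K κ k)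
    (hp' : WaveParams k0 d K κ' k) (X : ℝ) (a : Fin n → ℝ) (x : ℝ) :
    |kink κ' X k a x - kink κ X k a x| ≤ (2 + n * (K ^ 2 / d ^ 2)) * |κ' - κ| := by
  have h1 := abs_mul_tanh_sub_le ⟨hp.k0_le_top, hp.top_le⟩
    ⟨hp'.k0_le_top, hp'.top_le⟩ (x - X)
  have hd := hp.d_pos
  have h2 : |gsum κ' k a x - gsum κ k a x| ≤ n * (K ^ 2 / d ^ 2 * |κ' - κ|) := by
    unfold gsum
    rw [← Finset.sum_sub_distrib]
    refine (Finset.abs_sum_le_sum_abs _ _).trans ?_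
    have := Finset.sum_le_card_nsmul Finset.univ
      (fun j => |gfun κ' (k j) (x - a j) - gfun κ (k j) (x - a j)|)
      (K ^ 2 / d ^ 2 * |κ' - κ|) fun j _ => ?_
    · simpa using this
    · set y := x - a j
      have b1 : d ≤ κ - k j * tanh (k j * y) := by
        linarith [(theta_bounds (κ := κ) (hp.pos j) (k j * y)).1, hp.gap j]
      have b2 : d ≤ κ' - k j * tanh (k j * y) := by
        linarith [(theta_bounds (κ := κ') (hp.pos j) (k j * y)).1, hp'.gap j]
      have hc : 1 ≤ cosh (k j * y) ^ 2 := one_le_pow₀ (one_le_cosh _)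
      have hkK : k j ≤ K := (hp.lt_top j).le.trans hp.top_le
      have hkj := hp.pos j
      unfold gfun
      set t := k j * tanh (k j * y)
      have e : k j ^ 2 / (cosh (k j * y) ^ 2 * (κ' - t)) - k j ^ 2 / (cosh (k j * y) ^ 2 * (κ - t))
          = k j ^ 2 / (cosh (k j * y) ^ 2 * ((κ - t) * (κ' - t))) * (κ - κ') := by
        have n1 : κ - t ≠ 0 := by linarith
        have n2 : κ' - t ≠ 0 := by linarith
        have n3 : cosh (k j * y) ≠ 0 := (cosh_pos _).ne'
        field_simp
        ring
      rw [e, abs_mul, abs_sub_comm κ κ']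
      refine mul_le_mul_of_nonneg_right ?_ (abs_nonneg _)
      have h3 : d ^ 2 ≤ (κ - t) * (κ' - t) := by
        rw [sq]; exact mul_le_mul b1 b2 hd.le (by linarith)
      have h4 : d ^ 2 ≤ cosh (k j * y) ^ 2 * ((κ - t) * (κ' - t)) := by
        nlinarith [sq_nonneg d]
      rw [abs_of_nonneg (div_nonneg (sq_nonneg _) ((sq_nonneg d).trans h4))]
      exact div_le_div₀ (sq_nonneg _) (pow_le_pow_left₀ hkj.le hkK 2) (by positivity) h4
  have e : kink κ' X k a x - kink κ X k a x =
      (κ' * tanh (κ' * (x - X)) - κ * tanh (κ * (x - X))) + (gsum κ' k a x - gsum κ k a x) := by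
    unfold kink; ring
  rw [e]
  refine (abs_add_le _ _).trans ?_
  linarith

theorem WaveParams.continuous_thetaProd {n : ℕ} {k0 d K κ : ℝ} {k : Fin n → ℝ}
    (hp : WaveParams k0 d K κ k) (a : Fin n → ℝ) : Continuous (thetaProd κ k a) :=
  continuous_iff_continuousAt.2 fun x => (hp.hasDerivAt_thetaProd a x).continuousAt

theorem WaveParams.sq_thetaProd_bounds {n : ℕ} {k0 d K κ : ℝ} {k : Fin n → ℝ}
    (hp : WaveParams k0 d K κ k) (a : Fin n → ℝ) (x : ℝ) : 0 < thetaProd κ k a x ∧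
      (d ^ n) ^ 2 ≤ thetaProd κ k a x ^ 2 ∧ thetaProd κ k a x ^ 2 ≤ ((2 * K) ^ n) ^ 2 := by
  obtain ⟨h1, h2⟩ := hp.thetaProd_bounds a x
  have h0 : 0 < d ^ n := pow_pos hp.d_pos n
  exact ⟨h0.trans_le h1, pow_le_pow_left₀ h0.le h1 2, pow_le_pow_left₀ (h0.trans_le h1).le h2 2⟩

/-- A perturbation of the kink which solves a Riccati equation. -/
theorem WaveParams.hasDerivAt_kink_add {n : ℕ} {k0 d K κ : ℝ} {k : Fin n → ℝ}
    (hp : WaveParams k0 d K κ k) (X : ℝ) (a : Fin n → ℝ) {e q : ℝ → ℝ} {μ : ℝ}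
    (he : ∀ x, HasDerivAt e (2 * (κ * tanh (κ * x)) * e x + e x ^ 2 / thetaProd κ k a (x + X) ^ 2 +
      thetaProd κ k a (x + X) ^ 2 * (q (x + X) - (sol κ (x + X - X) +
        ∑ j, sol (k j) (x + X - a j)) - interaction κ X k a (x + X) - μ)) x) (x : ℝ) :
    HasDerivAt (fun x => kink κ X k a x + e (x - X) / thetaProd κ k a x ^ 2)
      ((kink κ X k a x + e (x - X) / thetaProd κ k a x ^ 2) ^ 2 - (κ ^ 2 + μ) + q x) x := by
  have h0 := (hp.sq_thetaProd_bounds a x).1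
  have h1 := (he (x - X)).comp_sub_const x X
  rw [sub_add_cancel] at h1
  have h2 := (hp.hasDerivAt_kink X a x).fun_add (h1.fun_div
    ((hp.hasDerivAt_thetaProd a x).fun_pow 2) (pow_pos h0 2).ne')
  refine h2.congr_deriv ?_
  have h3 := h0.ne'
  have h4 := hp.sol_add_sum_sol X a x
  have hk : kink κ X k a x = κ * tanh (κ * (x - X)) + gsum κ k a x := rfl
  rw [hk] at h4 ⊢
  generalize thetaProd κ k a x = Θ at h3
  generalize (∑ j, sol (k j) (x - a j - phase κ (k j))) = Sg at h4
  generalize (∑ j, sol (k j) (x - a j)) = Sg' at h4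
  have h5 : sol κ (x - X) = 2 * κ ^ 2 - 2 * (κ * tanh (κ * (x - X)) + gsum κ k a x) ^ 2 -
    2 * interaction κ X k a x - Sg - Sg' := by linear_combination h4
  rw [h5]
  generalize gsum κ k a x = g
  generalize tanh (κ * (x - X)) = T
  generalize interaction κ X k a x = I
  generalize e (x - X) = e0
  field_simp
  ring

/-- The weighted difference of a solution of a Riccati equation and the kink. -/
theorem WaveParams.hasDerivAt_sub_kink {n : ℕ} {k0 d K κ : ℝ} {k : Fin n → ℝ}
    (hp : WaveParams k0 d K κ k) (X : ℝ) (a : Fin n → ℝ) {h q : ℝ → ℝ}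
    (hh : ∀ x, HasDerivAt h (h x ^ 2 - κ ^ 2 + q x) x) (x : ℝ) :
    HasDerivAt (fun x => (h x - kink κ X k a x) * thetaProd κ k a x ^ 2)
      (2 * (κ * tanh (κ * (x - X))) * ((h x - kink κ X k a x) * thetaProd κ k a x ^ 2) +
        1 / thetaProd κ k a x ^ 2 * ((h x - kink κ X k a x) * thetaProd κ k a x ^ 2) ^ 2 +
        thetaProd κ k a x ^ 2 * (q x - (sol κ (x - X) + ∑ j, sol (k j) (x - a j)) -
          interaction κ X k a x)) x := by
  have h3 := (hp.sq_thetaProd_bounds a x).1.ne'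
  have h2 := ((hh x).fun_sub (hp.hasDerivAt_kink X a x)).fun_mul
    ((hp.hasDerivAt_thetaProd a x).fun_pow 2)
  refine h2.congr_deriv ?_
  have h4 := hp.sol_add_sum_sol X a x
  have hk : kink κ X k a x = κ * tanh (κ * (x - X)) + gsum κ k a x := rfl
  rw [hk] at h4 ⊢
  generalize thetaProd κ k a x = Θ at h3
  generalize (∑ j, sol (k j) (x - a j - phase κ (k j))) = Sg at h4
  generalize (∑ j, sol (k j) (x - a j)) = Sg' at h4
  have h5 : sol κ (x - X) = 2 * κ ^ 2 - 2 * (κ * tanh (κ * (x - X)) + gsum κ k a x) ^ 2 -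
    2 * interaction κ X k a x - Sg - Sg' := by linear_combination h4
  rw [h5]
  generalize gsum κ k a x = g
  generalize tanh (κ * (x - X)) = T
  generalize interaction κ X k a x = I
  generalize h x = e0
  field_simp
  ring

/-- Existence of a solution of the Riccati equation close to a kink. -/
theorem exists_riccati_near_kink (n : ℕ) {k0 d K : ℝ} (hk0 : 0 < k0) (hdp : 0 < d) (hK : 0 < K) :
    ∃ δ1 C, 0 < δ1 ∧ 0 < C ∧ ∀ (κ0 X δ : ℝ) (k a : Fin n → ℝ) (q : ℝ → ℝ),
      WaveParams k0 d K κ0 k → 0 < δ → δ ≤ δ1 →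
      L2le (fun x => q x - (sol κ0 (x - X) + ∑ j, sol (k j) (x - a j)) -
        interaction κ0 X k a x) δ →
      ∃ (κ : ℝ) (h : ℝ → ℝ), 0 < κ ∧ |κ - κ0| ≤ C * δ ∧
        (∀ x, HasDerivAt h (h x ^ 2 - κ ^ 2 + q x) x) ∧
        (∀ x, |h x - kink κ0 X k a x| ≤ C * δ) := by
  have hm0 : 0 < (d ^ n) ^ 2 := by positivity
  have hP0 : 0 < ((2 * K) ^ n) ^ 2 := by positivity
  obtain ⟨δR, CR, hδR, hCR, hR⟩ := exists_riccati_bounded hk0 hK hm0 hP0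
  refine ⟨min δR (k0 ^ 2 / (2 * CR)), CR / k0 + CR / (d ^ n) ^ 2, by positivity, by positivity,
    fun κ0 X δ k a q hp hδ hδ1 hf => ?_⟩
  have hκ00 := hp.top_pos
  have d2 : CR * δ ≤ k0 ^ 2 / 2 := by
    have := hδ1.trans (min_le_right _ _)
    rw [le_div_iff₀ (by positivity)] at this
    linarith
  have hf' := hf.comp_sub (-X)
  simp only [sub_neg_eq_add] at hf'
  have cΘ0 : Continuous fun x => thetaProd κ0 k a (x + X) ^ 2 :=
    ((hp.continuous_thetaProd a).comp (continuous_id.add continuous_const)).pow 2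
  obtain ⟨e, μ, he, hesup, hμ⟩ := hR κ0 δ (fun x => thetaProd κ0 k a (x + X) ^ 2) _
    hp.k0_le_top hp.top_le cΘ0 (fun x => (hp.sq_thetaProd_bounds a (x + X)).2.1)
    (fun x => (hp.sq_thetaProd_bounds a (x + X)).2.2) hf' hδ (hδ1.trans (min_le_left _ _))
  have hk2 : k0 ^ 2 ≤ κ0 ^ 2 := pow_le_pow_left₀ hk0.le hp.k0_le_top 2
  have hκpos : 0 < κ0 ^ 2 + μ := by
    have h1 := (abs_le.1 (hμ.trans d2)).1
    have h2 := pow_pos hk0 2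
    linarith
  have hsq := sq_sqrt hκpos.le
  have hpos := sqrt_pos.2 hκpos
  have hCm : 0 ≤ CR / (d ^ n) ^ 2 * δ := by positivity
  have hCk : 0 ≤ CR / k0 * δ := by positivity
  refine ⟨√(κ0 ^ 2 + μ), fun x => kink κ0 X k a x + e (x - X) / thetaProd κ0 k a x ^ 2, hpos, ?_,
    fun x => ?_, fun x => ?_⟩
  · have h1 : |√(κ0 ^ 2 + μ) - κ0| * (√(κ0 ^ 2 + μ) + κ0) = |μ| := by
      rw [← abs_of_pos (add_pos hpos hκ00), ← abs_mul]
      congr 1; linear_combination hsq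
    have h2 : |√(κ0 ^ 2 + μ) - κ0| * k0 ≤ CR * δ :=
      (mul_le_mul_of_nonneg_left (by linarith [hp.k0_le_top]) (abs_nonneg _)).trans
        (h1.trans_le hμ)
    rw [← le_div_iff₀ hk0, mul_div_right_comm] at h2
    linarith
  · rw [hsq]
    exact hp.hasDerivAt_kink_add X a he x
  · obtain ⟨t0, t1, -⟩ := hp.sq_thetaProd_bounds a x
    simp only [add_sub_cancel_left]
    rw [abs_div, abs_of_pos (pow_pos t0 2)]
    have h1 : |e (x - X)| / thetaProd κ0 k a x ^ 2 ≤ CR * δ / (d ^ n) ^ 2 :=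
      div_le_div₀ (by positivity) (hesup _) hm0 t1
    rw [mul_div_right_comm] at h1
    linarith

/-- If a solution of a Riccati equation is uniformly close to a kink, then the transformed
potential is close to the sum of the remaining solitons. -/
theorem riccati_transform_close (n : ℕ) {k0 d K : ℝ} (hk0 : 0 < k0) (hdp : 0 < d) (hK : 0 < K) :
    ∃ s1 C, 0 < s1 ∧ 0 < C ∧ ∀ (κ X ℓ δ s : ℝ) (k a : Fin n → ℝ) (q h : ℝ → ℝ),
      WaveParams k0 d K κ k → Separated ℓ X a → 0 ≤ s → s ≤ s1 →
      (∀ x, HasDerivAt h (h x ^ 2 - κ ^ 2 + q x) x) → (∀ x, |h x - kink κ X k a x| ≤ s) →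
      L2le (fun x => q x - (sol κ (x - X) + ∑ j, sol (k j) (x - a j))) δ →
      L2le (fun x => -q x - 2 * h x ^ 2 + 2 * κ ^ 2 -
        ∑ j, sol (k j) (x - a j - phase κ (k j))) (C * (δ + s + exp (-(k0 * ℓ)))) := by
  obtain ⟨CI, hCI, hI⟩ := l2le_interaction n hk0 hdp hK
  obtain ⟨m, hm⟩ : ∃ m, m = (d ^ n) ^ 2 := ⟨_, rfl⟩
  obtain ⟨P, hP⟩ : ∃ P, P = ((2 * K) ^ n) ^ 2 := ⟨_, rfl⟩
  obtain ⟨B, hB⟩ : ∃ B, B = 1 + (5 * 1 ^ 2 + 1 / k0) / k0 := ⟨_, rfl⟩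
  obtain ⟨Hb, hHb⟩ : ∃ Hb, Hb = K + n * (K ^ 2 / d) := ⟨_, rfl⟩
  have hm0 : 0 < m := by rw [hm]; positivity
  have hP0 : 0 < P := by rw [hP]; positivity
  have hB0 : 0 < B := by rw [hB]; positivity
  have hHb0 : 0 < Hb := by rw [hHb]; positivity
  obtain ⟨Ce, hCe⟩ : ∃ Ce, Ce = P * (1 + CI) := ⟨_, rfl⟩
  have hCe0 : 0 < Ce := by rw [hCe]; positivity
  obtain ⟨CL, hCL⟩ : ∃ CL, CL = (2 * (2 * Hb + 1)) * (1 / m * (B * Ce)) := ⟨_, rfl⟩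
  have hCL0 : 0 < CL := by rw [hCL]; positivity
  refine ⟨min (k0 * m / (2 * P)) 1, CL + (1 + 2 * CI), by positivity, by positivity,
    fun κ X ℓ δ s k a q h hp hs hs0 hs1 hh hsup hq => ?_⟩
  have hδ := hq.2.1
  have hI1 := hI κ X ℓ k a hp hs
  have hE0 : 0 < exp (-(k0 * ℓ)) := exp_pos _
  generalize exp (-(k0 * ℓ)) = E at hI1 hE0 ⊢
  obtain ⟨D, hD⟩ : ∃ D, D = δ + s + E := ⟨_, rfl⟩
  rw [← hD]
  have hD0 : 0 < D := by rw [hD]; positivity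
  have hsD : s ≤ D := by rw [hD]; linarith
  have d4 : 1 / m * (P * s) ≤ k0 / 2 := by
    have := hs1.trans (min_le_left _ _)
    rw [le_div_iff₀ (by positivity)] at this
    rw [one_div_mul_eq_div, div_le_iff₀ hm0]
    linarith
  have d5 : s ≤ 1 := hs1.trans (min_le_right _ _)
  have ΘB := hp.sq_thetaProd_bounds a
  rw [← hm, ← hP] at ΘB
  have cΘ := hp.continuous_thetaProd a
  have ct := continuous_tanh
  have cH := hp.continuous_kink X a
  have ch : Continuous h := continuous_iff_continuousAt.2 fun x => (hh x).continuousAt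
  have hF := (hq.sub hI1)
  have cF := hF.1
  have hη := hp.hasDerivAt_sub_kink X a hh
  have hηsup : ∀ x, |(h x - kink κ X k a x) * thetaProd κ k a x ^ 2| ≤ P * s := fun x => by
    rw [abs_mul, abs_of_pos (pow_pos (ΘB x).1 2), mul_comm]
    exact mul_le_mul (ΘB x).2.2 (hsup x) (abs_nonneg _) hP0.le
  have hφ : L2le (fun x => thetaProd κ k a x ^ 2 * (q x - (sol κ (x - X) +
      ∑ j, sol (k j) (x - a j)) - interaction κ X k a x)) (Ce * D) :=
    (hF.of_abs_le (by fun_prop) hP0.le fun x => by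
      rw [abs_mul, abs_of_pos (pow_pos (ΘB x).1 2)]
      exact mul_le_mul_of_nonneg_right (ΘB x).2.2 (abs_nonneg _)).mono (by
        rw [hCe, mul_assoc]
        refine mul_le_mul_of_nonneg_left ?_ hP0.le
        have : 0 ≤ CI * (δ + s) := by positivity
        rw [hD]; linarith)
  have hη0 : ∀ x, h x - kink κ X k a x =
      1 / thetaProd κ k a x ^ 2 * ((h x - kink κ X k a x) * thetaProd κ k a x ^ 2) := fun x => by
    have := (ΘB x).1.ne'
    field_simp
  have cη : Continuous fun x => (h x - kink κ X k a x) * thetaProd κ k a x ^ 2 := by fun_prop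
  have hL : L2le (fun x => (h x - kink κ X k a x) * thetaProd κ k a x ^ 2) (B * (Ce * D)) := by
    have cr : Continuous fun x => 1 / thetaProd κ k a x ^ 2 :=
      continuous_const.div (cΘ.pow 2) fun x => (pow_pos (ΘB x).1 2).ne'
    have hr : ∀ x, |1 / thetaProd κ k a x ^ 2| ≤ 1 / m := fun x => by
      rw [abs_of_nonneg (by positivity)]
      exact one_div_le_one_div_of_le hm0 (ΘB x).2.1
    have hsup' : ∀ x, |(h x - kink κ X k a x) * thetaProd κ k a x ^ 2| ≤ 1 * (Ce * D) := fun x => by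
      refine (hηsup x).trans ?_
      rw [hCe, one_mul, mul_assoc]
      refine mul_le_mul_of_nonneg_left ?_ hP0.le
      have : 0 ≤ CI * D := by positivity
      linarith
    have cη' : Continuous fun x =>
        2 * (κ * tanh (κ * (x - X))) * ((h x - kink κ X k a x) * thetaProd κ k a x ^ 2) +
        1 / thetaProd κ k a x ^ 2 * ((h x - kink κ X k a x) * thetaProd κ k a x ^ 2) ^ 2 +
        thetaProd κ k a x ^ 2 * (q x - (sol κ (x - X) + ∑ j, sol (k j) (x - a j)) -
          interaction κ X k a x) := by
      refine Continuous.add (Continuous.add ?_ (cr.mul (cη.pow 2))) hφ.1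
      fun_prop
    have hφ' := hφ.comp_sub (-X)
    simp only [sub_neg_eq_add] at hφ'
    have h1 := riccati_line_energy (s := -1) (S := 1) (r := fun x => 1 / thetaProd κ k a (x + X) ^ 2)
      (φ := fun x => thetaProd κ k a (x + X) ^ 2 * (q (x + X) - (sol κ (x + X - X) +
        ∑ j, sol (k j) (x + X - a j)) - interaction κ X k a (x + X))) hk0 hp.k0_le_top (Or.inr rfl)
      (fun x => (hη (x + X)).comp_add_const x X)
      (cη'.comp (continuous_id.add continuous_const)) (fun x => by rw [add_sub_cancel_right]; ring)
      (fun x => by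
        rw [abs_mul]
        have h1 := mul_le_mul (hr (x + X)) (hηsup (x + X)) (abs_nonneg _) (by positivity)
        linarith [hp.k0_le_top])
      (fun x => hsup' (x + X)) hφ'
    have h2 := h1.comp_sub X
    simp only [sub_add_cancel] at h2
    rwa [hB]
  have hhL : L2le (fun x => h x - kink κ X k a x) (1 / m * (B * (Ce * D))) := by
    refine hL.of_abs_le (ch.sub cH) (by positivity) fun x => ?_
    rw [abs_mul, abs_of_pos (pow_pos (ΘB x).1 2), one_div_mul_eq_div, le_div_iff₀ hm0]
    exact mul_le_mul_of_nonneg_left (ΘB x).2.1 (abs_nonneg _)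
  have h1 := hhL.of_abs_le
    (g := fun x => (2 * (h x + kink κ X k a x)) * (h x - kink κ X k a x))
    (C := 2 * (2 * Hb + 1)) (by fun_prop) (by positivity) (fun x => by
      rw [abs_mul]
      refine mul_le_mul_of_nonneg_right ?_ (abs_nonneg _)
      have h1 := hp.abs_kink_le X a x
      have h2 := (hsup x).trans d5
      rw [← hHb] at h1
      rw [abs_le] at h1 h2 ⊢
      constructor <;> linarith [h1.1, h1.2, h2.1, h2.2])
  have h2 := (hq.add h1).neg.add (hI1.add hI1)
  have e : (fun x => -q x - 2 * h x ^ 2 + 2 * κ ^ 2 -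
      ∑ j, sol (k j) (x - a j - phase κ (k j))) = fun x =>
      -(q x - (sol κ (x - X) + ∑ j, sol (k j) (x - a j)) +
        (2 * (h x + kink κ X k a x)) * (h x - kink κ X k a x)) +
      (interaction κ X k a x + interaction κ X k a x) := by
    funext x
    linear_combination -hp.sol_add_sum_sol X a x
  rw [e]
  refine h2.mono ?_
  have e2 : 2 * (2 * Hb + 1) * (1 / m * (B * (Ce * D))) = CL * D := by rw [hCL]; ring
  have e3 : (CL + (1 + 2 * CI)) * D = CL * D + δ + s + E + 2 * (CI * E) + 2 * CI * (δ + s) := by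
    rw [hD]; ring
  have e4 : 0 ≤ 2 * CI * (δ + s) := by positivity
  rw [e2, e3]
  linarith

/-- A potential close to a sum of solitons admits a solution of the Riccati equation close to the
kink of the largest soliton, and the transformed potential is close to the sum of the remaining
solitons. -/
theorem removing_soliton (n : ℕ) {k0 d K : ℝ} (hk0 : 0 < k0) (hdp : 0 < d) (hK : 0 < K) :
    ∃ δ1 C, 0 < δ1 ∧ 0 < C ∧ ∀ (κ0 X ℓ δ : ℝ) (k a : Fin n → ℝ) (q : ℝ → ℝ),
      (∀ κ, |κ - κ0| ≤ d → WaveParams k0 d K κ k) → Separated ℓ X a →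
      δ + exp (-(k0 * ℓ)) ≤ δ1 →
      L2le (fun x => q x - (sol κ0 (x - X) + ∑ j, sol (k j) (x - a j))) δ →
      ∃ (κ : ℝ) (h : ℝ → ℝ), |κ - κ0| ≤ d ∧ |κ - κ0| ≤ C * (δ + exp (-(k0 * ℓ))) ∧
        (∀ x, HasDerivAt h (h x ^ 2 - κ ^ 2 + q x) x) ∧
        (∀ x, |h x - kink κ0 X k a x| ≤ C * (δ + exp (-(k0 * ℓ)))) ∧
        L2le (fun x => -q x - 2 * h x ^ 2 + 2 * κ ^ 2 -
          ∑ j, sol (k j) (x - a j - phase κ (k j))) (C * (δ + exp (-(k0 * ℓ)))) := by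
  obtain ⟨CI, hCI, hI⟩ := l2le_interaction n hk0 hdp hK
  obtain ⟨δR, CR, hδR, hCR, hR⟩ := exists_riccati_near_kink n hk0 hdp hK
  obtain ⟨s1, CT, hs1, hCT, hT⟩ := riccati_transform_close n hk0 hdp hK
  obtain ⟨Cκ, hCκ⟩ : ∃ Cκ, Cκ = CR * (1 + CI) := ⟨_, rfl⟩
  have hCκ0 : 0 < Cκ := by rw [hCκ]; positivity
  obtain ⟨Cd, hCd⟩ : ∃ Cd, Cd = Cκ + (2 + n * (K ^ 2 / d ^ 2)) * Cκ := ⟨_, rfl⟩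
  have hCd0 : 0 < Cd := by rw [hCd]; positivity
  obtain ⟨Cs, hCs⟩ : ∃ Cs, Cs = 8 * K * √(2 / k0) * Cκ := ⟨_, rfl⟩
  have hCs0 : 0 < Cs := by rw [hCs]; positivity
  refine ⟨min (δR / (1 + CI)) (min (d / Cκ) (s1 / Cd)), Cκ + CT * (1 + Cs + Cd), by positivity,
    by positivity, fun κ0 X ℓ δ k a q hroom hs hδ1 hq => ?_⟩
  have hδ := hq.2.1
  have hp0 := hroom κ0 (by simpa using hdp.le)
  have hI0 := hI κ0 X ℓ k a hp0 hs
  have hTE := fun κ => hT κ X ℓ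
  have hE0 : 0 < exp (-(k0 * ℓ)) := exp_pos _
  generalize exp (-(k0 * ℓ)) = E at hI0 hE0 hδ1 hTE ⊢
  obtain ⟨D, hD⟩ : ∃ D, D = δ + E := ⟨_, rfl⟩
  rw [← hD] at hδ1 ⊢
  have hD0 : 0 < D := by rw [hD]; positivity
  have d1 : (1 + CI) * D ≤ δR := by
    have := hδ1.trans (min_le_left _ _)
    rw [le_div_iff₀ (by positivity)] at this
    linarith
  have d2 : Cκ * D ≤ d := by
    have := hδ1.trans ((min_le_right _ _).trans (min_le_left _ _))
    rw [le_div_iff₀ hCκ0] at this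
    linarith
  have d3 : Cd * D ≤ s1 := by
    have := hδ1.trans ((min_le_right _ _).trans (min_le_right _ _))
    rw [le_div_iff₀ hCd0] at this
    linarith
  obtain ⟨κ, h, hκ0, hκ, hh, hsup⟩ := hR κ0 X ((1 + CI) * D) k a q hp0 (by positivity) d1
    ((hq.sub hI0).mono (by
      have : 0 ≤ E + CI * δ := by positivity
      rw [hD]; linarith))
  rw [← mul_assoc, ← hCκ] at hκ hsup
  have hp := hroom κ (hκ.trans d2)
  have hsup' : ∀ x, |h x - kink κ X k a x| ≤ Cd * D := fun x => by
    have h1 := abs_kink_sub_le hp0 hp X a x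
    have h2 := mul_le_mul_of_nonneg_left hκ
      (show 0 ≤ 2 + n * (K ^ 2 / d ^ 2) by positivity)
    have h3 := abs_sub (h x - kink κ0 X k a x) (kink κ X k a x - kink κ0 X k a x)
    rw [sub_sub_sub_cancel_right] at h3
    rw [hCd, add_mul, mul_assoc]
    linarith [hsup x]
  have hsol : L2le (fun x => sol κ0 (x - X) - sol κ (x - X)) (Cs * D) :=
    (l2le_sol_sub hk0 ⟨hp.k0_le_top, hp.top_le⟩ ⟨hp0.k0_le_top, hp0.top_le⟩ X).mono (by
      rw [abs_sub_comm, hCs, mul_assoc _ Cκ D]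
      exact mul_le_mul_of_nonneg_left hκ (by positivity))
  have hq' : L2le (fun x => q x - (sol κ (x - X) + ∑ j, sol (k j) (x - a j))) (δ + Cs * D) := by
    convert hq.add hsol using 2
    ring
  have hfin := hTE κ _ (Cd * D) k a q h hp hs (by positivity) d3 hh hsup' hq'
  have e1 : 0 ≤ CT * (1 + Cs + Cd) * D := by positivity
  refine ⟨κ, h, hκ.trans d2, hκ.trans ?_, hh, fun x => (hsup x).trans ?_, hfin.mono ?_⟩
  · linarith
  · linarith
  · have e2 : CT * (δ + Cs * D + Cd * D + E) = CT * (1 + Cs + Cd) * D := by rw [hD]; ring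
    have e3 : 0 ≤ Cκ * D := by positivity
    rw [e2]
    linarith

theorem pos_of_deriv_pos_of_eq_zero {f f' : ℝ → ℝ} (hf : ∀ t, HasDerivAt f (f' t) t)
    (h0 : 0 < f 0) (h : ∀ t, 0 ≤ t → f t = 0 → 0 < f' t) {t : ℝ} (ht : 0 ≤ t) : 0 < f t := by
  by_contra! hc
  have cf : Continuous f := continuous_iff_continuousAt.2 fun x => (hf x).continuousAt
  have hS : IsCompact (Icc 0 t ∩ f ⁻¹' {0}) :=
    isCompact_Icc.inter_right (isClosed_singleton.preimage cf)
  have hne : (Icc 0 t ∩ f ⁻¹' {0}).Nonempty := by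
    obtain ⟨y, hy, e⟩ := intermediate_value_Icc' ht cf.continuousOn ⟨hc, h0.le⟩
    exact ⟨y, hy, e⟩
  obtain ⟨z, ⟨hz, hz0⟩, hmin⟩ := hS.exists_isLeast hne
  have hz0 : f z = 0 := hz0
  have hzpos : 0 < z := hz.1.lt_of_ne (by rintro rfl; linarith)
  have hpos : ∀ y ∈ Ico 0 z, 0 < f y := by
    intro y hy
    by_contra! hc'
    obtain ⟨y', hy', e⟩ := intermediate_value_Icc' hy.1 cf.continuousOn ⟨hc', h0.le⟩
    have := hmin ⟨⟨hy'.1, hy'.2.trans (hy.2.le.trans hz.2)⟩, e⟩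
    linarith [hy'.2, hy.2]
  have hd := h z hz.1 hz0
  have h1 : ∀ᶠ y in 𝓝[<] z, slope f z y ∈ Ioi 0 :=
    ((hasDerivAt_iff_tendsto_slope.1 (hf z)).mono_left
      (nhdsWithin_mono _ fun y hy => ne_of_lt hy)).eventually (Ioi_mem_nhds hd)
  have h2 : ∀ᶠ y in 𝓝[<] z, y ∈ Ico 0 z := by
    filter_upwards [self_mem_nhdsWithin, nhdsWithin_le_nhds (Ioi_mem_nhds hzpos)] with y hy hy'
    exact ⟨le_of_lt hy', hy⟩
  obtain ⟨y, hy1, hy2⟩ := (h1.and h2).exists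
  have hy1 : 0 < slope f z y := hy1
  rw [slope_def_field, hz0, sub_zero] at hy1
  have := hpos y hy2
  have h3 : f y / (y - z) < 0 := div_neg_of_pos_of_neg this (by linarith [hy2.2])
  linarith

/-- Derivative of the average of the Riccati function over a moving window. -/
theorem RiccatiFlow.hasDerivAt_window {q q1 q2 q3 h : ℝ → ℝ → ℝ} {κ : ℝ}
    (hq : KdVReg q q1 q2 q3) (H : RiccatiFlow q q1 q2 κ h) {ζ ζ1 ζ2 ζ3 : ℝ → ℝ}
    (d0 : ∀ x, HasDerivAt ζ (ζ1 x) x) (d1 : ∀ x, HasDerivAt ζ1 (ζ2 x) x)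
    (d2 : ∀ x, HasDerivAt ζ2 (ζ3 x) x) (c0 : Continuous ζ) (c1 : Continuous ζ1)
    (c3 : Continuous ζ3)
    (hs : ∀ x, 1 ≤ |x| → ζ x = 0 ∧ ζ1 x = 0 ∧ ζ2 x = 0 ∧ ζ3 x = 0) (b v t : ℝ) :
    HasDerivAt (fun t => ∫ y in (-1)..1, ζ y * h t (y + (b + v * t)))
      (∫ y in (-1)..1, (ζ1 y * ((6 * κ ^ 2 - v) * h t (y + (b + v * t)) -
        2 * h t (y + (b + v * t)) ^ 3) + ζ3 y * h t (y + (b + v * t)))) t := by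
  have cq := hq.c0
  have cq1 := hq.c1
  have cq2 := hq.c2
  have ch := H.c
  let ht : ℝ → ℝ → ℝ := fun t x => -(q2 t x + 2 * q1 t x * h t x +
    (4 * κ ^ 2 + 2 * q t x) * (h t x ^ 2 - κ ^ 2 + q t x))
  let hx : ℝ → ℝ → ℝ := fun t x => h t x ^ 2 - κ ^ 2 + q t x
  have cht : Continuous (uncurry ht) := by unfold uncurry at *; fun_prop
  have chx : Continuous (uncurry hx) := by unfold uncurry at *; fun_prop
  have hd : ∀ t y, HasDerivAt (fun t => ζ y * h t (y + (b + v * t)))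
      (ζ y * (ht t (y + (b + v * t)) + v * hx t (y + (b + v * t)))) t := by
    intro t y
    have h1 : HasDerivAt (fun t => y + (b + v * t)) v t := by
      simpa using ((hasDerivAt_id t).const_mul v).const_add b |>.const_add y
    have h2 := hasDerivAt_along_curve H.dt H.dx cht chx h1
    refine (h2.const_mul (ζ y)).congr_deriv ?_
    simp only [ht, hx]
    ring
  have cF : Continuous (uncurry fun t y => ζ y * h t (y + (b + v * t))) := by
    unfold uncurry at *; fun_prop
  have cF' : Continuous (uncurry fun t y =>
      ζ y * (ht t (y + (b + v * t)) + v * hx t (y + (b + v * t)))) := by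
    unfold uncurry at *; fun_prop
  refine (hasDerivAt_intervalIntegral_param (-1) 1 t cF cF' hd).congr_deriv ?_
  have cG : Continuous fun y => ζ1 y * ((6 * κ ^ 2 - v) * h t (y + (b + v * t)) -
        2 * h t (y + (b + v * t)) ^ 3) + ζ3 y * h t (y + (b + v * t)) := by
    have := ch.uncurry_left t
    fun_prop
  rw [← sub_eq_zero, ← intervalIntegral.integral_sub ((cF'.uncurry_left t).intervalIntegrable _ _)
    (cG.intervalIntegrable _ _)]
  have key : ∀ y, HasDerivAt (fun y => ζ y * (v * h t (y + (b + v * t)) - q1 t (y + (b + v * t)) -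
      (4 * κ ^ 2 + 2 * q t (y + (b + v * t))) * h t (y + (b + v * t))) +
      ζ1 y * (h t (y + (b + v * t)) ^ 2 - κ ^ 2 + q t (y + (b + v * t))) -
      ζ2 y * h t (y + (b + v * t))) (ζ y * (ht t (y + (b + v * t)) + v * hx t (y + (b + v * t))) -
      (ζ1 y * ((6 * κ ^ 2 - v) * h t (y + (b + v * t)) -
        2 * h t (y + (b + v * t)) ^ 3) + ζ3 y * h t (y + (b + v * t)))) y := by
    intro y
    have e := (H.dx t (y + (b + v * t))).comp_add_const y (b + v * t)
    have e0 := (hq.d0 t (y + (b + v * t))).comp_add_const y (b + v * t)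
    have e1 := (hq.d1 t (y + (b + v * t))).comp_add_const y (b + v * t)
    refine (((d0 y).fun_mul (((e.const_mul v).fun_sub e1).fun_sub
      (((e0.const_mul 2).const_add (4 * κ ^ 2)).fun_mul e))).fun_add ((d1 y).fun_mul
      (((e.fun_pow 2).sub_const (κ ^ 2)).fun_add e0))).fun_sub ((d2 y).fun_mul e) |>.congr_deriv ?_
    simp only [ht, hx]
    ring
  have := intervalIntegral.integral_eq_sub_of_hasDerivAt (a := -1) (b := 1)
    (fun y _ => key y) (((cF'.uncurry_left t).sub cG).intervalIntegrable _ _)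
  refine this.trans ?_
  obtain ⟨a1, a2, a3, -⟩ := hs 1 (by simp)
  obtain ⟨b1, b2, b3, -⟩ := hs (-1) (by simp)
  rw [a1, a2, a3, b1, b2, b3]
  ring

/-- Rate of change of the average over a window in which the Riccati function is close to a
hyperbolic tangent. -/
theorem window_rate_tanh {ζ ζ1 ζ2 ζ3 : ℝ → ℝ}
    (d0 : ∀ x, HasDerivAt ζ (ζ1 x) x) (d1 : ∀ x, HasDerivAt ζ1 (ζ2 x) x)
    (d2 : ∀ x, HasDerivAt ζ2 (ζ3 x) x) (c0 : Continuous ζ) (c1 : Continuous ζ1)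
    (c3 : Continuous ζ3)
    (hs : ∀ x, 1 ≤ |x| → ζ x = 0 ∧ ζ1 x = 0 ∧ ζ2 x = 0 ∧ ζ3 x = 0) (κ z v : ℝ) :
    ∫ y in (-1)..1, (ζ1 y * ((6 * κ ^ 2 - v) * (κ * tanh (κ * (y - z))) -
        2 * (κ * tanh (κ * (y - z))) ^ 3) + ζ3 y * (κ * tanh (κ * (y - z)))) =
      (v - 4 * κ ^ 2) * ∫ y in (-1)..1, ζ y * (κ ^ 2 / cosh (κ * (y - z)) ^ 2) := by
  have ct := continuous_tanh
  have cc : Continuous fun y => κ ^ 2 / cosh (κ * (y - z)) ^ 2 :=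
    continuous_const.div (by fun_prop) fun y => (pow_pos (cosh_pos _) 2).ne'
  have cG : Continuous fun y => (ζ1 y * ((6 * κ ^ 2 - v) * (κ * tanh (κ * (y - z))) -
        2 * (κ * tanh (κ * (y - z))) ^ 3) + ζ3 y * (κ * tanh (κ * (y - z)))) := by fun_prop
  have cF : Continuous fun y => (v - 4 * κ ^ 2) * (ζ y * (κ ^ 2 / cosh (κ * (y - z)) ^ 2)) := by
    fun_prop
  rw [← intervalIntegral.integral_const_mul, ← sub_eq_zero,
    ← intervalIntegral.integral_sub (cG.intervalIntegrable _ _) (cF.intervalIntegrable _ _)]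
  have hsq : ∀ y, κ ^ 2 / cosh (κ * (y - z)) ^ 2 = κ ^ 2 - (κ * tanh (κ * (y - z))) ^ 2 := by
    intro y
    have := one_sub_tanh_sq (κ * (y - z))
    rw [mul_pow]
    linear_combination -κ ^ 2 * this
  have key : ∀ y, HasDerivAt (fun y => ζ2 y * (κ * tanh (κ * (y - z))) -
      ζ1 y * (κ ^ 2 - (κ * tanh (κ * (y - z))) ^ 2) + ζ y * (4 * κ ^ 2 - v) *
        (κ * tanh (κ * (y - z))))
      ((ζ1 y * ((6 * κ ^ 2 - v) * (κ * tanh (κ * (y - z))) -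
        2 * (κ * tanh (κ * (y - z))) ^ 3) + ζ3 y * (κ * tanh (κ * (y - z)))) -
        (v - 4 * κ ^ 2) * (ζ y * (κ ^ 2 / cosh (κ * (y - z)) ^ 2))) y := by
    intro y
    have e : HasDerivAt (fun y => κ * tanh (κ * (y - z)))
        (κ ^ 2 - (κ * tanh (κ * (y - z))) ^ 2) y := hasDerivAt_tanh_mul κ z y
    refine ((((d2 y).fun_mul e).fun_sub ((d1 y).fun_mul ((e.fun_pow 2).const_sub (κ ^ 2)))).fun_add
      (((d0 y).mul_const (4 * κ ^ 2 - v)).fun_mul e)).congr_deriv ?_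
    rw [hsq]
    ring
  have := intervalIntegral.integral_eq_sub_of_hasDerivAt (a := -1) (b := 1)
    (fun y _ => key y) ((cG.sub cF).intervalIntegrable _ _)
  refine this.trans ?_
  obtain ⟨a1, a2, a3, -⟩ := hs 1 (by simp)
  obtain ⟨b1, b2, b3, -⟩ := hs (-1) (by simp)
  rw [a1, a2, a3, b1, b2, b3]
  ring

/-- The window average keeps its sign if the Riccati function is close to a hyperbolic tangent
around each of its zeros in the window. -/
theorem RiccatiFlow.exists_sign_window {k0 K V ε : ℝ} (hk0 : 0 < k0) (hK : 0 < K) (hV : 0 < V)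
    (hε : 0 < ε) : ∃ s0, 0 < s0 ∧ ∀ (κ v b σ : ℝ) (q q1 q2 q3 h : ℝ → ℝ → ℝ),
      KdVReg q q1 q2 q3 → RiccatiFlow q q1 q2 κ h → κ ∈ Icc k0 K → (σ = 1 ∨ σ = -1) → |v| ≤ V →
      ε ≤ σ * (v - 4 * κ ^ 2) → (∀ x, |x - b| ≤ 1 → 0 < σ * h 0 x) →
      (∀ t, 0 ≤ t → ∀ X, |X - (b + v * t)| ≤ 1 → h t X = 0 → ∀ x, |x - X| ≤ 2 →
        |h t x - κ * tanh (κ * (x - X))| ≤ s0) →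
      ∀ t, 0 ≤ t → ∃ x, |x - (b + v * t)| ≤ 1 ∧ 0 < σ * h t x := by
  obtain ⟨ζ, ζ1, ζ2, ζ3, d0, d1, d2, c0, c1, c2, c3, hζ0, -, hζ1, hs⟩ := exists_bump
  obtain ⟨Z1, hZ1⟩ := (isCompact_Icc (a := (-1 : ℝ)) (b := 1)).exists_bound_of_continuousOn
    c1.continuousOn
  obtain ⟨Z3, hZ3⟩ := (isCompact_Icc (a := (-1 : ℝ)) (b := 1)).exists_bound_of_continuousOn
    c3.continuousOn
  obtain ⟨Z, hZ⟩ : ∃ Z, Z = |Z1| + |Z3| + 1 := ⟨_, rfl⟩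
  have hZ0 : 0 < Z := by rw [hZ]; positivity
  have hm0 : 0 < ∫ y in (-1)..1, ζ y :=
    intervalIntegral.integral_pos (by norm_num) c0.continuousOn (fun y _ => hζ0 y)
      ⟨0, by norm_num, by rw [hζ1 0 (by norm_num)]; norm_num⟩
  obtain ⟨m, hm⟩ : ∃ m, m = ∫ y in (-1)..1, ζ y := ⟨_, rfl⟩
  rw [← hm] at hm0
  obtain ⟨M, hM⟩ : ∃ M, M = 6 * K ^ 2 + V + 6 * (K + 1) ^ 2 + 1 := ⟨_, rfl⟩
  have hM0 : 0 < M := by rw [hM]; positivity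
  obtain ⟨c, hc⟩ : ∃ c, c = k0 ^ 2 / cosh (K * 2) ^ 2 := ⟨_, rfl⟩
  have hc0 : 0 < c := by have := cosh_pos (K * 2); rw [hc]; positivity
  refine ⟨min 1 (ε * (c * m) / (4 * (Z * M))), by positivity,
    fun κ v b σ q q1 q2 q3 h hq H hκ hσ hv hεv h0 hT => ?_⟩
  obtain ⟨s, hs_def⟩ : ∃ s, s = min 1 (ε * (c * m) / (4 * (Z * M))) := ⟨_, rfl⟩
  rw [← hs_def] at hT
  have hs0 : 0 < s := by rw [hs_def]; positivity
  have hs1 : s ≤ 1 := hs_def ▸ min_le_left _ _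
  have hs2 : 4 * (Z * M) * s ≤ ε * (c * m) := by
    have : s ≤ ε * (c * m) / (4 * (Z * M)) := hs_def ▸ min_le_right _ _
    rw [le_div_iff₀ (by positivity)] at this
    linarith
  have hκ0 : 0 < κ := hk0.trans_le hκ.1
  have ch : ∀ t, Continuous (h t) := fun t => H.c.uncurry_left t
  have cw : ∀ t, Continuous fun y => ζ y * h t (y + (b + v * t)) := fun t => by
    have := ch t
    fun_prop
  have sgn : ∀ t, ∀ ρ : ℝ, (∀ x, |x - (b + v * t)| ≤ 1 → 0 < ρ * h t x) →
      0 < ρ * ∫ y in (-1)..1, ζ y * h t (y + (b + v * t)) := by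
    intro t ρ hρ
    rw [← intervalIntegral.integral_const_mul]
    have hpos : ∀ y ∈ Icc (-1 : ℝ) 1, 0 < ρ * h t (y + (b + v * t)) := fun y hy =>
      hρ _ (by rw [add_sub_cancel_right]; exact abs_le.2 hy)
    refine intervalIntegral.integral_pos (by norm_num)
      (continuous_const.mul (cw t)).continuousOn (fun y hy => ?_) ⟨0, by norm_num, ?_⟩
    · have := mul_nonneg (hζ0 y) (hpos y ⟨hy.1.le, hy.2⟩).le
      linarith
    · have := hpos 0 (by norm_num)
      rw [hζ1 0 (by norm_num)]
      linarith
  have hG := fun t => (H.hasDerivAt_window hq d0 d1 d2 c0 c1 c3 hs b v t).const_mul σ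
  have main : ∀ t, 0 ≤ t → 0 < σ * ∫ y in (-1)..1, ζ y * h t (y + (b + v * t)) := by
    intro t ht
    refine pos_of_deriv_pos_of_eq_zero hG (sgn 0 σ (by simpa using h0)) (fun t ht hz => ?_) ht
    have hσ0 : σ ≠ 0 := by rcases hσ with rfl | rfl <;> norm_num
    have hz := (mul_eq_zero.1 hz).resolve_left hσ0
    obtain ⟨X, hX1, hX0⟩ : ∃ X, |X - (b + v * t)| ≤ 1 ∧ h t X = 0 := by
      by_contra! hne
      have hne' : ∀ x ∈ Icc (b + v * t - 1) (b + v * t + 1), h t x ≠ 0 := fun x hx =>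
        hne x (abs_le.2 ⟨by linarith [hx.1], by linarith [hx.2]⟩)
      have hmem : ∀ x, |x - (b + v * t)| ≤ 1 → x ∈ Icc (b + v * t - 1) (b + v * t + 1) :=
        fun x hx => ⟨by linarith [(abs_le.1 hx).1], by linarith [(abs_le.1 hx).2]⟩
      have ivt : ∀ x ∈ Icc (b + v * t - 1) (b + v * t + 1),
          ∀ y ∈ Icc (b + v * t - 1) (b + v * t + 1), h t x < 0 → 0 < h t y → False := by
        intro x hx y hy h1 h2
        obtain ⟨z, hz, hz0⟩ := isPreconnected_Icc.intermediate_value hx hy (ch t).continuousOn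
          ⟨h1.le, h2.le⟩
        exact hne' z hz hz0
      have hcm : b + v * t ∈ Icc (b + v * t - 1) (b + v * t + 1) := ⟨by linarith, by linarith⟩
      rcases lt_or_gt_of_ne (hne' _ hcm) with hneg | hpos
      · have := sgn t (-1) fun x hx => by
          rcases lt_or_gt_of_ne (hne' _ (hmem x hx)) with h1 | h1
          · linarith
          · exact (ivt _ hcm _ (hmem x hx) hneg h1).elim
        linarith
      · have := sgn t 1 fun x hx => by
          rcases lt_or_gt_of_ne (hne' _ (hmem x hx)) with h1 | h1
          · exact (ivt _ (hmem x hx) _ hcm h1 hpos).elim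
          · linarith
        linarith
    have hclose := hT t ht X hX1 hX0
    obtain ⟨z, hz_def⟩ : ∃ z, z = X - (b + v * t) := ⟨_, rfl⟩
    rw [← hz_def] at hX1
    have hyz : ∀ y ∈ Icc (-1 : ℝ) 1, |y - z| ≤ 2 := fun y hy => by
      have := abs_le.1 hX1
      exact abs_le.2 ⟨by linarith [hy.1], by linarith [hy.2]⟩
    have hd : ∀ y ∈ Icc (-1 : ℝ) 1,
        |h t (y + (b + v * t)) - κ * tanh (κ * (y - z))| ≤ s := fun y hy => by
      have e : y + (b + v * t) - X = y - z := by rw [hz_def]; ring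
      have := hclose (y + (b + v * t)) (by rw [e]; exact hyz y hy)
      rwa [e] at this
    have ct := continuous_tanh
    have cht := ch t
    have cc : Continuous fun y => κ ^ 2 / cosh (κ * (y - z)) ^ 2 :=
      continuous_const.div (by fun_prop) fun y => (pow_pos (cosh_pos _) 2).ne'
    have hlow : c * m ≤ ∫ y in (-1)..1, ζ y * (κ ^ 2 / cosh (κ * (y - z)) ^ 2) := by
      rw [hm, ← intervalIntegral.integral_const_mul]
      refine intervalIntegral.integral_mono_on (by norm_num)
        ((continuous_const.mul c0).intervalIntegrable _ _) ((c0.mul cc).intervalIntegrable _ _)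
        fun y hy => ?_
      rw [mul_comm]
      refine mul_le_mul_of_nonneg_left ?_ (hζ0 y)
      rw [hc]
      have h1 : cosh (κ * (y - z)) ≤ cosh (K * 2) := by
        rw [cosh_le_cosh, abs_mul, abs_mul, abs_of_pos hκ0, abs_of_pos hK, abs_two]
        exact mul_le_mul hκ.2 (hyz y hy) (abs_nonneg _) hK.le
      exact div_le_div₀ (sq_nonneg _) (pow_le_pow_left₀ hk0.le hκ.1 2) (pow_pos (cosh_pos _) 2)
        (pow_le_pow_left₀ (cosh_pos _).le h1 2)
    have hrate := window_rate_tanh d0 d1 d2 c0 c1 c3 hs κ z v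
    have cA : Continuous fun y => (ζ1 y * ((6 * κ ^ 2 - v) * h t (y + (b + v * t)) -
        2 * h t (y + (b + v * t)) ^ 3) + ζ3 y * h t (y + (b + v * t))) := by fun_prop
    have cB : Continuous fun y => (ζ1 y * ((6 * κ ^ 2 - v) * (κ * tanh (κ * (y - z))) -
        2 * (κ * tanh (κ * (y - z))) ^ 3) + ζ3 y * (κ * tanh (κ * (y - z)))) := by fun_prop
    have hdiff := intervalIntegral.norm_integral_le_of_norm_le_const (a := -1) (b := 1)
      (C := Z * M * s) (f := fun y => (ζ1 y * ((6 * κ ^ 2 - v) * h t (y + (b + v * t)) -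
        2 * h t (y + (b + v * t)) ^ 3) + ζ3 y * h t (y + (b + v * t))) -
        (ζ1 y * ((6 * κ ^ 2 - v) * (κ * tanh (κ * (y - z))) -
        2 * (κ * tanh (κ * (y - z))) ^ 3) + ζ3 y * (κ * tanh (κ * (y - z))))) (by
      intro y hy
      rw [uIoc_of_le (by norm_num)] at hy
      have hy : y ∈ Icc (-1 : ℝ) 1 := ⟨hy.1.le, hy.2⟩
      have hT := (abs_mul_tanh_lt hκ0 (κ * (y - z))).le.trans hκ.2
      have hd := hd y hy
      have z1 : |ζ1 y| ≤ Z := by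
        have := hZ1 y hy
        rw [norm_eq_abs] at this
        rw [hZ]; linarith [le_abs_self Z1, abs_nonneg Z3]
      have z3 : |ζ3 y| ≤ Z := by
        have := hZ3 y hy
        rw [norm_eq_abs] at this
        rw [hZ]; linarith [le_abs_self Z3, abs_nonneg Z1]
      generalize κ * tanh (κ * (y - z)) = T at hT hd ⊢
      generalize h t (y + (b + v * t)) = η at hd ⊢
      have hη : |η| ≤ K + 1 := by
        have := abs_sub_abs_le_abs_sub η T
        linarith
      have e : ζ1 y * ((6 * κ ^ 2 - v) * η - 2 * η ^ 3) + ζ3 y * η -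
          (ζ1 y * ((6 * κ ^ 2 - v) * T - 2 * T ^ 3) + ζ3 y * T) =
          (ζ1 y * ((6 * κ ^ 2 - v) - 2 * (η ^ 2 + η * T + T ^ 2)) + ζ3 y) * (η - T) := by ring
      rw [norm_eq_abs, e, abs_mul]
      refine mul_le_mul ?_ hd (abs_nonneg _) (by positivity)
      have hκ2 : κ ^ 2 ≤ K ^ 2 := pow_le_pow_left₀ hκ0.le hκ.2 2
      have q1 : η ^ 2 ≤ (K + 1) ^ 2 := sq_le_sq' (abs_le.1 hη).1 (abs_le.1 hη).2
      have hT' : |T| ≤ K + 1 := by linarith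
      have q2 : T ^ 2 ≤ (K + 1) ^ 2 := sq_le_sq' (abs_le.1 hT').1 (abs_le.1 hT').2
      have q3 : |η * T| ≤ (K + 1) ^ 2 := by
        rw [abs_mul, sq]; exact mul_le_mul hη hT' (abs_nonneg _) (by positivity)
      have hb : |(6 * κ ^ 2 - v) - 2 * (η ^ 2 + η * T + T ^ 2)| ≤ M - 1 := by
        rw [hM]
        rw [abs_le] at q3 hv ⊢
        constructor <;> linarith [q3.1, q3.2, hv.1, hv.2, sq_nonneg η, sq_nonneg T, sq_nonneg κ]
      have h1 := abs_add_le (ζ1 y * ((6 * κ ^ 2 - v) - 2 * (η ^ 2 + η * T + T ^ 2))) (ζ3 y)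
      rw [abs_mul] at h1
      have h2 := mul_le_mul z1 hb (abs_nonneg _) hZ0.le
      linarith)
    rw [intervalIntegral.integral_sub (cA.intervalIntegrable _ _) (cB.intervalIntegrable _ _),
      hrate, norm_eq_abs] at hdiff
    generalize (∫ y in (-1)..1, (ζ1 y * ((6 * κ ^ 2 - v) * h t (y + (b + v * t)) -
        2 * h t (y + (b + v * t)) ^ 3) + ζ3 y * h t (y + (b + v * t)))) = A at hdiff ⊢
    generalize (∫ y in (-1)..1, ζ y * (κ ^ 2 / cosh (κ * (y - z)) ^ 2)) = I at hdiff hlow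
    have h1 : ε * (c * m) ≤ σ * (v - 4 * κ ^ 2) * I :=
      mul_le_mul hεv hlow (by positivity) (hε.le.trans hεv)
    have h2 : |(1 : ℝ) - -1| = 2 := by norm_num
    rw [h2, abs_le] at hdiff
    have h3 : 0 < ε * (c * m) := by positivity
    rcases hσ with rfl | rfl
    · linarith [hdiff.1, hdiff.2]
    · linarith [hdiff.1, hdiff.2]
  intro t ht
  by_contra! hne
  have hle : 0 ≤ ∫ y in (-1)..1, -σ * (ζ y * h t (y + (b + v * t))) :=
    intervalIntegral.integral_nonneg (by norm_num) fun y hy => by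
      have := mul_nonneg (hζ0 y) (neg_nonneg.2 (hne (y + (b + v * t))
        (by rw [add_sub_cancel_right]; exact abs_le.2 hy)))
      linarith
  rw [intervalIntegral.integral_const_mul] at hle
  linarith [main t ht]

/-- The zero of the Riccati function moves at a speed close to `4 κ ^ 2`. -/
theorem RiccatiFlow.exists_zero {k0 K V ε : ℝ} (hk0 : 0 < k0) (hK : 0 < K) (hV : 0 < V)
    (hε : 0 < ε) : ∃ s0, 0 < s0 ∧ ∀ (κ v b : ℝ) (q q1 q2 q3 h : ℝ → ℝ → ℝ),
      KdVReg q q1 q2 q3 → RiccatiFlow q q1 q2 κ h → κ ∈ Icc k0 K → |v| ≤ V →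
      |v - 4 * κ ^ 2| ≤ ε → (∀ x, |x - (b - 2)| ≤ 1 → h 0 x < 0) →
      (∀ x, |x - (b + 2)| ≤ 1 → 0 < h 0 x) →
      (∀ t, 0 ≤ t → ∀ X, b - 3 + (v - 2 * ε) * t ≤ X → h t X = 0 → ∀ x, |x - X| ≤ 2 →
        |h t x - κ * tanh (κ * (x - X))| ≤ s0) →
      ∀ t, 0 ≤ t → ∃ X, |X - b - v * t| ≤ 3 + 2 * ε * t ∧ h t X = 0 := by
  obtain ⟨s0, hs0, H0⟩ := RiccatiFlow.exists_sign_window hk0 hK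
    (show 0 < V + 2 * ε by positivity) hε
  refine ⟨s0, hs0, fun κ v b q q1 q2 q3 h hq H hκ hv hvκ hl hr hT t ht => ?_⟩
  have hvκ := abs_le.1 hvκ
  have hv := abs_le.1 hv
  obtain ⟨x, hx, hx0⟩ := H0 κ (v - 2 * ε) (b - 2) (-1) q q1 q2 q3 h hq H hκ (Or.inr rfl)
    (abs_le.2 ⟨by linarith, by linarith⟩) (by linarith) (fun x hx => by linarith [hl x hx])
    (fun t ht X hX => hT t ht X (by linarith [(abs_le.1 hX).1])) t ht
  obtain ⟨y, hy, hy0⟩ := H0 κ (v + 2 * ε) (b + 2) 1 q q1 q2 q3 h hq H hκ (Or.inl rfl)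
    (abs_le.2 ⟨by linarith, by linarith⟩) (by linarith) (fun x hx => by linarith [hr x hx])
    (fun t ht X hX => hT t ht X (by
      have : 0 ≤ 4 * ε * t := by positivity
      linarith [(abs_le.1 hX).1])) t ht
  have hεt : 0 ≤ ε * t := by positivity
  have hx := abs_le.1 hx
  have hy := abs_le.1 hy
  have hm : ∀ z, b - 3 + (v - 2 * ε) * t ≤ z → z ≤ b + 3 + (v + 2 * ε) * t →
      |z - b - v * t| ≤ 3 + 2 * ε * t := fun z h1 h2 =>
    abs_le.2 ⟨by linarith, by linarith⟩
  have hxy : x ≤ y := by linarith [hx.1, hx.2, hy.1, hy.2]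
  obtain ⟨z, hz, hz0⟩ := intermediate_value_Icc hxy (H.c.uncurry_left t).continuousOn
    (show (0 : ℝ) ∈ Icc (h t x) (h t y) from ⟨by linarith, by linarith⟩)
  exact ⟨z, hm z (by linarith [hx.1, hz.1]) (by linarith [hy.2, hz.2]), hz0⟩

theorem monotone_tanh : Monotone tanh :=
  monotone_of_deriv_nonneg (fun x => (hasDerivAt_tanh x).differentiableAt) fun x => by
    rw [(hasDerivAt_tanh x).deriv, one_sub_tanh_sq]
    positivity

theorem exists_pos_forall_le {ι : Type*} [Finite ι] {f : ι → ℝ} (hf : ∀ i, 0 < f i) :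
    ∃ d, 0 < d ∧ ∀ i, d ≤ f i := by
  cases isEmpty_or_nonempty ι with
  | inl h => exact ⟨1, one_pos, fun i => h.elim i⟩
  | inr h =>
    obtain ⟨i, hi⟩ := Finite.exists_min f
    exact ⟨f i, hf i, hi⟩

theorem exists_exp_neg_mul_le {γ σ : ℝ} (hγ : 0 < γ) (hσ : 0 < σ) :
    ∃ L0, 0 < L0 ∧ ∀ L, L0 ≤ L → exp (-(γ * L)) ≤ σ := by
  refine ⟨1 / (γ * σ), by positivity, fun L hL => ?_⟩
  have h1 : 1 ≤ γ * L * σ := by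
    have := mul_le_mul_of_nonneg_left hL (mul_pos hγ hσ).le
    rw [mul_one_div_cancel (mul_pos hγ hσ).ne'] at this
    linarith
  have h2 := add_one_le_exp (γ * L)
  rw [exp_neg, inv_le_comm₀ (exp_pos _) hσ]
  refine le_trans ?_ h2
  rw [inv_le_iff_one_le_mul₀ hσ]
  linarith

namespace WaveParams

variable {n : ℕ} {k0 d K κ : ℝ} {k : Fin n → ℝ}

theorem phase_mem (h : WaveParams k0 d K κ k) (j : Fin n) :
    phase κ (k j) ∈ Icc 0 (artanh (1 - d / K) / k0) := by
  have h1 := h.k0_le j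
  have hk := h.pos j
  have hg := h.gap j
  have hκ := h.top_pos
  have hd := h.d_pos
  have hK := h.K_pos
  have h0 : 0 ≤ k j / κ := by positivity
  have h2 : k j / κ ≤ 1 - d / K := by
    have : d / K ≤ d / κ := div_le_div_of_nonneg_left hd.le hκ h.top_le
    have : k j / κ ≤ (κ - d) / κ := by gcongr; linarith
    rw [sub_div, div_self hκ.ne'] at this
    linarith
  have h3 : 0 ≤ artanh (k j / κ) := artanh_nonneg h0
  have h4 : artanh (k j / κ) ≤ artanh (1 - d / K) :=
    artanh_le_artanh (by linarith) (by have : 0 < d / K := by positivity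
                                       linarith) h2
  exact ⟨by unfold phase; positivity, div_le_div₀ (h3.trans h4) h4 h.k0_pos h1⟩

theorem tanh_bounds (h : WaveParams k0 d K κ k) {y : ℝ} :
    (1 ≤ y → k0 * tanh k0 ≤ κ * tanh (κ * y)) ∧
      (y ≤ -1 → κ * tanh (κ * y) ≤ -(k0 * tanh k0)) := by
  have key : ∀ y, 1 ≤ y → k0 * tanh k0 ≤ κ * tanh (κ * y) := fun y hy => by
    have h0 := h.k0_pos
    have h1 : k0 ≤ κ * y := by nlinarith [h.k0_le_top, h.top_pos]
    have h2 : 0 ≤ tanh k0 := by simpa using monotone_tanh h0.le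
    exact mul_le_mul h.k0_le_top (monotone_tanh h1) h2 h.top_pos.le
  refine ⟨key y, fun hy => ?_⟩
  have := key (-y) (by linarith)
  rw [mul_neg, tanh_neg] at this
  linarith

theorem sign_of_near_kink (hp : WaveParams k0 d K κ k) {ℓ X s : ℝ} {a : Fin n → ℝ}
    (hs : Separated ℓ X a) {h : ℝ → ℝ} (hh : ∀ x, |h x - kink κ X k a x| ≤ s)
    (hsm : s + n * (K ^ 2 / d * (2 * exp (-(k0 * (ℓ - 3))))) < k0 * tanh k0) :
    (∀ x, |x - (X - 2)| ≤ 1 → h x < 0) ∧ ∀ x, |x - (X + 2)| ≤ 1 → 0 < h x := by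
  have hd := hp.d_pos
  have hG : 0 ≤ n * (K ^ 2 / d * (2 * exp (-(k0 * (ℓ - 3))))) := by positivity
  constructor
  · intro x hx
    have hx := abs_le.1 hx
    have h1 := hp.gsum_le_exp hs (show X - 3 ≤ x by linarith)
    have h2 := (hp.tanh_bounds (y := x - X)).2 (by linarith)
    have h3 := (abs_le.1 (hh x)).2
    rw [kink] at h3
    linarith
  · intro x hx
    have hx := abs_le.1 hx
    have h1 := hp.gsum_nonneg a x
    have h2 := (hp.tanh_bounds (y := x - X)).1 (by linarith)
    have h3 := (abs_le.1 (hh x)).1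
    rw [kink] at h3
    linarith

theorem abs_sub_tanh_le (hp : WaveParams k0 d K κ k) {ℓ X s : ℝ} {a : Fin n → ℝ}
    (hs : Separated ℓ X a) {h : ℝ → ℝ} (hh : ∀ x, |h x - kink κ X k a x| ≤ s) {x : ℝ}
    (hx : |x - X| ≤ 3) : |h x - κ * tanh (κ * (x - X))| ≤
      s + n * (K ^ 2 / d * (2 * exp (-(k0 * (ℓ - 3))))) := by
  have h1 := hp.gsum_le_exp hs (show X - 3 ≤ x by linarith [(abs_le.1 hx).1])
  have h2 := hp.gsum_nonneg a x
  have h3 := abs_le.1 (hh x)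
  rw [kink] at h3
  exact abs_le.2 ⟨by linarith, by linarith⟩

end WaveParams

/-- Stability of trains of solitons with parameters `k`, in a form suitable for induction: the
solitons move at a speed `ε`-close to `4 k ^ 2`. -/
def StableTrain {n : ℕ} (k : Fin n → ℝ) : Prop :=
  ∀ ε, 0 < ε → ∃ σ A γ C : ℝ, 0 < σ ∧ 0 < A ∧ 0 < γ ∧ 0 < C ∧
    ∀ (L α : ℝ) (a : Fin n → ℝ) (q q1 q2 q3 : ℝ → ℝ → ℝ), α + exp (-(γ * L)) ≤ σ →
      (∀ i j, i < j → a i + L ≤ a j) → KdVClass q q1 q2 q3 →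
      L2le (fun x => q 0 x - ∑ j, sol (k j) (x - a j)) α → ∀ t, 0 ≤ t →
      ∃ X : Fin n → ℝ, L2le (fun x => q t x - ∑ j, sol (k j) (x - X j))
        (A * (α + exp (-(γ * L)))) ∧ ∀ j, |X j - a j - 4 * k j ^ 2 * t| ≤ C + ε * t

theorem stableTrain_zero (k : Fin 0 → ℝ) : StableTrain k := by
  refine fun ε _ => ⟨1, 1, 1, 1, one_pos, one_pos, one_pos, one_pos,
    fun L α a q q1 q2 q3 _ _ hq h0 t ht => ⟨a, ?_, fun j => j.elim0⟩⟩
  obtain ⟨M, hM⟩ := hq.bdd t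
  simp only [Finset.univ_eq_empty, Finset.sum_empty, sub_zero] at h0 ⊢
  have hc := l2_conservation hq.toKdVReg ht (M := M + M) fun τ hτ => by
    obtain ⟨-, h1, h2, h3, h4⟩ := hM τ (by rw [abs_of_nonneg hτ.1]; exact hτ.2)
    exact ⟨h1, h2, add_le_add h3 h4⟩
  obtain ⟨-, h1, -⟩ := hM t (abs_of_nonneg ht).le
  have h2 : L2le (q t) α :=
    ⟨hq.c0.uncurry_left t, h0.2.1, h1, hc.le.trans h0.2.2.2⟩
  exact h2.mono (by have := (exp_pos (-(1 * L))).le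
                    linarith)

theorem Separated.of_drift {n : ℕ} {L C e t v b X : ℝ} {k a y : Fin n → ℝ} (ht : 0 ≤ t)
    (ha : ∀ i j, i < j → a i + L ≤ a j) (hb : ∀ j, a j + L ≤ b)
    (hL : 4 * C + 6 ≤ L) (hC : 0 < C) (hk : ∀ i j, i < j → 4 * k i ^ 2 + 2 * e ≤ 4 * k j ^ 2)
    (hv : ∀ j, 4 * k j ^ 2 + 3 * e ≤ v) (hX : b - 3 + (v - 2 * e) * t ≤ X)
    (hy : ∀ j, |y j - a j - 4 * k j ^ 2 * t| ≤ C + e * t) : Separated (L / 2) X y := by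
  have key : ∀ i j, i < j → L / 2 ≤ y j - y i := fun i j hij => by
    have h1 := abs_le.1 (hy i)
    have h2 := abs_le.1 (hy j)
    have h3 := mul_le_mul_of_nonneg_right (hk i j hij) ht
    linarith [ha i j hij]
  refine ⟨fun i j hij => ?_, fun j => ?_⟩
  · rcases lt_or_gt_of_ne hij with h | h
    · rw [abs_sub_comm]
      exact (key i j h).trans (le_abs_self _)
    · exact (key j i h).trans (le_abs_self _)
  · have h1 := abs_le.1 (hy j)
    have h2 := mul_le_mul_of_nonneg_right (hv j) ht
    linarith [hb j]

theorem eventually_mul_lt (c : ℝ) {b : ℝ} (hb : 0 < b) : ∀ᶠ σ in 𝓝[>] (0 : ℝ), c * σ < b :=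
  (((continuous_const.mul continuous_id).tendsto' 0 0 (by simp)).eventually_lt_const hb).filter_mono
    nhdsWithin_le_nhds

set_option maxHeartbeats 1000000 in
theorem StableTrain.succ {n : ℕ} (ih : ∀ k : Fin n → ℝ, (∀ j, 0 < k j) → StrictMono k →
    StableTrain k) {k : Fin (n + 1) → ℝ} (hk : ∀ j, 0 < k j) (hmono : StrictMono k) :
    StableTrain k := by
  intro ε hε
  obtain ⟨k0, hk0, hkk⟩ : ∃ k0, 0 < k0 ∧ ∀ j, 2 * k0 ≤ k j :=
    ⟨k 0 / 2, half_pos (hk 0), fun j => by linarith [hmono.monotone (Fin.zero_le j)]⟩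
  obtain ⟨d, hd, hdk, hgap⟩ : ∃ d, 0 < d ∧ d ≤ k0 ∧ ∀ i j, i < j → k i + 2 * d ≤ k j := by
    obtain ⟨d, hd, hd'⟩ := exists_pos_forall_le
      (f := fun p : {p : Fin (n + 1) × Fin (n + 1) // p.1 < p.2} => (k p.1.2 - k p.1.1) / 2)
      fun p => by linarith [hmono p.2]
    exact ⟨min d k0, lt_min hd hk0, min_le_right _ _, fun i j hij => by
      linarith [hd' ⟨(i, j), hij⟩, min_le_left d k0]⟩
  obtain ⟨kn, hkn⟩ : ∃ kn, kn = k (Fin.last n) := ⟨_, rfl⟩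
  obtain ⟨K, hKe⟩ : ∃ K, K = kn + d := ⟨_, rfl⟩
  have hkn0 : 2 * k0 ≤ kn := hkn ▸ hkk _
  have hK : 0 < K := by linarith
  obtain ⟨e, he, heε, hed⟩ : ∃ e, 0 < e ∧ 2 * e ≤ ε ∧ e ≤ d * k0 :=
    ⟨min (ε / 2) (d * k0), lt_min (half_pos hε) (mul_pos hd hk0),
      by linarith [min_le_left (ε / 2) (d * k0)], min_le_right _ _⟩
  have hspeed : ∀ i j, i < j → 4 * k i ^ 2 + 3 * e ≤ 4 * k j ^ 2 := fun i j hij => by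
    have h1 := hgap i j hij
    have h2 := hkk i
    nlinarith [mul_pos hd hk0, mul_le_mul_of_nonneg_left h2 hd.le]
  have hroom : ∀ κ, |κ - kn| ≤ d → WaveParams k0 d K κ (fun j : Fin n => k j.castSucc) :=
    fun κ hκ => by
      have hκ := abs_le.1 hκ
      exact ⟨hk0, hd, fun j => by linarith [hkk j.castSucc], fun j => by
        linarith [hgap _ _ (Fin.castSucc_lt_last j)], by linarith, by linarith⟩
  obtain ⟨σI, A, γI, C, hσI, hA, hγI, hC, hI⟩ := ih (fun j => k j.castSucc) (fun j => hk _)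
    (fun i j hij => hmono (Fin.castSucc_lt_castSucc_iff.2 hij)) e he
  obtain ⟨δR, CR, hδR, hCR, hR⟩ := removing_soliton n hk0 hd hK
  obtain ⟨δA, CA, hδA, hCA, hAd⟩ := adding_soliton n hk0 hd hK
  obtain ⟨s0, hs0, hZ⟩ := RiccatiFlow.exists_zero hk0 hK
    (show 0 < 4 * kn ^ 2 by have : 0 < kn := by linarith
                            positivity) he
  obtain ⟨Φ, hΦe⟩ : ∃ Φ, Φ = artanh (1 - d / K) / k0 := ⟨_, rfl⟩
  have hΦ : 0 ≤ Φ := by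
    have : d / K ≤ 1 := by rw [div_le_one hK]; linarith
    have := artanh_nonneg (show 0 ≤ 1 - d / K by linarith)
    rw [hΦe]; positivity
  obtain ⟨γ, hγ, hγ1, hγ2⟩ : ∃ γ, 0 < γ ∧ 2 * γ ≤ γI ∧ 2 * γ ≤ k0 :=
    ⟨min γI k0 / 2, half_pos (lt_min hγI hk0), by linarith [min_le_left γI k0],
      by linarith [min_le_right γI k0]⟩
  obtain ⟨G, hGe⟩ : ∃ G, G = n * (K ^ 2 / d * (2 * exp (3 * k0))) := ⟨_, rfl⟩
  have hG : 0 ≤ G := by rw [hGe]; positivity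
  obtain ⟨B, hBe⟩ : ∃ B, B = A * (CR + 1) + 1 := ⟨_, rfl⟩
  have hB : 0 < B := by rw [hBe]; positivity
  have htk : 0 < k0 * tanh k0 := by
    rw [tanh_eq_sinh_div_cosh]
    have := sinh_pos_iff.2 hk0
    have := cosh_pos k0
    positivity
  obtain ⟨Ks, hKs⟩ : ∃ Ks, Ks = 8 * K * √(2 / k0) := ⟨_, rfl⟩
  have hKs0 : 0 ≤ Ks := by rw [hKs]; positivity
  obtain ⟨σ, hσ, hσ1, hσ2, hσ3, hσ4, hσ5, hσ6, hσ7⟩ := ((eventually_mem_nhdsWithin (a := (0:ℝ)) (s := Ioi 0)).and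
    ((eventually_mul_lt 1 hδR).and ((eventually_mul_lt (8 * K * CR) he).and
    ((eventually_mul_lt (CR + 1) hσI).and ((eventually_mul_lt (CR + G) htk).and
    ((eventually_mul_lt B hδA).and ((eventually_mul_lt (CA * B + G) hs0).and
    (eventually_mul_lt 1 (exp_pos (-(γ * (4 * C + 6 + 2 * Φ)))))))))))).exists
  refine ⟨σ, CA * B + Ks * CR, γ, C + 3, hσ, by positivity, hγ, by positivity,
    fun L α a q q1 q2 q3 hS ha hq h0 t ht => ?_⟩
  have hα := h0.2.1
  have hL : 4 * C + 6 + 2 * Φ ≤ L := by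
    have h1 : exp (-(γ * L)) < exp (-(γ * (4 * C + 6 + 2 * Φ))) := by linarith
    rw [exp_lt_exp, neg_lt_neg_iff] at h1
    exact (lt_of_mul_lt_mul_left h1 hγ.le).le
  have hL0 : 0 ≤ L := by linarith
  have hE1 : exp (-(k0 * (L / 2))) ≤ exp (-(γ * L)) := exp_le_exp.2 (by nlinarith)
  have hE2 : exp (-(γI * (L - Φ))) ≤ exp (-(γ * L)) := exp_le_exp.2 (by nlinarith)
  have hE3 : n * (K ^ 2 / d * (2 * exp (-(k0 * (L / 2 - 3))))) = G * exp (-(k0 * (L / 2))) := by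
    rw [hGe, show -(k0 * (L / 2 - 3)) = 3 * k0 + -(k0 * (L / 2)) by ring, exp_add]
    ring
  have hE0 := (exp_pos (-(k0 * (L / 2)))).le
  obtain ⟨S, hSe⟩ : ∃ S, S = α + exp (-(γ * L)) := ⟨_, rfl⟩
  have hαS : α + exp (-(k0 * (L / 2))) ≤ S := by linarith
  have hSσ : S ≤ σ := hSe ▸ hS
  have hS0 : 0 ≤ S := by linarith
  have hES : exp (-(γ * L)) ≤ S := by linarith
  rw [← hSe]
  have hmul : ∀ {c b : ℝ}, 0 ≤ c → c * σ < b → c * S < b := fun hc h =>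
    (mul_le_mul_of_nonneg_left hSσ hc).trans_lt h
  have hσ1 := hmul one_pos.le hσ1
  have hσ2 := hmul (by positivity) hσ2
  have hσ3 := hmul (by positivity) hσ3
  have hσ4 := hmul (by positivity) hσ4
  have hσ5 := hmul (by positivity) hσ5
  have hσ6 := hmul (by positivity) hσ6
  have hGS : G * exp (-(k0 * (L / 2))) ≤ G * S := mul_le_mul_of_nonneg_left (by linarith) hG
  have hCRS : CR * (α + exp (-(k0 * (L / 2)))) ≤ CR * S := mul_le_mul_of_nonneg_left hαS hCR.le
  have hsep0 : Separated (L / 2) (a (Fin.last n)) fun j => a (Fin.castSucc j) := by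
    refine Separated.of_drift (k := fun _ => 0) (C := C) (e := -1) (v := 3) (t := 0) (b := a (Fin.last n))
      le_rfl (fun i j hij => ha _ _ (Fin.castSucc_lt_castSucc_iff.2 hij))
      (fun j => ha _ _ (Fin.castSucc_lt_last j)) (by linarith) hC
      (fun _ _ _ => by norm_num) (fun _ => by norm_num) (by linarith) (fun j => by simp [hC.le])
  have h0' : L2le (fun x => q 0 x - (sol kn (x - a (Fin.last n)) +
      ∑ j : Fin n, sol (k j.castSucc) (x - a j.castSucc))) α := by
    convert h0 using 3
    rw [Fin.sum_univ_castSucc, hkn, add_comm]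
  obtain ⟨κ, g, hκd, hκS, hgx, hgk, hgw⟩ := hR kn (a (Fin.last n)) (L / 2) α
    (fun j => k j.castSucc) (fun j => a j.castSucc) (q 0) hroom hsep0 (by linarith) h0'
  have hκS' : |κ - kn| ≤ CR * S := hκS.trans hCRS
  obtain ⟨h, hh0, hhc, hhx, hht⟩ := exists_riccati_evolution hq κ hgx
  have H : RiccatiFlow q q1 q2 κ h := ⟨hhc, hhx, hht⟩
  obtain ⟨w1, w2, w3, hw⟩ := H.darboux hq
  have hp := hroom κ hκd
  have hpn := hroom kn (by simp [hd.le])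
  have hph := fun j => hp.phase_mem j
  rw [← hΦe] at hph
  have hIH := hI (L - Φ) (CR * S) (fun j => a j.castSucc + phase κ (k j.castSucc)) _ w1 w2 w3
    (by linarith) (fun i j hij => by
      linarith [ha _ _ (Fin.castSucc_lt_castSucc_iff.2 hij), (hph i).2, (hph j).1]) hw (by
      simp only [hh0, sub_add_eq_sub_sub]
      exact hgw.mono hCRS)
  choose! Y hY hYd using hIH
  have hδt : A * (CR * S + exp (-(γI * (L - Φ)))) + exp (-(k0 * (L / 2))) ≤ B * S := by
    have : A * (CR * S + exp (-(γI * (L - Φ)))) ≤ A * (CR * S + S) :=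
      mul_le_mul_of_nonneg_left (by linarith) hA.le
    rw [hBe]
    linarith
  have hnear : ∀ t, 0 ≤ t → ∀ X, a (Fin.last n) - 3 + (4 * kn ^ 2 - 2 * e) * t ≤ X → h t X = 0 →
      (∀ x, |x - X| ≤ 2 → |h t x - κ * tanh (κ * (x - X))| ≤ s0) ∧
      L2le (fun x => q t x - (sol κ (x - X) +
        ∑ j, sol (k (Fin.castSucc j)) (x - (Y t j - phase κ (k j.castSucc))))) (CA * (B * S)) := by
    intro t ht X hX hX0
    have hsep : Separated (L / 2) X fun j => Y t j - phase κ (k j.castSucc) := by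
      refine Separated.of_drift (C := C) (e := e) (k := fun j => k j.castSucc)
        (a := fun j => a j.castSucc) ht
        (fun i j hij => ha _ _ (Fin.castSucc_lt_castSucc_iff.2 hij))
        (fun j => ha _ _ (Fin.castSucc_lt_last j)) (by linarith) hC
        (fun i j hij => by
          linarith [hspeed _ _ (Fin.castSucc_lt_castSucc_iff.2 hij)])
        (fun j => hkn ▸ hspeed _ _ (Fin.castSucc_lt_last j)) hX fun j => ?_
      convert hYd t ht j using 2
      ring
    obtain ⟨h1, h2⟩ := hAd κ X (L / 2) (A * (CR * S + exp (-(γI * (L - Φ)))))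
      (fun j => k j.castSucc) (fun j => Y t j - phase κ (k j.castSucc)) (h t) _ hp hsep
      (by linarith) (hw.c0.uncurry_left t)
      (fun x => (hhx t x).congr_deriv (by ring)) hX0 (by
        simp only [sub_sub, sub_add_cancel]
        exact hY t ht)
    have hCB := mul_le_mul_of_nonneg_left hδt hCA.le
    refine ⟨fun x hx => ?_, ?_⟩
    · have := hp.abs_sub_tanh_le hsep h1 (x := x) (by linarith)
      rw [hE3] at this
      linarith
    · refine L2le.mono ?_ hCB
      convert h2 using 3
      ring
  have hpos : 0 < κ + kn := by linarith [hp.top_pos]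
  obtain ⟨X, hXd, hX0⟩ := hZ κ (4 * kn ^ 2) (a (Fin.last n)) q q1 q2 q3 h hq.toKdVReg H
    ⟨hp.k0_le_top, hp.top_le⟩ (abs_of_nonneg (by positivity)).le (by
      rw [show 4 * kn ^ 2 - 4 * κ ^ 2 = -(4 * (κ + kn) * (κ - kn)) by ring, abs_neg, abs_mul,
        abs_of_pos (by positivity)]
      have h1 : 4 * (κ + kn) ≤ 8 * K := by linarith [hp.top_le]
      have := mul_le_mul h1 hκS' (abs_nonneg _) (by positivity)
      linarith)
    (hh0 ▸ (hpn.sign_of_near_kink hsep0 hgk (by rw [hE3]; linarith)).1)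
    (hh0 ▸ (hpn.sign_of_near_kink hsep0 hgk (by rw [hE3]; linarith)).2)
    (fun t ht X hX hX0 => (hnear t ht X hX hX0).1) t ht
  have hXl := (hnear t ht X (by linarith [(abs_le.1 hXd).1]) hX0).2
  refine ⟨Fin.snoc (α := fun _ => ℝ) (fun j => Y t j - phase κ (k j.castSucc)) X, ?_, fun j => ?_⟩
  · have hsol := l2le_sol_sub hk0 (κ := kn) (κ' := κ) ⟨hpn.k0_le_top, hpn.top_le⟩
      ⟨hp.k0_le_top, hp.top_le⟩ X
    rw [← hKs] at hsol
    have := (hXl.add hsol).mono (b := (CA * B + Ks * CR) * S) (by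
      have := mul_le_mul_of_nonneg_left hκS' hKs0
      linarith)
    convert this using 2
    rw [Fin.sum_univ_castSucc]
    simp only [Fin.snoc_castSucc, Fin.snoc_last, ← hkn]
    ring
  · have het : 0 ≤ e * t := mul_nonneg he.le ht
    have heεt : 2 * e * t ≤ ε * t := mul_le_mul_of_nonneg_right heε ht
    refine Fin.lastCases ?_ (fun j => ?_) j
    · rw [Fin.snoc_last, ← hkn]
      linarith
    · rw [Fin.snoc_castSucc]
      have : |Y t j - (a j.castSucc + phase κ (k j.castSucc)) - 4 * k j.castSucc ^ 2 * t| ≤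
        C + e * t := hYd t ht j
      rw [show Y t j - phase κ (k j.castSucc) - a j.castSucc - 4 * k j.castSucc ^ 2 * t =
        Y t j - (a j.castSucc + phase κ (k j.castSucc)) - 4 * k j.castSucc ^ 2 * t by ring]
      linarith

theorem stableTrain {n : ℕ} (k : Fin n → ℝ) (hk : ∀ j, 0 < k j) (hmono : StrictMono k) :
    StableTrain k := by
  induction n with
  | zero => exact stableTrain_zero k
  | succ n ih => exact StableTrain.succ ih hk hmono

theorem Q_eq_three_mul_sol {c : ℝ} (hc : 0 < c) (s : ℝ) : Q c s = 3 * sol (√c / 2) s := by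
  have h1 : cosh (√c * s) = 2 * cosh (√c / 2 * s) ^ 2 - 1 := by
    have := cosh_sq (√c / 2 * s)
    rw [show √c * s = 2 * (√c / 2 * s) by ring, cosh_two_mul]
    linarith
  have h2 := cosh_pos (√c / 2 * s)
  rw [Q, sol, h1, div_pow, sq_sqrt hc.le]
  field_simp
  ring

theorem l2le_sol {k : ℝ} (hk : 0 < k) : L2le (sol k) (2 * k ^ 2 * √(2 / k)) :=
  (l2le_inv_cosh hk).of_abs_le (continuous_sol k) (by positivity) fun x => by
    have h := cosh_pos (k * x)
    rw [sol, abs_of_pos (by positivity), abs_of_pos (by positivity), mul_one_div]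
    gcongr
    exact le_self_pow₀ (one_le_cosh _) two_ne_zero

theorem KdVClass.l2le_sub_sum_sol {q q1 q2 q3 : ℝ → ℝ → ℝ} (hq : KdVClass q q1 q2 q3) {n : ℕ}
    {k : Fin n → ℝ} (hk : ∀ j, 0 < k j) (a : Fin n → ℝ) (t : ℝ) :
    ∃ δ, L2le (fun x => q t x - ∑ j, sol (k j) (x - a j)) δ := by
  obtain ⟨M, hM⟩ := hq.bdd |t|
  obtain ⟨-, h1, -⟩ := hM t le_rfl
  have h2 : L2le (q t) √(∫ x, q t x ^ 2) :=
    ⟨hq.c0.uncurry_left t, sqrt_nonneg _, h1,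
      (sq_sqrt (integral_nonneg fun x => sq_nonneg (q t x))).ge⟩
  obtain ⟨B, hB⟩ := (Set.finite_range fun j => 2 * k j ^ 2 * √(2 / k j)).bddAbove
  exact ⟨_, h2.sub (L2le.sum fun j => ((l2le_sol (hk j)).comp_sub (a j)).mono
    (hB (mem_range_self j)))⟩

end SolitonTrains

/-- `L²`-stability of the sum of `N` solitons of KdV. -/
theorem kdv_sum_of_solitons_L2_stability
    (N : ℕ) (hN : 2 ≤ N) (c : Fin N → ℝ) (hcpos : ∀ j, 0 < c j) (hc : StrictMono c) :
    ∃ α₀ A₀ L₀ γ₀ : ℝ, 0 < α₀ ∧ 0 < A₀ ∧ 0 < L₀ ∧ 0 < γ₀ ∧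
      ∀ L α : ℝ, L₀ < L → 0 < α → α < α₀ →
      ∀ x₀ : Fin N → ℝ, StrictMono x₀ →
        (∀ i j : Fin N, (i : ℕ) + 1 = (j : ℕ) → x₀ i + L < x₀ j) →
      ∀ u : ℝ → ℝ → ℝ, IsKdVSolution u →
        L2sq (fun x => u 0 x - ∑ j, Q (c j) (x - x₀ j)) ≤ α ^ 2 →
        ∃ X : Fin N → ℝ → ℝ, ∀ t : ℝ, 0 ≤ t →
          L2sq (fun x => u t x - ∑ j, Q (c j) (x - X j t)) ≤
            (A₀ * (α + Real.exp (-γ₀ * L))) ^ 2 := by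
  have hk : ∀ j, 0 < √(c j) / 2 := fun j => half_pos (sqrt_pos.2 (hcpos j))
  obtain ⟨σ, A, γ, C, hσ, hA, hγ, -, H⟩ := stableTrain (fun j => √(c j) / 2) hk
    (fun i j hij => div_lt_div_of_pos_right (sqrt_lt_sqrt (hcpos i).le (hc hij)) two_pos) 1 one_pos
  obtain ⟨L₀, hL₀, hexp⟩ := exists_exp_neg_mul_le hγ (half_pos hσ)
  refine ⟨σ, 3 * A, L₀, γ, hσ, by positivity, hL₀, hγ,
    fun L α hL hα hασ x₀ hx₀ hsep u hu hu0 => ?_⟩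
  have hscale : ∀ (t : ℝ) (y : Fin N → ℝ), L2sq (fun x => u t x - ∑ j, Q (c j) (x - y j)) =
      9 * ∫ x, (u t x / 3 - ∑ j, sol (√(c j) / 2) (x - y j)) ^ 2 := fun t y => by
    rw [L2sq, ← integral_const_mul]
    congr 1 with x
    simp only [fun j => Q_eq_three_mul_sol (hcpos j), ← Finset.mul_sum]
    ring
  obtain ⟨q1, q2, q3, hq⟩ := hu.kdVClass
  obtain ⟨δ, hδ⟩ := hq.l2le_sub_sum_sol hk x₀ 0
  rw [hscale] at hu0
  have h0 : L2le (fun x => u 0 x / 3 - ∑ j, sol (√(c j) / 2) (x - x₀ j)) (α / 3) :=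
    ⟨hδ.1, by positivity, hδ.2.2.1, by linarith⟩
  have hX := H L (α / 3) x₀ _ q1 q2 q3 (by linarith [hexp L hL.le]) (fun i j hij => by
    have h1 : (i : ℕ) + 1 < N := lt_of_le_of_lt (Nat.succ_le_of_lt hij) j.2
    have h2 := hsep i ⟨i + 1, h1⟩ rfl
    have h3 : x₀ ⟨i + 1, h1⟩ ≤ x₀ j := hx₀.monotone (Nat.succ_le_of_lt hij)
    linarith) hq h0
  choose! X hX _ using hX
  refine ⟨fun j t => X t j, fun t ht => ?_⟩
  have h1 := (hX t ht).2.2.2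
  rw [hscale, neg_mul]
  have h2 := exp_pos (-(γ * L))
  calc _ ≤ 9 * (A * (α / 3 + exp (-(γ * L)))) ^ 2 := by gcongr
    _ ≤ 9 * (A * (α + exp (-(γ * L)))) ^ 2 := by gcongr; linarith
    _ = _ := by ring
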